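/- arXiv:2206.11227 — 2 statements merged into one kernel-verified Lean document; each statement's English description precedes it below -/
import Mathlib

section
/- There exist constants c > 0 and d₀ ∈ ℕ such that for every dimension d ≥ d₀ and every convex body K ⊂ ℝ^d, the Hadwiger covering number satisfies N(K) ≤ exp(−c·d/L_K²) · 4^d, where L_K is the isotropic constant of K. -/
open MeasureTheory Pointwise

/-- The Hadwiger covering number of `K`: the least `N` such that `K` can be covered by
`N` translates of its interior. -/
noncomputable def coveringNumber {d : ℕ} (K : Set (EuclideanSpace ℝ (Fin d))) : ℕ :=
  sInf {N : ℕ | ∃ x : Fin N → EuclideanSpace ℝ (Fin d), K ⊆ ⋃ i, (x i +ᵥ interior K)}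

/-- The centre of mass of `K`. -/
noncomputable def centroid {d : ℕ} (K : Set (EuclideanSpace ℝ (Fin d))) :
    EuclideanSpace ℝ (Fin d) :=
  (volume K).toReal⁻¹ • ∫ x in K, x

/-- The covariance matrix `Σ_K = E[(X - E X) ⊗ (X - E X)]` of a uniformly random point
`X` of `K`. -/
noncomputable def covMatrix {d : ℕ} (K : Set (EuclideanSpace ℝ (Fin d))) :
    Matrix (Fin d) (Fin d) ℝ :=
  fun i j => (volume K).toReal⁻¹ * ∫ x in K, (x i - centroid K i) * (x j - centroid K j)

/-- The isotropic constant `L_K = (√(det Σ_K) / vol(K))^(1/d)`. -/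
noncomputable def isotropicConstant {d : ℕ} (K : Set (EuclideanSpace ℝ (Fin d))) : ℝ :=
  (Real.sqrt (covMatrix K).det / (volume K).toReal) ^ ((d : ℝ)⁻¹)

open scoped ENNReal

set_option linter.unusedSectionVars false

/-- One-dimensional Brunn–Minkowski inequality for a weighted sum of two sets. -/
theorem Real.brunn_minkowski {A B C : Set ℝ} (hA : MeasurableSet A) (hB : MeasurableSet B)
    (hA' : A.Nonempty) (hB' : B.Nonempty) {s t : ℝ} (hs : 0 < s) (ht : 0 < t)
    (hC : ∀ x ∈ A, ∀ y ∈ B, s * x + t * y ∈ C) :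
    ENNReal.ofReal s * volume A + ENNReal.ofReal t * volume B ≤ volume C := by
  have key : ∀ A' ⊆ A, ∀ B' ⊆ B, IsCompact A' → IsCompact B' → A'.Nonempty → B'.Nonempty →
      ENNReal.ofReal s * volume A' + ENNReal.ofReal t * volume B' ≤ volume C := by
    intro A' hAA B' hBB hcA hcB hnA hnB
    obtain ⟨a, haA, ha⟩ := hcA.exists_isGreatest hnA
    obtain ⟨b, hbB, hb⟩ := hcB.exists_isLeast hnB
    set U : Set ℝ := (fun x => s * x + t * b) '' A' with hU
    set V : Set ℝ := (fun y => s * a + t * y) '' B' with hV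
    have hUc : IsCompact U := hcA.image (by fun_prop)
    have hVc : IsCompact V := hcB.image (by fun_prop)
    have hUv : volume U = ENNReal.ofReal s * volume A' := by
      have : U = (fun x => x + t * b) '' (s • A') := by
        rw [hU, ← Set.image_smul, Set.image_image]; rfl
      rw [this, Set.image_add_right, measure_preimage_add_right, Measure.addHaar_smul]
      simp [abs_of_pos hs]
    have hVv : volume V = ENNReal.ofReal t * volume B' := by
      have : V = (fun x => s * a + x) '' (t • B') := by
        rw [hV, ← Set.image_smul, Set.image_image]; rfl
      rw [this, Set.image_add_left, measure_preimage_add, Measure.addHaar_smul]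
      simp [abs_of_pos ht]
    have hinter : volume (U ∩ V) = 0 := by
      refine measure_mono_null (t := {s * a + t * b}) ?_ (by simp)
      rintro _ ⟨⟨x, hx, rfl⟩, ⟨y, hy, hxy⟩⟩
      have h1 := mul_le_mul_of_nonneg_left (ha hx) hs.le
      have h2 := mul_le_mul_of_nonneg_left (hb hy) ht.le
      simp only [Set.mem_singleton_iff] at *
      linarith
    rw [← hUv, ← hVv, ← measure_union_add_inter U hVc.measurableSet, hinter, add_zero]
    refine measure_mono (Set.union_subset ?_ ?_)
    · rintro _ ⟨x, hx, rfl⟩; exact hC x (hAA hx) b (hBB hbB)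
    · rintro _ ⟨x, hx, rfl⟩; exact hC a (hAA haA) x (hBB hx)
  obtain ⟨a, ha⟩ := hA'
  obtain ⟨b, hb⟩ := hB'
  rw [hA.measure_eq_iSup_isCompact, hB.measure_eq_iSup_isCompact]
  simp only [ENNReal.mul_iSup, iSup_and']
  refine ENNReal.biSup_add_biSup_le' ⟨∅, Set.empty_subset _, isCompact_empty⟩
    ⟨∅, Set.empty_subset _, isCompact_empty⟩ ?_
  rintro A' ⟨hAA, hcA⟩ B' ⟨hBB, hcB⟩
  refine le_trans ?_ (key (insert a A') (Set.insert_subset ha hAA) (insert b B')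
    (Set.insert_subset hb hBB) (hcA.insert a) (hcB.insert b) ⟨a, by simp⟩ ⟨b, by simp⟩)
  gcongr <;> exact Set.subset_insert _ _

theorem ENNReal.geom_mean_le_arith_mean_weighted {l : ℝ} (h0 : 0 < l) (h1 : l < 1) (a b : ℝ≥0∞) :
    a ^ (1 - l) * b ^ l ≤ ENNReal.ofReal (1 - l) * a + ENNReal.ofReal l * b := by
  have h1' : 0 < 1 - l := by linarith
  rcases eq_or_ne a ∞ with rfl | ha
  · rw [ENNReal.mul_top (by simpa using h1)]; simp
  rcases eq_or_ne b ∞ with rfl | hb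
  · rw [ENNReal.mul_top (by simpa using h0)]; simp
  lift a to NNReal using ha
  lift b to NNReal using hb
  have ha := a.coe_nonneg
  have hb := b.coe_nonneg
  have := Real.geom_mean_le_arith_mean2_weighted h1'.le h0.le ha hb (by ring)
  rw [← ENNReal.ofReal_coe_nnreal, ← ENNReal.ofReal_coe_nnreal (p := b),
    ENNReal.ofReal_rpow_of_nonneg ha h1'.le, ENNReal.ofReal_rpow_of_nonneg hb h0.le,
    ← ENNReal.ofReal_mul (by positivity), ← ENNReal.ofReal_mul h1'.le, ← ENNReal.ofReal_mul h0.le,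
    ← ENNReal.ofReal_add (by positivity) (by positivity)]
  exact ENNReal.ofReal_le_ofReal this

theorem lintegral_add_le_of_superlevel_subset {l : ℝ} (h0 : 0 < l) (h1 : l < 1) {f g h : ℝ → ℝ}
    (hf : Measurable f) (hg : Measurable g) (hh : Measurable h) (hf0 : ∀ x, 0 ≤ f x)
    (hg0 : ∀ x, 0 ≤ g x) (hh0 : ∀ x, 0 ≤ h x) (hf1 : ∀ x, f x ≤ 1) (hg1 : ∀ x, g x ≤ 1)
    (hfs : ∀ t < 1, ∃ x, t < f x) (hgs : ∀ t < 1, ∃ x, t < g x)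
    (hfgh : ∀ t > 0, ∀ x y, t < f x → t < g y → t < h ((1 - l) * x + l * y)) :
    ENNReal.ofReal (1 - l) * (∫⁻ x, ENNReal.ofReal (f x)) +
      ENNReal.ofReal l * (∫⁻ x, ENNReal.ofReal (g x)) ≤ ∫⁻ x, ENNReal.ofReal (h x) := by
  rw [lintegral_eq_lintegral_meas_lt _ (ae_of_all _ hf0) hf.aemeasurable,
    lintegral_eq_lintegral_meas_lt _ (ae_of_all _ hg0) hg.aemeasurable,
    lintegral_eq_lintegral_meas_lt _ (ae_of_all _ hh0) hh.aemeasurable]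
  have hanti : ∀ u : ℝ → ℝ, Measurable fun t => volume {a | t < u a} := fun u =>
    Antitone.measurable fun s t hst => measure_mono fun x hx => lt_of_le_of_lt hst hx
  rw [← lintegral_const_mul _ (hanti f), ← lintegral_const_mul _ (hanti g),
    ← lintegral_add_left ((hanti f).const_mul _)]
  refine setLIntegral_mono (hanti h) fun t ht => ?_
  rcases lt_or_ge t 1 with ht1 | ht1
  · exact Real.brunn_minkowski (measurableSet_lt measurable_const hf)
      (measurableSet_lt measurable_const hg) (hfs t ht1) (hgs t ht1) (by linarith) h0
      fun x hx y hy => hfgh t ht x y hx hy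
  · have e1 : {a | t < f a} = ∅ := by
      ext x; simpa using (hf1 x).trans ht1
    have e2 : {a | t < g a} = ∅ := by
      ext x; simpa using (hg1 x).trans ht1
    simp [e1, e2]

theorem exists_lt_toReal_div_iSup {f : ℝ → ℝ≥0∞} (h0 : ⨆ x, f x ≠ 0) (ht : ⨆ x, f x ≠ ∞) (t : ℝ)
    (ht1 : t < 1) : ∃ x, t < (f x / ⨆ x, f x).toReal := by
  rcases lt_or_ge t 0 with hneg | hpos
  · exact ⟨0, hneg.trans_le ENNReal.toReal_nonneg⟩
  have : ENNReal.ofReal t * (⨆ x, f x) < ⨆ x, f x := by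
    conv_rhs => rw [← one_mul (⨆ x, f x)]
    exact (ENNReal.mul_lt_mul_iff_left h0 ht).2 (by simpa using ht1)
  obtain ⟨x, hx⟩ := lt_iSup_iff.1 this
  refine ⟨x, (ENNReal.ofReal_lt_iff_lt_toReal hpos ?_).1 ?_⟩
  · exact ENNReal.div_ne_top ((le_iSup f x).trans_lt ht.lt_top).ne h0
  · exact (ENNReal.lt_div_iff_mul_lt (Or.inl h0) (Or.inl ht)).2 hx

theorem prekopa_leindler_real_of_bounded {l : ℝ} (h0 : 0 < l) (h1 : l < 1) {f g h : ℝ → ℝ≥0∞}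
    (hf : Measurable f) (hg : Measurable g) (hh : Measurable h)
    (hfb : ⨆ x, f x ≠ ∞) (hgb : ⨆ x, g x ≠ ∞)
    (hfgh : ∀ x y, f x ^ (1 - l) * g y ^ l ≤ h ((1 - l) * x + l * y)) :
    (∫⁻ x, f x) ^ (1 - l) * (∫⁻ x, g x) ^ l ≤ ∫⁻ x, h x := by
  have h1' : 0 < 1 - l := by linarith
  set F := ⨆ x, f x with hF
  set G := ⨆ x, g x with hG
  rcases eq_or_ne F 0 with hF0 | hF0
  · have : ∀ x, f x = 0 := fun x => le_bot_iff.1 ((le_iSup f x).trans hF0.le)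
    simp [this, h1']
  rcases eq_or_ne G 0 with hG0 | hG0
  · have : ∀ x, g x = 0 := fun x => le_bot_iff.1 ((le_iSup g x).trans hG0.le)
    simp [this, h0]
  set H := F ^ (1 - l) * G ^ l with hH
  have hFl : F ^ (1 - l) ≠ 0 := by simp [hF0, hfb]
  have hGl : G ^ l ≠ 0 := by simp [hG0, hgb]
  have hH0 : H ≠ 0 := by simp [hH, hF0, hG0, hfb, hgb]
  have hHt : H ≠ ∞ := by
    refine ENNReal.mul_ne_top ?_ ?_ <;> apply ENNReal.rpow_ne_top_of_nonneg <;> simp_all <;> linarith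
  have hfF : ∀ x, f x / F ≤ 1 := fun x => ENNReal.div_le_of_le_mul (by simpa using le_iSup f x)
  have hgG : ∀ x, g x / G ≤ 1 := fun x => ENNReal.div_le_of_le_mul (by simpa using le_iSup g x)
  have hft : ∀ x, f x / F ≠ ∞ := fun x => ((hfF x).trans_lt ENNReal.one_lt_top).ne
  have hgt : ∀ x, g x / G ≠ ∞ := fun x => ((hgG x).trans_lt ENNReal.one_lt_top).ne
  have hht : ∀ x, min (h x / H) 1 ≠ ∞ := fun x => ((min_le_right _ _).trans_lt ENNReal.one_lt_top).ne
  have main := lintegral_add_le_of_superlevel_subset h0 h1 (f := fun x => (f x / F).toReal)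
    (g := fun x => (g x / G).toReal) (h := fun x => (min (h x / H) 1).toReal)
    (by fun_prop) (by fun_prop) (by fun_prop) (fun _ => ENNReal.toReal_nonneg)
    (fun _ => ENNReal.toReal_nonneg) (fun _ => ENNReal.toReal_nonneg)
    (fun x => by simpa using ENNReal.toReal_mono ENNReal.one_ne_top (hfF x))
    (fun x => by simpa using ENNReal.toReal_mono ENNReal.one_ne_top (hgG x))
    (exists_lt_toReal_div_iSup hF0 hfb) (exists_lt_toReal_div_iSup hG0 hgb)
    (fun t ht x y hx hy => by
      rw [← ENNReal.ofReal_lt_iff_lt_toReal ht.le (hft x)] at hx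
      rw [← ENNReal.ofReal_lt_iff_lt_toReal ht.le (hgt y)] at hy
      rw [← ENNReal.ofReal_lt_iff_lt_toReal ht.le (hht _), lt_min_iff]
      refine ⟨?_, hx.trans_le (hfF x)⟩
      have ht0 : ENNReal.ofReal t ≠ 0 := by simpa using ht
      calc ENNReal.ofReal t = ENNReal.ofReal t ^ (1 - l) * ENNReal.ofReal t ^ l := by
            rw [← ENNReal.rpow_add _ _ ht0 ENNReal.ofReal_ne_top]; simp
        _ < (f x / F) ^ (1 - l) * (g y / G) ^ l := by
            exact ENNReal.mul_lt_mul (ENNReal.rpow_lt_rpow hx h1') (ENNReal.rpow_lt_rpow hy h0)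
        _ = (f x ^ (1 - l) * g y ^ l) / H := by
            rw [ENNReal.div_rpow_of_nonneg _ _ h1'.le, ENNReal.div_rpow_of_nonneg _ _ h0.le,
              ENNReal.mul_div_mul_comm (Or.inl hFl) (Or.inr hGl)]
        _ ≤ _ := by gcongr; exact hfgh x y)
  simp only [ENNReal.ofReal_toReal (hft _), ENNReal.ofReal_toReal (hgt _),
    ENNReal.ofReal_toReal (hht _)] at main
  simp only [div_eq_mul_inv] at main
  rw [lintegral_mul_const _ hf, lintegral_mul_const _ hg] at main
  have := (ENNReal.geom_mean_le_arith_mean_weighted h0 h1 _ _).trans (main.trans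
    (lintegral_mono fun x => min_le_left _ _))
  rw [lintegral_mul_const _ hh, ENNReal.mul_rpow_of_nonneg _ _ h1'.le,
    ENNReal.mul_rpow_of_nonneg _ _ h0.le, ENNReal.inv_rpow, ENNReal.inv_rpow, mul_mul_mul_comm,
    ← ENNReal.mul_inv, ← hH, ← div_eq_mul_inv, ← div_eq_mul_inv] at this
  · rwa [ENNReal.div_le_iff hH0 hHt, ENNReal.div_mul_cancel hH0 hHt] at this
  · exact Or.inl hFl
  · exact Or.inr hGl

/-- The Prékopa–Leindler inequality on the line. -/
theorem prekopa_leindler_real {l : ℝ} (h0 : 0 < l) (h1 : l < 1) {f g h : ℝ → ℝ≥0∞}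
    (hf : Measurable f) (hg : Measurable g) (hh : Measurable h)
    (hfgh : ∀ x y, f x ^ (1 - l) * g y ^ l ≤ h ((1 - l) * x + l * y)) :
    (∫⁻ x, f x) ^ (1 - l) * (∫⁻ x, g x) ^ l ≤ ∫⁻ x, h x := by
  have h1' : 0 < 1 - l := by linarith
  rcases eq_or_ne (∫⁻ x, f x) 0 with hF0 | hF0
  · simp [hF0, h1']
  rcases eq_or_ne (∫⁻ x, g x) 0 with hG0 | hG0
  · simp [hG0, h0]
  have lim : ∀ u : ℝ → ℝ≥0∞, Measurable u →
      Filter.Tendsto (fun n : ℕ => ∫⁻ x, min (u x) n) Filter.atTop (nhds (∫⁻ x, u x)) := by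
    intro u hu
    refine lintegral_tendsto_of_tendsto_of_monotone (fun n => by fun_prop) ?_ ?_
    · exact ae_of_all _ fun x m n hmn => min_le_min_left _ (by exact_mod_cast hmn)
    · refine ae_of_all _ fun x => ?_
      have := (tendsto_const_nhds (x := u x)).min ENNReal.tendsto_nat_nhds_top
      simpa using this
  refine le_of_tendsto (ENNReal.Tendsto.mul (((ENNReal.continuous_rpow_const).tendsto _).comp
    (lim f hf)) (Or.inl ?_) (((ENNReal.continuous_rpow_const).tendsto _).comp (lim g hg))
    (Or.inl ?_)) (Filter.Eventually.of_forall fun n => ?_)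
  · simp only [ne_eq, ENNReal.rpow_eq_zero_iff, not_or, not_and, not_lt]
    exact ⟨fun h => absurd h hF0, fun _ => h1'.le⟩
  · simp only [ne_eq, ENNReal.rpow_eq_zero_iff, not_or, not_and, not_lt]
    exact ⟨fun h => absurd h hG0, fun _ => h0.le⟩
  · refine prekopa_leindler_real_of_bounded h0 h1 (by fun_prop) (by fun_prop) hh ?_ ?_ ?_
    · exact ((iSup_le fun x => min_le_right _ _).trans_lt (ENNReal.natCast_lt_top n)).ne
    · exact ((iSup_le fun x => min_le_right _ _).trans_lt (ENNReal.natCast_lt_top n)).ne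
    · refine fun x y => le_trans ?_ (hfgh x y)
      gcongr <;> exact min_le_left _ _

theorem piFinSuccAbove_zero_symm_apply {n : ℕ} (p : ℝ × (Fin n → ℝ)) :
    (MeasurableEquiv.piFinSuccAbove (fun _ : Fin (n + 1) => ℝ) 0).symm p = Fin.cons p.1 p.2 := by
  ext i
  refine Fin.cases ?_ (fun i => ?_) i <;>
    simp [MeasurableEquiv.piFinSuccAbove, Fin.insertNthEquiv]

theorem lintegral_pi_succ (μ : Measure ℝ) [SigmaFinite μ] {n : ℕ} {f : (Fin (n + 1) → ℝ) → ℝ≥0∞}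
    (hf : Measurable f) :
    ∫⁻ x, f x ∂(Measure.pi fun _ => μ) =
      ∫⁻ a, ∫⁻ b, f (Fin.cons a b) ∂(Measure.pi fun _ => μ) ∂μ := by
  rw [← (measurePreserving_piFinSuccAbove (fun _ => μ) 0).symm.lintegral_comp hf,
    lintegral_prod _ (by fun_prop)]
  simp_rw [piFinSuccAbove_zero_symm_apply]

theorem measurable_finCons {n : ℕ} :
    Measurable fun p : ℝ × (Fin n → ℝ) => (Fin.cons p.1 p.2 : Fin (n + 1) → ℝ) := by
  have := (MeasurableEquiv.piFinSuccAbove (fun _ : Fin (n + 1) => ℝ) 0).symm.measurable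
  rwa [funext piFinSuccAbove_zero_symm_apply] at this

theorem measurable_comp_finCons {n : ℕ} {f : (Fin (n + 1) → ℝ) → ℝ≥0∞} (hf : Measurable f)
    (a : ℝ) : Measurable fun b : Fin n → ℝ => f (Fin.cons a b) :=
  hf.comp (measurable_finCons.comp measurable_prodMk_left)

theorem measurable_lintegral_finCons (μ : Measure ℝ) [SigmaFinite μ] {n : ℕ}
    {f : (Fin (n + 1) → ℝ) → ℝ≥0∞} (hf : Measurable f) :
    Measurable fun a => ∫⁻ b : Fin n → ℝ, f (Fin.cons a b) ∂(Measure.pi fun _ => μ) :=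
  (hf.comp measurable_finCons).lintegral_prod_right'

/-- The Prékopa–Leindler inequality. -/
theorem prekopa_leindler {l : ℝ} (h0 : 0 < l) (h1 : l < 1) {n : ℕ} {f g h : (Fin n → ℝ) → ℝ≥0∞}
    (hf : Measurable f) (hg : Measurable g) (hh : Measurable h)
    (hfgh : ∀ x y, f x ^ (1 - l) * g y ^ l ≤ h ((1 - l) • x + l • y)) :
    (∫⁻ x, f x) ^ (1 - l) * (∫⁻ x, g x) ^ l ≤ ∫⁻ x, h x := by
  induction n with
  | zero =>
    have hx : ∀ x : Fin 0 → ℝ, x = 0 := fun x => Subsingleton.elim _ _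
    have e : ∀ u : (Fin 0 → ℝ) → ℝ≥0∞, ∫⁻ x, u x = u 0 := fun u => by
      simp_rw [hx, lintegral_const, volume_pi]; simp
    simpa [e] using hfgh 0 0
  | succ n ih =>
    simp only [volume_pi] at ih ⊢
    rw [lintegral_pi_succ _ hf, lintegral_pi_succ _ hg, lintegral_pi_succ _ hh]
    refine prekopa_leindler_real h0 h1 (measurable_lintegral_finCons _ hf)
      (measurable_lintegral_finCons _ hg) (measurable_lintegral_finCons _ hh) fun a b => ?_
    refine ih (measurable_comp_finCons hf a) (measurable_comp_finCons hg b)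
      (measurable_comp_finCons hh _) fun x y => (hfgh _ _).trans_eq ?_
    congr 1
    ext i
    refine Fin.cases ?_ (fun i => ?_) i <;> simp

/-- Multiplicative form of the Brunn–Minkowski inequality. -/
theorem brunn_minkowski {l : ℝ} (h0 : 0 < l) (h1 : l < 1) {d : ℕ}
    {A B C : Set (EuclideanSpace ℝ (Fin d))} (hA : MeasurableSet A) (hB : MeasurableSet B)
    (hC : MeasurableSet C) (hABC : ∀ x ∈ A, ∀ y ∈ B, (1 - l) • x + l • y ∈ C) :
    volume A ^ (1 - l) * volume B ^ l ≤ volume C := by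
  have h1' : 0 < 1 - l := by linarith
  have e := PiLp.volume_preserving_toLp (Fin d)
  rw [← e.measure_preimage hA.nullMeasurableSet, ← e.measure_preimage hB.nullMeasurableSet,
    ← e.measure_preimage hC.nullMeasurableSet]
  have hA' := e.measurable hA
  have hB' := e.measurable hB
  have hC' := e.measurable hC
  rw [← lintegral_indicator_one hA', ← lintegral_indicator_one hB', ← lintegral_indicator_one hC']
  refine prekopa_leindler h0 h1 (measurable_one.indicator hA') (measurable_one.indicator hB')
    (measurable_one.indicator hC') fun x y => ?_
  by_cases hx : WithLp.toLp 2 x ∈ A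
  · by_cases hy : WithLp.toLp 2 y ∈ B
    · have : WithLp.toLp 2 ((1 - l) • x + l • y) ∈ C := hABC _ hx _ hy
      have : (1 - l) • x + l • y ∈ WithLp.toLp 2 ⁻¹' C := this
      rw [Set.indicator_of_mem (s := _ ⁻¹' C) this]
      simp [Set.indicator, hx, hy]
    · simp [Set.indicator, hy, h0]
  · simp [Set.indicator, hx, h1']

/-- The property `(τ)` of the standard Gaussian measure on the line. -/
theorem gaussianReal_tau {f g : ℝ → ℝ≥0∞} (hf : Measurable f) (hg : Measurable g)
    (hfg : ∀ x y, f x * g y ≤ ENNReal.ofReal (Real.exp ((x - y) ^ 2 / 4))) :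
    (∫⁻ x, f x ∂ProbabilityTheory.gaussianReal 0 1) *
      (∫⁻ x, g x ∂ProbabilityTheory.gaussianReal 0 1) ≤ 1 := by
  set φ := ProbabilityTheory.gaussianPDF 0 1 with hφ
  have hφm : Measurable φ := ProbabilityTheory.measurable_gaussianPDF 0 1
  have e : ∀ u : ℝ → ℝ≥0∞, Measurable u →
      ∫⁻ x, u x ∂ProbabilityTheory.gaussianReal 0 1 = ∫⁻ x, φ x * u x := fun u hu => by
    rw [ProbabilityTheory.gaussianReal_of_var_ne_zero _ one_ne_zero,
      lintegral_withDensity_eq_lintegral_mul _ hφm hu]; rfl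
  rw [e f hf, e g hg]
  have := prekopa_leindler_real (l := 1 / 2) (by norm_num) (by norm_num) (h := φ)
    (hφm.mul hf) (hφm.mul hg) hφm fun x y => ?_
  · rw [ProbabilityTheory.lintegral_gaussianPDF_eq_one _ one_ne_zero] at this
    norm_num at this
    rw [← ENNReal.mul_rpow_of_nonneg _ _ (by norm_num)] at this
    rwa [← ENNReal.one_rpow (1 / 2), ENNReal.rpow_le_rpow_iff (by norm_num)] at this
  · norm_num
    rw [← ENNReal.mul_rpow_of_nonneg _ _ (by norm_num), mul_mul_mul_comm]
    refine (ENNReal.rpow_le_rpow (mul_le_mul_right (hfg x y) _) (by norm_num)).trans ?_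
    simp only [hφ, ProbabilityTheory.gaussianPDF, ProbabilityTheory.gaussianPDFReal]
    rw [← ENNReal.ofReal_mul (by positivity), ← ENNReal.ofReal_mul (by positivity),
      ENNReal.ofReal_rpow_of_nonneg (by positivity) (by norm_num)]
    refine ENNReal.ofReal_le_ofReal ?_
    rw [← Real.sqrt_eq_rpow]
    refine Real.sqrt_le_iff.2 ⟨by positivity, le_of_eq ?_⟩
    simp only [sub_zero]
    rw [mul_pow, ← Real.exp_nat_mul, mul_mul_mul_comm, mul_assoc, ← Real.exp_add, ← Real.exp_add,
      ← pow_two]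
    congr 2
    push_cast
    ring

theorem gaussian_pi_tau {n : ℕ} {f g : (Fin n → ℝ) → ℝ≥0∞} (hf : Measurable f) (hg : Measurable g)
    (hfg : ∀ x y, f x * g y ≤ ENNReal.ofReal (Real.exp ((∑ i, (x i - y i) ^ 2) / 4))) :
    (∫⁻ x, f x ∂Measure.pi fun _ => ProbabilityTheory.gaussianReal 0 1) *
      (∫⁻ x, g x ∂Measure.pi fun _ => ProbabilityTheory.gaussianReal 0 1) ≤ 1 := by
  induction n with
  | zero =>
    have hx : ∀ x : Fin 0 → ℝ, x = 0 := fun x => Subsingleton.elim _ _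
    have e : ∀ u : (Fin 0 → ℝ) → ℝ≥0∞,
        ∫⁻ x, u x ∂(Measure.pi fun _ => ProbabilityTheory.gaussianReal 0 1) = u 0 := fun u => by
      simp_rw [hx, lintegral_const]; simp
    simpa [e] using hfg 0 0
  | succ n ih =>
    rw [lintegral_pi_succ _ hf, lintegral_pi_succ _ hg]
    refine gaussianReal_tau (measurable_lintegral_finCons _ hf)
      (measurable_lintegral_finCons _ hg) fun a b => ?_
    have key := ih (measurable_comp_finCons hf a)
      ((measurable_comp_finCons hg b).mul_const (ENNReal.ofReal (Real.exp (-((a - b) ^ 2 / 4)))))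
      fun x y => ?_
    · rw [lintegral_mul_const _ (measurable_comp_finCons hg b), ← mul_assoc, Real.exp_neg,
        ENNReal.ofReal_inv_of_pos (Real.exp_pos _), ← div_eq_mul_inv] at key
      rwa [ENNReal.div_le_iff (by simp [Real.exp_pos]) (by simp), one_mul] at key
    · rw [← mul_assoc]
      refine (mul_le_mul_left (hfg _ _) _).trans_eq ?_
      rw [← ENNReal.ofReal_mul (by positivity), ← Real.exp_add, Fin.sum_univ_succ]
      simp only [Fin.cons_zero, Fin.cons_succ]
      congr 2
      ring

/-- Exponential concentration of Lipschitz functions for the standard Gaussian measure. -/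
theorem stdGaussian_lintegral_exp_mul_le {E : Type*} [NormedAddCommGroup E] [InnerProductSpace ℝ E]
    [FiniteDimensional ℝ E] [MeasurableSpace E] [BorelSpace E] {F : E → ℝ} (hF : Measurable F)
    {L : ℝ} (hL : ∀ x y, F x - F y ≤ L * ‖x - y‖) :
    (∫⁻ x, ENNReal.ofReal (Real.exp (F x)) ∂ProbabilityTheory.stdGaussian E) *
      (∫⁻ x, ENNReal.ofReal (Real.exp (-F x)) ∂ProbabilityTheory.stdGaussian E) ≤
      ENNReal.ofReal (Real.exp (L ^ 2)) := by
  rw [ProbabilityTheory.stdGaussian, lintegral_map (by fun_prop) (by fun_prop),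
    lintegral_map (by fun_prop) (by fun_prop)]
  set T : (Fin (Module.finrank ℝ E) → ℝ) → E := fun x => ∑ i, x i • stdOrthonormalBasis ℝ E i
    with hT
  have hTm : Measurable T := by fun_prop
  have hnorm : ∀ x y, ‖T x - T y‖ ^ 2 = ∑ i, (x i - y i) ^ 2 := fun x y => by
    have : T x - T y = ∑ i, (x i - y i) • stdOrthonormalBasis ℝ E i := by
      simp [hT, sub_smul]
    rw [this, ← real_inner_self_eq_norm_sq,
      (stdOrthonormalBasis ℝ E).orthonormal.inner_sum]
    simp [pow_two]
  have key := gaussian_pi_tau (f := fun x => ENNReal.ofReal (Real.exp (F (T x))))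
    (g := fun x => ENNReal.ofReal (Real.exp (-F (T x))) * ENNReal.ofReal (Real.exp (-L ^ 2)))
    (by fun_prop) (by fun_prop) fun x y => ?_
  · rw [lintegral_mul_const _ (by fun_prop), ← mul_assoc, Real.exp_neg,
      ENNReal.ofReal_inv_of_pos (Real.exp_pos _), ← div_eq_mul_inv] at key
    rwa [ENNReal.div_le_iff (by simp [Real.exp_pos]) (by simp), one_mul] at key
  · rw [← ENNReal.ofReal_mul (by positivity), ← ENNReal.ofReal_mul (by positivity), ← Real.exp_add,
      ← Real.exp_add, ← hnorm]
    refine ENNReal.ofReal_le_ofReal (Real.exp_le_exp.2 ?_)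
    nlinarith [hL (T x) (T y), sq_nonneg (‖T x - T y‖ / 2 - L)]

section MidpointIteration

variable {F : Type*} [NormedAddCommGroup F] [InnerProductSpace ℝ F] [FiniteDimensional ℝ F]
  [MeasurableSpace F] [BorelSpace F]

/-- The law of the midpoint of two independent points with law `ν`. -/
noncomputable def midLaw (ν : Measure F) : Measure F :=
  (ν.prod ν).map fun p => (2⁻¹ : ℝ) • (p.1 + p.2)

theorem midLaw_mono {ν ν' : Measure F} [SFinite ν] [SFinite ν'] (h : ν ≤ ν') :
    midLaw ν ≤ midLaw ν' :=
  Measure.map_mono (Measure.prod_mono h h) (by fun_prop)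

theorem midLaw_smul (a : ℝ≥0∞) (ν : Measure F) [SFinite ν] :
    midLaw (a • ν) = (a * a) • midLaw ν := by
  rw [midLaw, Measure.prod_smul_left, Measure.prod_smul_right, smul_smul, Measure.map_smul, midLaw]

theorem midLaw_map {G : Type*} [NormedAddCommGroup G] [InnerProductSpace ℝ G]
    [FiniteDimensional ℝ G] [MeasurableSpace G] [BorelSpace G] (ν : Measure F) [SFinite ν]
    (f : F → G) (hf : Measurable f)
    (h : ∀ x y, f ((2⁻¹ : ℝ) • (x + y)) = (2⁻¹ : ℝ) • (f x + f y)) :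
    midLaw (ν.map f) = (midLaw ν).map f := by
  rw [midLaw, midLaw, Measure.map_prod_map _ _ hf hf, Measure.map_map (by fun_prop) (by fun_prop),
    Measure.map_map (by fun_prop) (by fun_prop)]
  congr 1
  funext p
  exact (h p.1 p.2).symm

/-- If `ν` is centred, midpoints halve the second moment. -/
theorem midLaw_moments {ν : Measure F} [IsProbabilityMeasure ν] (h2 : MemLp id 2 ν)
    (h0 : ∫ x, x ∂ν = 0) :
    IsProbabilityMeasure (midLaw ν) ∧ MemLp id 2 (midLaw ν) ∧ ∫ x, x ∂midLaw ν = 0 ∧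
      ∫ x, ‖x‖ ^ 2 ∂midLaw ν = 2⁻¹ * ∫ x, ‖x‖ ^ 2 ∂ν := by
  have hm : Measurable fun p : F × F => (2⁻¹ : ℝ) • (p.1 + p.2) := by fun_prop
  have h1 : Integrable (fun x : F => x) ν := h2.integrable (by norm_num)
  have i1 : Integrable (fun p : F × F => p.1) (ν.prod ν) := h1.comp_fst ν
  have i2 : Integrable (fun p : F × F => p.2) (ν.prod ν) := h1.comp_snd ν
  have hsq : Integrable (fun x : F => ‖x‖ ^ 2) ν := h2.norm.integrable_sq
  have s1 : Integrable (fun p : F × F => ‖p.1‖ ^ 2) (ν.prod ν) := hsq.comp_fst ν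
  have s2 : Integrable (fun p : F × F => ‖p.2‖ ^ 2) (ν.prod ν) := hsq.comp_snd ν
  have l1 : MemLp (fun p : F × F => p.1) 2 (ν.prod ν) :=
    (memLp_two_iff_integrable_sq_norm (by fun_prop)).2 s1
  have l2 : MemLp (fun p : F × F => p.2) 2 (ν.prod ν) :=
    (memLp_two_iff_integrable_sq_norm (by fun_prop)).2 s2
  have ii : Integrable (fun p : F × F => inner ℝ p.1 p.2) (ν.prod ν) := by
    refine ((s1.add s2)).mono' (by fun_prop) (ae_of_all _ fun p => ?_)
    simp only [Pi.add_apply]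
    refine (norm_inner_le_norm _ _).trans ?_
    nlinarith [sq_nonneg (‖p.1‖ - ‖p.2‖), sq_nonneg (‖p.1‖), sq_nonneg (‖p.2‖)]
  have ii0 : ∫ p : F × F, inner ℝ p.1 p.2 ∂(ν.prod ν) = 0 := by
    rw [integral_prod _ ii]
    simp_rw [integral_inner h1, h0, inner_zero_right, integral_zero]
  refine ⟨Measure.isProbabilityMeasure_map hm.aemeasurable, ?_, ?_, ?_⟩
  · rw [midLaw, memLp_map_measure_iff (by fun_prop) hm.aemeasurable]
    exact (l1.add l2).const_smul _
  · rw [midLaw, integral_map hm.aemeasurable (by fun_prop), integral_smul, integral_add i1 i2,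
      integral_fun_fst (μ := ν) (ν := ν) (fun x => x),
      integral_fun_snd (μ := ν) (ν := ν) (fun x => x)]
    simp [h0]
  · rw [midLaw, integral_map hm.aemeasurable (by fun_prop)]
    have e : ∀ p : F × F, ‖(2⁻¹ : ℝ) • (p.1 + p.2)‖ ^ 2 =
        4⁻¹ * (‖p.1‖ ^ 2 + ‖p.2‖ ^ 2) + 2⁻¹ * inner ℝ p.1 p.2 := fun p => by
      rw [norm_smul, mul_pow, norm_add_sq_real]; norm_num; ring
    simp_rw [e]
    rw [integral_add (by exact (s1.add s2).const_mul _) (ii.const_mul _), integral_const_mul,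
      integral_const_mul, ii0, integral_add s1 s2,
      integral_fun_fst (μ := ν) (ν := ν) (fun x => ‖x‖ ^ 2),
      integral_fun_snd (μ := ν) (ν := ν) (fun x => ‖x‖ ^ 2)]
    simp
    ring

theorem exists_iterated_midLaw {γ : Measure F} [IsProbabilityMeasure γ] (h2 : MemLp id 2 γ)
    (h0 : ∫ x, x ∂γ = 0) {M : ℝ≥0∞} (hM : midLaw γ ≤ M • γ) (m : ℕ) :
    ∃ ν : Measure F, IsProbabilityMeasure ν ∧ MemLp id 2 ν ∧ ∫ x, x ∂ν = 0 ∧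
      ∫ x, ‖x‖ ^ 2 ∂ν = (2 ^ m)⁻¹ * ∫ x, ‖x‖ ^ 2 ∂γ ∧ ν ≤ M ^ (2 ^ m - 1) • γ := by
  induction m with
  | zero => exact ⟨γ, inferInstance, h2, h0, by simp, by simp⟩
  | succ m ih =>
    obtain ⟨ν, hν, hν2, hν0, hνs, hle⟩ := ih
    obtain ⟨a, b, c, e⟩ := midLaw_moments hν2 hν0
    refine ⟨midLaw ν, a, b, c, ?_, ?_⟩
    · rw [e, hνs, pow_succ]; field_simp
    · refine (midLaw_mono hle).trans ?_
      rw [midLaw_smul]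
      have : 2 ^ (m + 1) - 1 = (2 ^ m - 1) + (2 ^ m - 1) + 1 := by
        have := Nat.one_le_two_pow (n := m); rw [pow_succ]; omega
      rw [this, pow_succ _ ((2 ^ m - 1) + (2 ^ m - 1)), pow_add, mul_smul _ M]
      refine Measure.le_iff.2 fun s _ => ?_
      simp only [Measure.smul_apply, smul_eq_mul]
      gcongr
      simpa using hM s

/-- A centred measure that dominates its midpoint law charges balls of radius a small multiple
of its standard deviation. -/
theorem half_le_of_midLaw_le {γ : Measure F} [IsProbabilityMeasure γ] (h2 : MemLp id 2 γ)
    (h0 : ∫ x, x ∂γ = 0) {M : ℝ≥0∞} (hM : midLaw γ ≤ M • γ) (m : ℕ) {R : ℝ} (hR : 0 < R)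
    (hR2 : 2 * ∫ x, ‖x‖ ^ 2 ∂γ ≤ 2 ^ m * R ^ 2) :
    2⁻¹ ≤ M ^ (2 ^ m - 1) * γ (Metric.closedBall 0 R) := by
  obtain ⟨ν, hν, hν2, hν0, hνs, hle⟩ := exists_iterated_midLaw h2 h0 hM m
  have hsq : Integrable (fun x : F => ‖x‖ ^ 2) ν := hν2.norm.integrable_sq
  have mk := mul_meas_ge_le_integral_of_nonneg (ae_of_all _ fun x => by positivity) hsq (R ^ 2)
  have h3 : ν.real {x | R ^ 2 ≤ ‖x‖ ^ 2} ≤ 1 / 2 := by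
    have hp : (0 : ℝ) < 2 ^ m := by positivity
    rw [hνs] at mk
    have : (2 ^ m)⁻¹ * ∫ x, ‖x‖ ^ 2 ∂γ ≤ R ^ 2 / 2 := by
      rw [inv_mul_le_iff₀ hp]; linarith
    nlinarith [sq_pos_of_pos hR]
  have h4 : (Metric.closedBall (0 : F) R)ᶜ ⊆ {x | R ^ 2 ≤ ‖x‖ ^ 2} := fun x hx => by
    simp only [Set.mem_compl_iff, mem_closedBall_zero_iff, not_le] at hx
    exact pow_le_pow_left₀ hR.le hx.le 2
  have h5 : 1 / 2 ≤ ν.real (Metric.closedBall (0 : F) R) := by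
    have := measureReal_mono (μ := ν) h4
    rw [probReal_compl_eq_one_sub Metric.isClosed_closedBall.measurableSet] at this
    linarith
  calc (2⁻¹ : ℝ≥0∞) = ENNReal.ofReal (1 / 2) := by
        rw [one_div, ENNReal.ofReal_inv_of_pos (by norm_num)]; simp
    _ ≤ ν (Metric.closedBall 0 R) := ENNReal.ofReal_le_of_le_toReal h5
    _ ≤ _ := by simpa using hle (Metric.closedBall 0 R)

end MidpointIteration

section Covering

variable {d : ℕ}

/-- If every point of the finite set `Y` lies in many translates `c +ᵥ A` with centre in `D`, then
few translates cover most of `Y`. -/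
theorem exists_card_uncovered_le {A D : Set (EuclideanSpace ℝ (Fin d))} (hA : MeasurableSet A)
    (Y : Finset (EuclideanSpace ℝ (Fin d)))
    (hD : ∀ y ∈ Y, ∀ c, y - c ∈ A → c ∈ D) {p : ℝ} (hp0 : 0 < p) (hp1 : p ≤ 1)
    (hDfin : volume D ≠ ∞)
    (hp : ENNReal.ofReal p * volume D ≤ volume A) (hD0 : volume D ≠ 0) (N : ℕ) :
    ∃ C : Finset (EuclideanSpace ℝ (Fin d)), C.card ≤ N ∧
      ∃ R : Finset (EuclideanSpace ℝ (Fin d)), R ⊆ Y ∧ (∀ y ∈ Y, y ∉ R → ∃ c ∈ C, y - c ∈ A) ∧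
        (R.card : ℝ) ≤ (1 - p) ^ N * Y.card := by
  classical
  induction N with
  | zero => exact ⟨∅, by simp, Y, subset_rfl, fun y hy h => absurd hy h, by simp⟩
  | succ N ih =>
    obtain ⟨C, hC, R, hRY, hcov, hR⟩ := ih
    obtain ⟨c, hc⟩ : ∃ c, p * R.card ≤ ((R.filter fun y => y - c ∈ A).card : ℝ) := by
      by_contra! hcon
      have hm : ∀ y, MeasurableSet {c | y - c ∈ A} := fun y =>
        hA.preimage (by fun_prop : Measurable fun c => y - c)
      have hv : ∀ y, volume {c | y - c ∈ A} = volume A := fun y =>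
        (Measure.measurePreserving_sub_left volume y).measure_preimage hA.nullMeasurableSet
      have h1 : ∫⁻ c in toMeasurable volume D, ∑ y ∈ R, ({c | y - c ∈ A}.indicator 1 c : ℝ≥0∞) =
          R.card * volume A := by
        rw [lintegral_finsetSum _ fun y _ => measurable_one.indicator (hm y)]
        rw [Finset.sum_congr rfl (g := fun _ => volume A), Finset.sum_const, nsmul_eq_mul]
        intro y hy
        rw [lintegral_indicator_one (hm y), Measure.restrict_apply (hm y),
          Set.inter_eq_self_of_subset_left, hv]
        exact fun c hc => subset_toMeasurable _ _ (hD y (hRY hy) c hc)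
      have h2 : ∀ c, ∑ y ∈ R, ({c | y - c ∈ A}.indicator 1 c : ℝ≥0∞) =
          ((R.filter fun y => y - c ∈ A).card : ℝ≥0∞) := fun c => by
        simp [Set.indicator_apply, Finset.sum_boole]
      simp_rw [h2] at h1
      have h3 : ∫⁻ c in toMeasurable volume D, ((R.filter fun y => y - c ∈ A).card : ℝ≥0∞) <
          ∫⁻ c in toMeasurable volume D, ENNReal.ofReal (p * R.card) := by
        refine lintegral_strict_mono ?_ (by fun_prop) ?_ (ae_of_all _ fun c => ?_)
        · simpa [Measure.restrict_eq_zero, measure_toMeasurable] using hD0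
        · rw [h1]
          refine ENNReal.mul_ne_top (by simp) ?_
          intro h
          rcases R.eq_empty_or_nonempty with rfl | ⟨y, hy⟩
          · simpa using hcon 0
          have : volume {c | y - c ∈ A} ≤ volume D := measure_mono fun c hc => hD y (hRY hy) c hc
          rw [hv, h] at this
          exact hDfin (top_le_iff.1 this)
        · rw [← ENNReal.ofReal_natCast]
          exact (ENNReal.ofReal_lt_ofReal_iff_of_nonneg (by positivity)).2 (hcon c)
      rw [h1, lintegral_const, Measure.restrict_apply_univ, measure_toMeasurable,
        ENNReal.ofReal_mul hp0.le, ENNReal.ofReal_natCast] at h3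
      refine absurd h3 (not_lt.2 ?_)
      calc _ = R.card * (ENNReal.ofReal p * volume D) := by ring
        _ ≤ _ := by gcongr
    refine ⟨insert c C, (Finset.card_insert_le _ _).trans (by omega),
      R.filter fun y => y - c ∉ A, (Finset.filter_subset _ _).trans hRY, ?_, ?_⟩
    · intro y hy hyR
      by_cases h : y ∈ R
      · refine ⟨c, by simp, ?_⟩
        by_contra hA'
        exact hyR (by simp [h, hA'])
      · obtain ⟨c', hc', h'⟩ := hcov y hy h
        exact ⟨c', by simp [hc'], h'⟩
    · have e := Finset.card_filter_add_card_filter_not (s := R) (fun y => y - c ∈ A)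
      have e' : (((R.filter fun y => y - c ∈ A).card : ℝ) +
        (R.filter fun y => y - c ∉ A).card) = R.card := by exact_mod_cast e
      rw [pow_succ]
      nlinarith

/-- A finite maximal separated set. -/
theorem exists_finset_separated {K A : Set (EuclideanSpace ℝ (Fin d))} (B : ℕ)
    (hB : ∀ Y : Finset (EuclideanSpace ℝ (Fin d)), ↑Y ⊆ K →
      (∀ x ∈ Y, ∀ y ∈ Y, x ≠ y → x - y ∉ A) → Y.card ≤ B)
    (hA0 : (0 : EuclideanSpace ℝ (Fin d)) ∈ A) (hAs : ∀ x ∈ A, -x ∈ A) :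
    ∃ Y : Finset (EuclideanSpace ℝ (Fin d)), ↑Y ⊆ K ∧ Y.card ≤ B ∧
      ∀ x ∈ K, ∃ y ∈ Y, x - y ∈ A := by
  classical
  set P : Set ℕ := {N | ∃ Y : Finset (EuclideanSpace ℝ (Fin d)), ↑Y ⊆ K ∧
      (∀ x ∈ Y, ∀ y ∈ Y, x ≠ y → x - y ∉ A) ∧ Y.card = N}
  have hP : BddAbove P := ⟨B, by rintro _ ⟨Y, h1, h2, rfl⟩; exact hB Y h1 h2⟩
  obtain ⟨Y, h1, h2, h3⟩ := Nat.sSup_mem (s := P) ⟨0, ∅, by simp⟩ hP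
  refine ⟨Y, h1, hB Y h1 h2, fun x hx => ?_⟩
  by_contra! hcon
  have hxY : x ∉ Y := fun h => hcon x h (by simpa using hA0)
  have : (insert x Y).card ∈ P := by
    refine ⟨insert x Y, ?_, ?_, rfl⟩
    · simpa [Set.insert_subset_iff] using ⟨hx, h1⟩
    · intro u hu v hv huv
      rw [Finset.mem_insert] at hu hv
      rcases hu with rfl | hu <;> rcases hv with rfl | hv
      · exact absurd rfl huv
      · exact hcon v hv
      · exact fun h => hcon u hu (by simpa using hAs _ h)
      · exact h2 u hu v hv huv
  have := le_csSup hP this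
  rw [Finset.card_insert_of_notMem hxY, h3] at this
  omega

theorem volume_preimage_add_two_smul {K : Set (EuclideanSpace ℝ (Fin d))}
    (z : EuclideanSpace ℝ (Fin d)) :
    volume ((fun c => c + z) ⁻¹' ((2 : ℝ) • K)) = 2 ^ d * volume K := by
  rw [measure_preimage_add_right, Measure.addHaar_smul]
  simp

/-- Covering a convex body using a large symmetric section `K ∩ (2 • z - K)`. -/
theorem coveringNumber_le_of_symmetric {K : Set (EuclideanSpace ℝ (Fin d))} (hd : 1 ≤ d)
    (hK : IsCompact K) (hconv : Convex ℝ K) (hInt : (interior K).Nonempty)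
    (z : EuclideanSpace ℝ (Fin d)) {θ : ℝ} (hθ : 2⁻¹ ^ d ≤ θ)
    (hS : ENNReal.ofReal θ * volume K ≤ volume {s | z + s ∈ K ∧ z - s ∈ K}) :
    (coveringNumber K : ℝ) ≤ 66 * d ^ 2 * 2 ^ d / θ := by
  set S : Set (EuclideanSpace ℝ (Fin d)) := {s | z + s ∈ K ∧ z - s ∈ K} with hSdef
  have hd0 : (0 : ℝ) < d := by exact_mod_cast hd
  have hd1 : (1 : ℝ) ≤ d := by exact_mod_cast hd
  have hθ0 : 0 < θ := lt_of_lt_of_le (by positivity) hθ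
  have hKfin : volume K ≠ ∞ := hK.measure_lt_top.ne
  have hK0 : volume K ≠ 0 := ((isOpen_interior.measure_pos volume hInt).trans_le
    (measure_mono interior_subset)).ne'
  have hScl : IsClosed S := by
    have a : IsClosed ((fun s => z + s) ⁻¹' K) := hK.isClosed.preimage (by fun_prop)
    have b : IsClosed ((fun s => z - s) ⁻¹' K) := hK.isClosed.preimage (by fun_prop)
    exact a.inter b
  have hSK : S ⊆ (fun s => z + s) ⁻¹' K := fun s hs => hs.1
  have hSvol : volume S ≤ volume K := (measure_mono hSK).trans_eq (measure_preimage_add _ _ _)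
  have hSfin : volume S ≠ ∞ := (hSvol.trans_lt hK.measure_lt_top).ne
  have hθ1 : θ ≤ 1 := by
    have : ENNReal.ofReal θ * volume K ≤ 1 * volume K := by rw [one_mul]; exact hS.trans hSvol
    have := (ENNReal.mul_le_mul_iff_left hK0 hKfin).1 this
    simpa using this
  have hS0 : volume S ≠ 0 := by
    intro h
    rw [h, nonpos_iff_eq_zero, mul_eq_zero] at hS
    rcases hS with h | h
    · simp at h; linarith
    · exact hK0 h
  have hSsymm : ∀ s ∈ S, -s ∈ S := fun s hs => ⟨by simpa [sub_eq_add_neg] using hs.2,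
    by simpa using hs.1⟩
  have hSconv : Convex ℝ S := by
    intro x hx y hy a b ha hb hab
    constructor
    · have := hconv hx.1 hy.1 ha hb hab
      convert this using 1
      rw [smul_add, smul_add, add_add_add_comm, ← add_smul, hab, one_smul]
    · have := hconv hx.2 hy.2 ha hb hab
      convert this using 1
      have : a • z + b • z = z := by rw [← add_smul, hab, one_smul]
      nth_rewrite 1 [← this]
      module
  obtain ⟨s0, hs0⟩ : (interior S).Nonempty := by
    by_contra hcon
    rw [Set.not_nonempty_iff_eq_empty] at hcon
    have h1 : S ⊆ frontier S := by
      rw [frontier, hcon, Set.sdiff_empty]; exact subset_closure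
    exact hS0 (measure_mono_null h1 (hSconv.addHaar_frontier volume))
  have hzS : (0 : EuclideanSpace ℝ (Fin d)) ∈ S := by
    have := hSconv (interior_subset hs0) (hSsymm _ (interior_subset hs0))
      (a := 1 / 2) (b := 1 / 2) (by norm_num) (by norm_num) (by norm_num)
    simpa using this
  have hzint : z ∈ interior K := by
    have h1 : z + s0 ∈ interior K := by
      have : z +ᵥ interior S ⊆ interior K := by
        refine interior_maximal ?_ (isOpen_interior.vadd z)
        rintro _ ⟨s, hs, rfl⟩
        exact (interior_subset hs).1
      exact this ⟨s0, hs0, rfl⟩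
    have h2 : z - s0 ∈ K := (interior_subset hs0).2
    have := hconv.combo_interior_self_mem_interior h1 h2 (a := 1 / 2) (b := 1 / 2)
      (by norm_num) (by norm_num) (by norm_num)
    convert this using 1
    module
  set η : ℝ := 1 / (4 * d) with hη
  have hη0 : 0 < η := by positivity
  have hη4 : η ≤ 1 / 4 := by rw [hη]; gcongr; linarith
  set D : Set (EuclideanSpace ℝ (Fin d)) := (fun c => c + z) ⁻¹' ((2 : ℝ) • K) with hDdef
  have hDvol : volume D = 2 ^ d * volume K := volume_preimage_add_two_smul z
  have hDmem : ∀ y ∈ K, ∀ c t : EuclideanSpace ℝ (Fin d), t ∈ S → c = y + t →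
      c ∈ D := by
    intro y hy c t ht hc
    refine ⟨(1 / 2 : ℝ) • y + (1 / 2 : ℝ) • (z + t), hconv hy ht.1 (by norm_num) (by norm_num)
      (by norm_num), ?_⟩
    rw [hc]; module
  have hscale : ∀ a : ℝ, 0 ≤ a → a ≤ 1 → ∀ t ∈ a • S, t ∈ S := by
    rintro a ha0 ha1 _ ⟨s, hs, rfl⟩
    have := hSconv hs hzS ha0 (by linarith : 0 ≤ 1 - a) (by ring)
    simpa using this
  obtain ⟨Y, hYK, hYcard, hYnet⟩ : ∃ Y : Finset (EuclideanSpace ℝ (Fin d)), ↑Y ⊆ K ∧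
      Y.card ≤ (32 * d) ^ d ∧ ∀ x ∈ K, ∃ y ∈ Y, x - y ∈ η • S := by
    refine exists_finset_separated _ (fun Y hYK hsep => ?_) ⟨0, hzS, by simp⟩ ?_
    · have hm : MeasurableSet ((η / 2) • S) := by
        exact (hScl.smul_of_ne_zero (by positivity)).measurableSet
      have hdisj : (Y : Set (EuclideanSpace ℝ (Fin d))).PairwiseDisjoint
          fun y => (fun c => c - y) ⁻¹' ((η / 2) • S) := by
        intro x hx y hy hxy
        refine Set.disjoint_left.2 ?_
        rintro c ⟨s, hs, hsx⟩ ⟨t, ht, hty⟩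
        refine hsep x hx y hy hxy ?_
        refine ⟨(1 / 2 : ℝ) • t + (1 / 2 : ℝ) • (-s), hSconv ht (hSsymm _ hs) (by norm_num)
          (by norm_num) (by norm_num), ?_⟩
        have : x - y = (c - y) - (c - x) := by abel
        simp only at hsx hty ⊢
        rw [this, ← hsx, ← hty]; module
      have h1 : volume (⋃ y ∈ Y, (fun c => c - y) ⁻¹' ((η / 2) • S)) =
          Y.card * volume ((η / 2) • S) := by
        rw [measure_biUnion_finset hdisj fun y _ => hm.preimage (by fun_prop)]
        simp [sub_eq_add_neg, measure_preimage_add_right]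
      have h2 : (⋃ y ∈ Y, (fun c => c - y) ⁻¹' ((η / 2) • S)) ⊆ D := by
        intro c hc
        simp only [Set.mem_iUnion] at hc
        obtain ⟨y, hy, hc⟩ := hc
        exact hDmem y (hYK hy) c _
          (hscale _ (by positivity) (by linarith) _ hc) (by simp)
      have h3 := measure_mono (μ := volume) h2
      rw [h1, hDvol, Measure.addHaar_smul, finrank_euclideanSpace_fin,
        abs_of_nonneg (by positivity)] at h3
      have h4 : (Y.card : ℝ≥0∞) * (ENNReal.ofReal ((η / 2) ^ d) * (ENNReal.ofReal θ * volume K)) ≤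
          2 ^ d * volume K := le_trans (by gcongr) h3
      rw [← mul_assoc, ← mul_assoc, ENNReal.mul_le_mul_iff_left hK0 hKfin,
        ← ENNReal.ofReal_natCast, ← ENNReal.ofReal_mul (by positivity),
        ← ENNReal.ofReal_mul (by positivity),
        show (2 : ℝ≥0∞) = ENNReal.ofReal 2 by simp, ← ENNReal.ofReal_pow (by norm_num),
        ENNReal.ofReal_le_ofReal_iff (by positivity)] at h4
      have h5 : (Y.card : ℝ) ≤ (32 * d) ^ d := by
        have e1 : (η / 2) ^ d * 2⁻¹ ^ d * (32 * d) ^ d = (2 : ℝ) ^ d := by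
          rw [← mul_pow, ← mul_pow]; congr 1; rw [hη]; field_simp; norm_num
        have : (0:ℝ) < (η / 2) ^ d * 2⁻¹ ^ d := by positivity
        refine le_of_mul_le_mul_left ?_ this
        rw [e1]
        refine le_trans ?_ h4
        calc _ = (Y.card : ℝ) * (η / 2) ^ d * 2⁻¹ ^ d := by ring
          _ ≤ _ := by gcongr
      exact_mod_cast h5
    · rintro _ ⟨s, hs, rfl⟩
      exact ⟨-s, hSsymm s hs, by simp⟩
  set A : Set (EuclideanSpace ℝ (Fin d)) := (1 - 2 * η) • S with hA
  have hAm : MeasurableSet A := (hScl.smul_of_ne_zero (by linarith)).measurableSet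
  set p : ℝ := θ / (2 * 2 ^ d) with hp
  have hp0 : 0 < p := by positivity
  have hp1 : p ≤ 1 := by
    rw [hp, div_le_one (by positivity)]
    nlinarith [one_le_pow₀ (M₀ := ℝ) (a := 2) (by norm_num) (n := d)]
  have hpow : (1 / 2 : ℝ) ≤ (1 - 2 * η) ^ d := by
    have := one_add_mul_le_pow (a := -(2 * η)) (by linarith) d
    have e : (d : ℝ) * (-(2 * η)) = -(1 / 2) := by rw [hη]; field_simp; norm_num
    rw [e] at this
    calc (1 / 2 : ℝ) = 1 + -(1 / 2) := by norm_num
      _ ≤ _ := this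
      _ = _ := by ring
  have hpD : ENNReal.ofReal p * volume D ≤ volume A := by
    rw [hDvol, hA, Measure.addHaar_smul, finrank_euclideanSpace_fin,
      abs_of_nonneg (by apply pow_nonneg; linarith)]
    calc ENNReal.ofReal p * (2 ^ d * volume K) = ENNReal.ofReal (p * 2 ^ d) * volume K := by
          rw [ENNReal.ofReal_mul hp0.le, ENNReal.ofReal_pow (by norm_num)]; simp [mul_assoc]
      _ ≤ ENNReal.ofReal ((1 - 2 * η) ^ d * θ) * volume K := by
          refine mul_le_mul_left (ENNReal.ofReal_le_ofReal ?_) _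
          rw [hp]
          calc θ / (2 * 2 ^ d) * 2 ^ d = 1 / 2 * θ := by field_simp
            _ ≤ _ := by gcongr
      _ = ENNReal.ofReal ((1 - 2 * η) ^ d) * (ENNReal.ofReal θ * volume K) := by
          rw [ENNReal.ofReal_mul (by apply pow_nonneg; linarith), mul_assoc]
      _ ≤ _ := by gcongr
  set L : ℝ := Real.log ((32 * d) ^ d) with hL
  have hL0 : 0 ≤ L := Real.log_nonneg (one_le_pow₀ (by linarith))
  set N : ℕ := ⌊L / p⌋₊ + 1 with hN
  have hNlt : L / p < N := by rw [hN]; push_cast; exact Nat.lt_floor_add_one _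
  obtain ⟨C, hCcard, R, hRY, hcov, hR⟩ := exists_card_uncovered_le hAm Y (D := D)
    (fun y hy c hc => hDmem y (hYK hy) c (-(y - c))
      (hSsymm _ (hscale _ (by linarith) (by linarith) _ hc)) (by abel)) hp0 hp1
      (by rw [hDvol]; exact ENNReal.mul_ne_top (by simp) hKfin) hpD
      (by rw [hDvol]; exact mul_ne_zero (by simp) hK0) N
  have hRempty : R = ∅ := by
    rw [← Finset.card_eq_zero, ← Nat.lt_one_iff]
    have h1 : (R.card : ℝ) < 1 := by
      have hY' : (Y.card : ℝ) ≤ (32 * d) ^ d := by exact_mod_cast hYcard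
      have h32 : (0 : ℝ) < (32 * d) ^ d := by positivity
      calc (R.card : ℝ) ≤ (1 - p) ^ N * Y.card := hR
        _ ≤ (Real.exp (-p)) ^ N * (32 * d) ^ d := by
            have := Real.add_one_le_exp (-p)
            have h1p : 0 ≤ 1 - p := by linarith
            gcongr
            linarith
        _ = Real.exp (-(p * N) + L) := by
            rw [Real.exp_add, hL, Real.exp_log h32, ← Real.exp_nat_mul]; congr 2; ring
        _ < 1 := by
            rw [Real.exp_lt_one_iff]
            rw [div_lt_iff₀ hp0] at hNlt
            linarith
    exact_mod_cast h1
  have hfinal : coveringNumber K ≤ N := by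
    refine le_trans (Nat.sInf_le ?_) hCcard
    refine ⟨fun i => (C.equivFin.symm i : EuclideanSpace ℝ (Fin d)) - z, fun x hx => ?_⟩
    obtain ⟨y, hy, s, hs, hxy⟩ := hYnet x hx
    obtain ⟨c, hc, t, ht, hyc⟩ := hcov y hy (by simp [hRempty])
    refine Set.mem_iUnion.2 ⟨C.equivFin ⟨c, hc⟩, ?_⟩
    simp only [Equiv.symm_apply_apply]
    rw [Set.mem_vadd_set_iff_neg_vadd_mem, vadd_eq_add]
    have hw : ((1 - 2 * η) / (1 - η)) • t + (η / (1 - η)) • s ∈ S := by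
      have h1 : 0 < 1 - η := by linarith
      refine hSconv ht hs (div_nonneg (by linarith) h1.le) (by positivity) ?_
      field_simp; ring
    have := hconv.combo_self_interior_mem_interior hw.1 hzint (a := 1 - η) (b := η)
      (by linarith) hη0 (by ring)
    convert this using 1
    have e1 : x = c + (1 - 2 * η) • t + η • s := by
      simp only at hxy hyc
      rw [hyc, hxy]; abel
    have h1 : (1 - η) ≠ 0 := by linarith
    rw [smul_add, smul_add, smul_smul, smul_smul, mul_div_cancel₀ _ h1, mul_div_cancel₀ _ h1, e1]
    module
  have hlog : L ≤ 32 * d ^ 2 := by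
    rw [hL, Real.log_pow]
    have := Real.log_le_sub_one_of_pos (show (0 : ℝ) < 32 * d by positivity)
    nlinarith
  calc (coveringNumber K : ℝ) ≤ N := by exact_mod_cast hfinal
    _ ≤ L / p + 1 := by
        rw [hN]; push_cast; gcongr; exact Nat.floor_le (by positivity)
    _ ≤ 32 * d ^ 2 / p + 1 * (1 / p) := by
        gcongr; rw [one_mul, one_le_div hp0]; exact hp1
    _ = (64 * d ^ 2 + 2) * 2 ^ d / θ := by rw [hp]; field_simp; ring
    _ ≤ _ := by gcongr; nlinarith

end Covering

section LogConcave

/-- Log-concavity of a measure, in Brunn–Minkowski form. -/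
def IsLogConcave {F : Type*} [AddCommGroup F] [Module ℝ F] [MeasurableSpace F] (μ : Measure F) :
    Prop :=
  ∀ l : ℝ, 0 < l → l < 1 → ∀ A B C : Set F, MeasurableSet A → MeasurableSet B → MeasurableSet C →
    (∀ x ∈ A, ∀ y ∈ B, (1 - l) • x + l • y ∈ C) → μ A ^ (1 - l) * μ B ^ l ≤ μ C

theorem IsLogConcave.map {F G : Type*} [AddCommGroup F] [Module ℝ F] [MeasurableSpace F]
    [AddCommGroup G] [Module ℝ G] [MeasurableSpace G] {μ : Measure F} (hμ : IsLogConcave μ)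
    {f : F → G} (hf : Measurable f)
    (haff : ∀ (l : ℝ) (x y : F), f ((1 - l) • x + l • y) = (1 - l) • f x + l • f y) :
    IsLogConcave (μ.map f) := by
  intro l h0 h1 A B C hA hB hC h
  rw [Measure.map_apply hf hA, Measure.map_apply hf hB, Measure.map_apply hf hC]
  refine hμ l h0 h1 _ _ _ (hf hA) (hf hB) (hf hC) fun x hx y hy => ?_
  rw [Set.mem_preimage, haff]
  exact h _ hx _ hy

theorem isLogConcave_uniform {d : ℕ} {K : Set (EuclideanSpace ℝ (Fin d))} (hK : MeasurableSet K)
    (hconv : Convex ℝ K) (h0 : volume K ≠ 0) (hfin : volume K ≠ ∞) :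
    IsLogConcave ((volume K)⁻¹ • volume.restrict K) := by
  intro l h0l h1l A B C hA hB hC h
  have h1' : 0 < 1 - l := by linarith
  simp only [Measure.smul_apply, smul_eq_mul, Measure.restrict_apply hA, Measure.restrict_apply hB,
    Measure.restrict_apply hC]
  rw [ENNReal.mul_rpow_of_nonneg _ _ h1'.le, ENNReal.mul_rpow_of_nonneg _ _ h0l.le,
    mul_mul_mul_comm, ← ENNReal.rpow_add _ _ (ENNReal.inv_ne_zero.2 hfin) (ENNReal.inv_ne_top.2 h0),
    sub_add_cancel, ENNReal.rpow_one]
  gcongr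
  refine brunn_minkowski h0l h1l (hA.inter hK) (hB.inter hK) (hC.inter hK) fun x hx y hy => ?_
  exact ⟨h x hx.1 y hy.1, hconv hx.2 hy.2 h1'.le h0l.le (by ring)⟩

variable {κ : Measure ℝ} [IsProbabilityMeasure κ]

/-- Borell's lemma: exponential tails of a log-concave law on the line. -/
theorem IsLogConcave.tail_le (hκ : IsLogConcave κ) (hL2 : Integrable (fun x => x ^ 2) κ)
    (h2 : ∫ x, x ^ 2 ∂κ ≤ 1) {t : ℝ} (ht : 1 < t) :
    κ {x | 4 * t < |x|} ≤ ENNReal.ofReal (Real.exp (-t)) := by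
  have hSm : MeasurableSet {x : ℝ | |x| ≤ 4} := measurableSet_le (by fun_prop) (by fun_prop)
  have hTm : ∀ s : ℝ, MeasurableSet {x : ℝ | s < |x|} := fun s =>
    measurableSet_lt (by fun_prop) (by fun_prop)
  have mk := mul_meas_ge_le_integral_of_nonneg (ae_of_all κ fun x => sq_nonneg x) hL2 16
  have hc : κ.real {x : ℝ | 4 < |x|} ≤ 1 / 16 := by
    have : κ.real {x : ℝ | 4 < |x|} ≤ κ.real {x : ℝ | (16 : ℝ) ≤ x ^ 2} :=
      measureReal_mono fun x (hx : 4 < |x|) => by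
        show (16 : ℝ) ≤ x ^ 2
        rw [← sq_abs]; nlinarith
    linarith
  have hS : 15 / 16 ≤ κ.real {x : ℝ | |x| ≤ 4} := by
    have e : {x : ℝ | 4 < |x|} = {x : ℝ | |x| ≤ 4}ᶜ := by ext; simp
    rw [e, probReal_compl_eq_one_sub hSm] at hc
    linarith
  have ht1 : 0 < t + 1 := by linarith
  have key := hκ ((t - 1) / (t + 1)) (div_pos (by linarith) ht1)
    ((div_lt_one ht1).2 (by linarith)) {x | 4 * t < |x|} {x | |x| ≤ 4} {x | 4 < |x|}
    (hTm _) hSm (hTm _) fun x hx y hy => by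
      have e : 1 - (t - 1) / (t + 1) = 2 / (t + 1) := by field_simp; ring
      simp only [Set.mem_ofPred_eq, smul_eq_mul, e] at *
      have h1 := abs_sub_abs_le_abs_add (2 / (t + 1) * x) ((t - 1) / (t + 1) * y)
      rw [abs_mul, abs_mul, abs_of_pos (show 0 < 2 / (t + 1) by positivity),
        abs_of_pos (show 0 < (t - 1) / (t + 1) from div_pos (by linarith) ht1)] at h1
      refine lt_of_lt_of_le ?_ h1
      rw [div_mul_eq_mul_div, div_mul_eq_mul_div, ← sub_div, lt_div_iff₀ ht1]
      nlinarith
  set a := κ.real {x | 4 * t < |x|} with ha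
  have ha0 : 0 ≤ a := measureReal_nonneg
  have e : 1 - (t - 1) / (t + 1) = 2 / (t + 1) := by field_simp; ring
  have hr : a ^ (2 / (t + 1)) * (15 / 16 : ℝ) ^ ((t - 1) / (t + 1)) ≤ 1 / 16 := by
    have k2 := ENNReal.toReal_mono (measure_ne_top _ _) key
    rw [ENNReal.toReal_mul, ← ENNReal.toReal_rpow, ← ENNReal.toReal_rpow, e] at k2
    refine le_trans ?_ (k2.trans hc)
    refine mul_le_mul_of_nonneg_left ?_ (by positivity)
    exact Real.rpow_le_rpow (by norm_num) hS (div_nonneg (by linarith) ht1.le)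
  rw [ENNReal.le_ofReal_iff_toReal_le (measure_ne_top _ _) (Real.exp_pos _).le]
  change a ≤ _
  by_contra! hcon
  have hE : Real.exp (-t) ^ (2 / (t + 1)) * (15 / 16 : ℝ) ^ ((t - 1) / (t + 1)) ≤ 1 / 16 :=
    le_trans (mul_le_mul_of_nonneg_right (Real.rpow_le_rpow (Real.exp_pos _).le hcon.le
      (by positivity)) (by positivity)) hr
  have h1516 : (15 / 16 : ℝ) ≤ (15 / 16 : ℝ) ^ ((t - 1) / (t + 1)) := by
    conv_lhs => rw [← Real.rpow_one (15 / 16 : ℝ)]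
    exact Real.rpow_le_rpow_of_exponent_ge (by norm_num) (by norm_num)
      ((div_le_one ht1).2 (by linarith))
  have hexp : Real.exp (-2) ≤ Real.exp (-t) ^ (2 / (t + 1)) := by
    rw [← Real.exp_mul]
    refine Real.exp_le_exp.2 ?_
    rw [mul_div_assoc', le_div_iff₀ ht1]
    linarith
  have h2' : Real.exp 1 < 2.7182818286 := Real.exp_one_lt_d9
  have h3 : 1 / 9 < Real.exp (-2) := by
    rw [Real.exp_neg, show (2 : ℝ) = 1 + 1 by norm_num, Real.exp_add, one_div]
    refine inv_strictAnti₀ (by positivity) ?_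
    nlinarith [Real.exp_pos 1]
  have : 1 / 9 * (15 / 16 : ℝ) ≤ Real.exp (-t) ^ (2 / (t + 1)) * (15 / 16 : ℝ) ^ ((t - 1) / (t + 1)) :=
    mul_le_mul (h3.le.trans hexp) h1516 (by norm_num) (by positivity)
  linarith

theorem IsLogConcave.lintegral_exp_le (hκ : IsLogConcave κ) (hL2 : Integrable (fun x => x ^ 2) κ)
    (h2 : ∫ x, x ^ 2 ∂κ ≤ 1) :
    ∫⁻ x, ENNReal.ofReal (Real.exp (|x| / 8)) ∂κ ≤ 16 := by
  have hTm : ∀ s : ℝ, MeasurableSet {x : ℝ | s < |x|} := fun s =>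
    measurableSet_lt (by fun_prop) (by fun_prop)
  have hpt : ∀ x : ℝ, ENNReal.ofReal (Real.exp (|x| / 8)) ≤ ENNReal.ofReal (Real.exp 1) +
      ∑' n : ℕ, ENNReal.ofReal (Real.exp (n + 2)) *
        {x : ℝ | 8 * ((n : ℝ) + 1) < |x|}.indicator 1 x := by
    intro x
    by_cases hx : |x| / 8 ≤ 1
    · exact le_trans (ENNReal.ofReal_le_ofReal (Real.exp_le_exp.2 hx)) le_self_add
    · push Not at hx
      obtain ⟨n, hn1, hn2⟩ : ∃ n : ℕ, (n : ℝ) + 1 < |x| / 8 ∧ |x| / 8 ≤ n + 2 := by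
        refine ⟨⌈|x| / 8⌉₊ - 2, ?_, ?_⟩
        · have h2 : 2 ≤ ⌈|x| / 8⌉₊ := by
            have : 1 < ⌈|x| / 8⌉₊ := Nat.lt_ceil.2 (by simpa using hx)
            omega
          have := Nat.ceil_lt_add_one (show 0 ≤ |x| / 8 by positivity)
          push_cast [Nat.cast_sub h2]; linarith
        · have h2 : 2 ≤ ⌈|x| / 8⌉₊ := by
            have : 1 < ⌈|x| / 8⌉₊ := Nat.lt_ceil.2 (by simpa using hx)
            omega
          have := Nat.le_ceil (|x| / 8)
          push_cast [Nat.cast_sub h2]; linarith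
      refine le_trans ?_ le_add_self
      refine le_trans ?_ (ENNReal.le_tsum n)
      rw [Set.indicator_of_mem (by show 8 * ((n : ℝ) + 1) < |x|; linarith)]
      simpa using ENNReal.ofReal_le_ofReal (Real.exp_le_exp.2 hn2)
  have hterm : ∀ n : ℕ, ENNReal.ofReal (Real.exp (n + 2)) * κ {x : ℝ | 8 * ((n : ℝ) + 1) < |x|} ≤
      ENNReal.ofReal (2⁻¹ ^ n) := fun n => by
    have := hκ.tail_le hL2 h2 (t := 2 * ((n : ℝ) + 1)) (by linarith [Nat.cast_nonneg (α := ℝ) n])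
    have e : 4 * (2 * ((n : ℝ) + 1)) = 8 * ((n : ℝ) + 1) := by ring
    rw [e] at this
    refine (mul_le_mul_right this _).trans ?_
    rw [← ENNReal.ofReal_mul (Real.exp_pos _).le, ← Real.exp_add]
    refine ENNReal.ofReal_le_ofReal ?_
    have e : ((n : ℝ) + 2 + -(2 * (n + 1))) = n * (-1) := by ring
    rw [e, Real.exp_nat_mul]
    gcongr
    rw [Real.exp_neg]
    gcongr
    linarith [Real.exp_one_gt_d9]
  calc _ ≤ ∫⁻ x, (ENNReal.ofReal (Real.exp 1) +
      ∑' n : ℕ, ENNReal.ofReal (Real.exp (n + 2)) *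
        {x : ℝ | 8 * ((n : ℝ) + 1) < |x|}.indicator 1 x) ∂κ := lintegral_mono hpt
    _ = ENNReal.ofReal (Real.exp 1) + ∑' n : ℕ, ENNReal.ofReal (Real.exp (n + 2)) *
        κ {x : ℝ | 8 * ((n : ℝ) + 1) < |x|} := by
      rw [lintegral_add_left (by fun_prop), lintegral_const, measure_univ, mul_one,
        lintegral_tsum fun n =>
          ((measurable_one.indicator (hTm _)).const_mul _).aemeasurable]
      congr 2 with n
      rw [lintegral_const_mul _ (measurable_one.indicator (hTm _)), lintegral_indicator_one (hTm _)]
    _ ≤ ENNReal.ofReal 3 + ∑' n : ℕ, ENNReal.ofReal (2⁻¹ ^ n) := by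
      gcongr with n
      · linarith [Real.exp_one_lt_d9]
      · exact hterm n
    _ ≤ 16 := by
      rw [← ENNReal.ofReal_tsum_of_nonneg (fun n => by positivity)
        (summable_geometric_of_lt_one (by norm_num) (by norm_num)),
        tsum_geometric_of_lt_one (by norm_num) (by norm_num), ← ENNReal.ofReal_add (by norm_num)
        (by norm_num)]
      norm_num

/-- Moments of a log-concave law on the line grow at most linearly. -/
theorem IsLogConcave.lintegral_pow_le (hκ : IsLogConcave κ) (hL2 : Integrable (fun x => x ^ 2) κ)
    (h2 : ∫ x, x ^ 2 ∂κ ≤ 1) {p : ℕ} (hp : 1 ≤ p) :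
    ∫⁻ x, ENNReal.ofReal (|x| ^ p) ∂κ ≤ ENNReal.ofReal ((128 * p) ^ p) := by
  have hpt : ∀ x : ℝ, |x| ^ p ≤ (8 * p) ^ p * Real.exp (|x| / 8) := fun x => by
    have h1 := Real.pow_div_factorial_le_exp (|x| / 8) (by positivity) p
    have h2 : (p.factorial : ℝ) ≤ (p : ℝ) ^ p := by exact_mod_cast Nat.factorial_le_pow p
    rw [div_le_iff₀ (by positivity), div_pow, div_le_iff₀ (by positivity)] at h1
    refine h1.trans ?_
    rw [mul_pow]
    calc _ ≤ Real.exp (|x| / 8) * p ^ p * 8 ^ p := by gcongr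
      _ = _ := by ring
  calc _ ≤ ∫⁻ x, ENNReal.ofReal ((8 * p) ^ p) * ENNReal.ofReal (Real.exp (|x| / 8)) ∂κ := by
        refine lintegral_mono fun x => ?_
        rw [← ENNReal.ofReal_mul (by positivity)]
        exact ENNReal.ofReal_le_ofReal (hpt x)
    _ ≤ ENNReal.ofReal ((8 * p) ^ p) * 16 := by
        rw [lintegral_const_mul _ (by fun_prop)]
        gcongr
        exact hκ.lintegral_exp_le hL2 h2
    _ = ENNReal.ofReal ((8 * p) ^ p * 16) := by
        rw [ENNReal.ofReal_mul (by positivity)]; simp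
    _ ≤ _ := by
        refine ENNReal.ofReal_le_ofReal ?_
        rw [show (128 * (p : ℝ)) = 8 * p * 16 by ring, mul_pow _ (16 : ℝ)]
        gcongr
        exact le_self_pow₀ (by norm_num) (by omega)

end LogConcave

section GaussianTools

theorem ofReal_pow_le_lintegral_pow {Ω : Type*} [MeasurableSpace Ω] {μ : Measure Ω}
    [IsProbabilityMeasure μ] {X : Ω → ℝ} (hX : Measurable X) (hX0 : ∀ x, 0 ≤ X x) {w : ℝ}
    (hw : 0 ≤ w) {p q : ℕ} (hp : 1 ≤ p) (hpq : p ≤ q)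
    (h : ENNReal.ofReal (w ^ p) ≤ ∫⁻ x, ENNReal.ofReal (X x ^ p) ∂μ) :
    ENNReal.ofReal (w ^ q) ≤ ∫⁻ x, ENNReal.ofReal (X x ^ q) ∂μ := by
  have hp0 : (0 : ℝ) < p := by exact_mod_cast hp
  have hq0 : (0 : ℝ) < q := by exact_mod_cast (hp.trans hpq)
  have key := eLpNorm'_le_eLpNorm'_of_exponent_le hp0 (by exact_mod_cast hpq : (p : ℝ) ≤ q) μ
    hX.aestronglyMeasurable
  have e : ∀ r : ℕ, ∫⁻ x, ‖X x‖ₑ ^ (r : ℝ) ∂μ = ∫⁻ x, ENNReal.ofReal (X x ^ r) ∂μ := fun r => by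
    refine lintegral_congr fun x => ?_
    rw [ENNReal.rpow_natCast, Real.enorm_of_nonneg (hX0 x), ENNReal.ofReal_pow (hX0 x)]
  rw [eLpNorm', eLpNorm', e, e] at key
  have h1 : ENNReal.ofReal w ≤ (∫⁻ x, ENNReal.ofReal (X x ^ q) ∂μ) ^ (1 / (q : ℝ)) := by
    refine le_trans ?_ key
    refine le_trans (le_of_eq ?_) (ENNReal.rpow_le_rpow h (by positivity))
    rw [ENNReal.ofReal_pow hw, ← ENNReal.rpow_natCast, ← ENNReal.rpow_mul,
      mul_one_div_cancel hp0.ne', ENNReal.rpow_one]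
  rw [ENNReal.ofReal_pow hw]
  calc ENNReal.ofReal w ^ q ≤ ((∫⁻ x, ENNReal.ofReal (X x ^ q) ∂μ) ^ (1 / (q : ℝ))) ^ q := by
        gcongr
    _ = _ := by
        rw [← ENNReal.rpow_natCast, ← ENNReal.rpow_mul, one_div_mul_cancel hq0.ne',
          ENNReal.rpow_one]

variable {E : Type*} [NormedAddCommGroup E] [InnerProductSpace ℝ E] [FiniteDimensional ℝ E]
  [MeasurableSpace E] [BorelSpace E]

/-- A Lipschitz function of a Gaussian vector is rarely much smaller than its moments. -/
theorem stdGaussian_lower_tail {X : E → ℝ} (hX : Measurable X) (hX0 : ∀ x, 0 ≤ X x) {L w : ℝ}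
    (hw : 0 < w) (hL : ∀ x y, X x - X y ≤ L * ‖x - y‖) {p m : ℕ} (hp : 1 ≤ p) (hpm : p ≤ m)
    (h : ENNReal.ofReal (w ^ p) ≤ ∫⁻ x, ENNReal.ofReal (X x ^ p) ∂ProbabilityTheory.stdGaussian E)
    (hLm : m * Real.exp 6 * L ^ 2 ≤ w ^ 2) :
    ProbabilityTheory.stdGaussian E {x | X x ≤ w * Real.exp (-3)} ≤
      ENNReal.ofReal (Real.exp (-m)) := by
  set P := ProbabilityTheory.stdGaussian E
  have hm0 : (0 : ℝ) < m := by exact_mod_cast (hp.trans hpm)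
  set lam : ℝ := m * Real.exp 3 / w with hlam
  have hlam0 : 0 < lam := by positivity
  have hq := ofReal_pow_le_lintegral_pow hX hX0 hw.le hp hpm h
  have key := stdGaussian_lintegral_exp_mul_le (E := E) (F := fun x => lam * X x) (hX.const_mul lam)
    (L := lam * L) fun x y => by nlinarith [hL x y]
  have h1 : ENNReal.ofReal (Real.exp (3 * m)) ≤ ∫⁻ x, ENNReal.ofReal (Real.exp (lam * X x)) ∂P := by
    calc ENNReal.ofReal (Real.exp (3 * m)) = ENNReal.ofReal (lam ^ m / m ^ m) *
          ENNReal.ofReal (w ^ m) := by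
          rw [← ENNReal.ofReal_mul (by positivity), hlam, ← div_pow, ← mul_pow,
            mul_comm (3 : ℝ), Real.exp_nat_mul]
          congr 2
          field_simp
      _ ≤ ENNReal.ofReal (lam ^ m / m ^ m) * ∫⁻ x, ENNReal.ofReal (X x ^ m) ∂P := by gcongr
      _ = ∫⁻ x, ENNReal.ofReal (lam ^ m / m ^ m) * ENNReal.ofReal (X x ^ m) ∂P := by
          rw [lintegral_const_mul _ (by fun_prop)]
      _ ≤ _ := by
          refine lintegral_mono fun x => ?_
          rw [← ENNReal.ofReal_mul (by positivity)]
          refine ENNReal.ofReal_le_ofReal ?_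
          have hx := hX0 x
          refine le_trans ?_ (Real.pow_div_factorial_le_exp (lam * X x) (by positivity) m)
          rw [mul_pow, div_mul_eq_mul_div]
          gcongr
          exact_mod_cast Nat.factorial_le_pow m
  have h2 : ENNReal.ofReal (Real.exp (-m)) * P {x | X x ≤ w * Real.exp (-3)} ≤
      ∫⁻ x, ENNReal.ofReal (Real.exp (-(lam * X x))) ∂P := by
    have hms : MeasurableSet {x | X x ≤ w * Real.exp (-3)} := measurableSet_le hX measurable_const
    rw [← lintegral_indicator_one hms, ← lintegral_const_mul _ (measurable_one.indicator hms)]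
    refine lintegral_mono fun x => ?_
    by_cases hx : x ∈ {x | X x ≤ w * Real.exp (-3)}
    · rw [Set.indicator_of_mem hx, Pi.one_apply, mul_one]
      refine ENNReal.ofReal_le_ofReal (Real.exp_le_exp.2 (neg_le_neg ?_))
      calc lam * X x ≤ lam * (w * Real.exp (-3)) := by gcongr; exact hx
        _ = m := by rw [hlam, Real.exp_neg]; field_simp
    · rw [Set.indicator_of_notMem hx, mul_zero]; exact zero_le
  have h3 : ENNReal.ofReal (Real.exp (3 * m)) * (ENNReal.ofReal (Real.exp (-m)) *
      P {x | X x ≤ w * Real.exp (-3)}) ≤ ENNReal.ofReal (Real.exp m) := by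
    refine (mul_le_mul' h1 h2).trans (key.trans (ENNReal.ofReal_le_ofReal (Real.exp_le_exp.2 ?_)))
    rw [hlam, div_mul_eq_mul_div, div_pow, div_le_iff₀ (by positivity)]
    calc (m * Real.exp 3 * L) ^ 2 = m * (m * (Real.exp 3 * Real.exp 3) * L ^ 2) := by ring
      _ = m * (m * Real.exp 6 * L ^ 2) := by rw [← Real.exp_add]; norm_num
      _ ≤ _ := by gcongr
  rw [← mul_assoc, ← ENNReal.ofReal_mul (Real.exp_pos _).le, ← Real.exp_add] at h3
  have h4 := mul_le_mul_right h3 (ENNReal.ofReal (Real.exp (-(2 * m))))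
  rw [← mul_assoc, ← ENNReal.ofReal_mul (Real.exp_pos _).le, ← ENNReal.ofReal_mul (Real.exp_pos _).le,
    ← Real.exp_add, ← Real.exp_add] at h4
  ring_nf at h4 ⊢
  simpa using h4

theorem gaussianReal_moment_lower {p : ℕ} (hp : 1 ≤ p) :
    ENNReal.ofReal ((Real.exp (-4) * √p) ^ p) ≤
      ∫⁻ s, ENNReal.ofReal (max s 0 ^ p) ∂ProbabilityTheory.gaussianReal 0 1 := by
  have hp1 : (1 : ℝ) ≤ p := by exact_mod_cast hp
  have hsp : √(p : ℝ) ^ 2 = p := Real.sq_sqrt (by positivity)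
  have hsp0 : 0 ≤ √(p : ℝ) := Real.sqrt_nonneg _
  have hφ : ∀ s ∈ Set.Icc (√(p : ℝ)) (√p + 1), ENNReal.ofReal (Real.exp (-(4 * p))) ≤
      ProbabilityTheory.gaussianPDF 0 1 s := by
    intro s hs
    refine ENNReal.ofReal_le_ofReal ?_
    rw [ProbabilityTheory.gaussianPDFReal]
    have h1 : √(2 * Real.pi * ((1 : NNReal) : ℝ)) ≤ Real.exp 1 := by
      refine Real.sqrt_le_iff.2 ⟨(Real.exp_pos _).le, ?_⟩
      have := Real.pi_lt_d2
      have := Real.exp_one_gt_d9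
      push_cast; nlinarith
    calc Real.exp (-(4 * p)) ≤ Real.exp (-1) * Real.exp (-(s - 0) ^ 2 / (2 * ((1 : NNReal) : ℝ))) := by
          rw [← Real.exp_add]
          refine Real.exp_le_exp.2 ?_
          have : s ^ 2 ≤ (√p + 1) ^ 2 := pow_le_pow_left₀ (hsp0.trans hs.1) hs.2 2
          push_cast
          nlinarith [sq_nonneg (√(p : ℝ) - 1)]
      _ ≤ _ := by
          rw [Real.exp_neg 1]
          gcongr
  have hInt : ENNReal.ofReal (Real.exp (-(4 * p))) ≤
      ProbabilityTheory.gaussianReal 0 1 (Set.Icc (√(p : ℝ)) (√p + 1)) := by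
    rw [ProbabilityTheory.gaussianReal_apply _ one_ne_zero]
    refine le_trans ?_ (setLIntegral_mono' measurableSet_Icc hφ)
    rw [setLIntegral_const, Real.volume_Icc]
    simp
  calc ENNReal.ofReal ((Real.exp (-4) * √p) ^ p)
      = ENNReal.ofReal (√p ^ p) * ENNReal.ofReal (Real.exp (-(4 * p))) := by
        rw [← ENNReal.ofReal_mul (by positivity), mul_pow, ← Real.exp_nat_mul, mul_comm]
        congr 3; ring
    _ ≤ ENNReal.ofReal (√p ^ p) *
        ProbabilityTheory.gaussianReal 0 1 (Set.Icc (√(p : ℝ)) (√p + 1)) := by gcongr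
    _ = ∫⁻ s in Set.Icc (√(p : ℝ)) (√p + 1), ENNReal.ofReal (√p ^ p)
        ∂ProbabilityTheory.gaussianReal 0 1 := by rw [setLIntegral_const]
    _ ≤ ∫⁻ s in Set.Icc (√(p : ℝ)) (√p + 1), ENNReal.ofReal (max s 0 ^ p)
        ∂ProbabilityTheory.gaussianReal 0 1 := by
        refine setLIntegral_mono' measurableSet_Icc fun s hs => ENNReal.ofReal_le_ofReal ?_
        gcongr
        exact hs.1.trans (le_max_left _ _)
    _ ≤ _ := setLIntegral_le_lintegral _ _

theorem stdGaussian_moment_inner (v : E) (p : ℕ) :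
    ∫⁻ g, ENNReal.ofReal (max (inner ℝ v g) 0 ^ p) ∂ProbabilityTheory.stdGaussian E =
      ENNReal.ofReal (‖v‖ ^ p) *
        ∫⁻ s, ENNReal.ofReal (max s 0 ^ p) ∂ProbabilityTheory.gaussianReal 0 1 := by
  have h1 := ProbabilityTheory.IsGaussian.map_eq_gaussianReal
    (μ := ProbabilityTheory.stdGaussian E) (innerSL ℝ v)
  rw [ProbabilityTheory.integral_strongDual_stdGaussian,
    ProbabilityTheory.variance_dual_stdGaussian] at h1
  have h2 := ProbabilityTheory.gaussianReal_map_const_mul (μ := 0) (v := 1) ‖v‖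
  rw [mul_zero] at h2
  have h3 : (ProbabilityTheory.stdGaussian E).map (innerSL ℝ v) =
      (ProbabilityTheory.gaussianReal 0 1).map (‖v‖ * ·) := by
    rw [h1, h2]
    congr 1
    ext
    simp
  have hm : Measurable fun s : ℝ => ENNReal.ofReal (max s 0 ^ p) := by fun_prop
  calc _ = ∫⁻ s, ENNReal.ofReal (max s 0 ^ p)
        ∂(ProbabilityTheory.stdGaussian E).map (innerSL ℝ v) := by
        rw [lintegral_map hm (by fun_prop)]; rfl
    _ = _ := by
        rw [h3, lintegral_map hm (by fun_prop), ← lintegral_const_mul _ hm]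
        refine lintegral_congr fun s => ?_
        rw [← ENNReal.ofReal_mul (by positivity), ← mul_pow,
          mul_max_of_nonneg _ _ (norm_nonneg _), mul_zero]

theorem stdGaussian_lintegral_norm_sq :
    ∫⁻ g, ENNReal.ofReal (‖g‖ ^ 2) ∂ProbabilityTheory.stdGaussian E =
      Module.finrank ℝ E := by
  set b := stdOrthonormalBasis ℝ E
  have h1 : ∀ g : E, ENNReal.ofReal (‖g‖ ^ 2) = ∑ i, ENNReal.ofReal (inner ℝ (b i) g ^ 2) :=
    fun g => by
      rw [← ENNReal.ofReal_sum_of_nonneg fun i _ => sq_nonneg _, ← b.sum_sq_inner_right g]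
  have h2 : ∀ v : E, ‖v‖ = 1 →
      ∫⁻ g, ENNReal.ofReal (inner ℝ v g ^ 2) ∂ProbabilityTheory.stdGaussian E = 1 := by
    intro v hv
    have h := ProbabilityTheory.variance_dual_stdGaussian (E := E) (innerSL ℝ v)
    have hi : MemLp (innerSL ℝ v) 2 (ProbabilityTheory.stdGaussian E) :=
      ProbabilityTheory.IsGaussian.memLp_dual _ _ _ (by simp)
    rw [ProbabilityTheory.variance_eq_sub hi,
      ProbabilityTheory.integral_strongDual_stdGaussian, innerSL_apply_norm, hv] at h
    rw [← ofReal_integral_eq_lintegral_ofReal (by exact hi.integrable_sq)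
      (ae_of_all _ fun g => sq_nonneg _)]
    simp at h
    simp [h]
  simp_rw [h1]
  rw [lintegral_finsetSum _ fun i _ => by fun_prop]
  simp [h2]

end GaussianTools

section RandomProjection

/-- A centred measure with identity covariance. -/
structure IsIsotropic {F : Type*} [NormedAddCommGroup F] [InnerProductSpace ℝ F]
    [MeasurableSpace F] (γ : Measure F) : Prop where
  memLp : MemLp id 2 γ
  mean : ∫ x, x ∂γ = 0
  cov : ∀ ξ : F, ∫ x, inner ℝ ξ x ^ 2 ∂γ = ‖ξ‖ ^ 2

/-- The `L^p` norm of the positive part of the linear form `⟪ξ, ·⟫`. -/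
noncomputable def momentPlus {F : Type*} [NormedAddCommGroup F] [InnerProductSpace ℝ F]
    [MeasurableSpace F] (γ : Measure F) (p : ℕ) (ξ : F) : ℝ :=
  (eLpNorm (fun x => max (inner ℝ ξ x) 0) p γ).toReal

variable {F : Type*} [NormedAddCommGroup F] [InnerProductSpace ℝ F] [FiniteDimensional ℝ F]
  [MeasurableSpace F] [BorelSpace F] {γ : Measure F} [IsProbabilityMeasure γ]

theorem IsIsotropic.integrable_inner_sq (hi : IsIsotropic γ) (ξ : F) :
    Integrable (fun x => inner ℝ ξ x ^ 2) γ := by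
  have h : MemLp (fun x : F => inner ℝ ξ x) 2 γ := by
    refine (hi.memLp.norm.const_mul ‖ξ‖).mono' (by fun_prop) (ae_of_all _ fun x => ?_)
    exact norm_inner_le_norm _ _
  exact h.integrable_sq

theorem eLpNorm_inner_le (hlc : IsLogConcave γ) (hi : IsIsotropic γ) {p : ℕ} (hp : 1 ≤ p) (ξ : F) :
    eLpNorm (fun x => inner ℝ ξ x) p γ ≤ ENNReal.ofReal (128 * p * ‖ξ‖) := by
  rcases eq_or_ne ξ 0 with rfl | hξ
  · simp
  have hn : 0 < ‖ξ‖ := norm_pos_iff.2 hξ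
  set u := ‖ξ‖⁻¹ • ξ with hu
  have hu1 : ‖u‖ = 1 := by rw [hu, norm_smul, norm_inv, norm_norm, inv_mul_cancel₀ hn.ne']
  have hp0 : (0 : ℝ) < p := by exact_mod_cast hp
  have hm : Measurable fun x : F => inner ℝ u x := by fun_prop
  have : IsProbabilityMeasure (γ.map fun x => inner ℝ u x) :=
    Measure.isProbabilityMeasure_map hm.aemeasurable
  have hInt : Integrable (fun s : ℝ => s ^ 2) (γ.map fun x => inner ℝ u x) := by
    rw [integrable_map_measure (by fun_prop) hm.aemeasurable]
    exact hi.integrable_inner_sq u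
  have hb := (hlc.map hm fun l x y => by
    rw [inner_add_right, inner_smul_right, inner_smul_right, smul_eq_mul, smul_eq_mul]
    ).lintegral_pow_le hInt (by
      rw [integral_map hm.aemeasurable (by fun_prop), hi.cov u, hu1]; norm_num) hp
  rw [lintegral_map (by fun_prop) hm] at hb
  have h1 : eLpNorm (fun x => inner ℝ u x) p γ ≤ ENNReal.ofReal (128 * p) := by
    rw [eLpNorm_eq_lintegral_rpow_enorm_toReal (by exact_mod_cast (show p ≠ 0 by omega)) (by simp)]
    simp only [ENNReal.toReal_natCast, ENNReal.rpow_natCast]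
    have e : ∀ x, ‖inner ℝ u x‖ₑ ^ p = ENNReal.ofReal (|inner ℝ u x| ^ p) := fun x => by
      rw [Real.enorm_eq_ofReal_abs, ENNReal.ofReal_pow (abs_nonneg _)]
    simp_rw [e]
    refine (ENNReal.rpow_le_rpow hb (by positivity)).trans (le_of_eq ?_)
    rw [ENNReal.ofReal_pow (by positivity), ← ENNReal.rpow_natCast, ← ENNReal.rpow_mul,
      mul_one_div_cancel hp0.ne', ENNReal.rpow_one]
  have e2 : (fun x : F => inner ℝ ξ x) = ‖ξ‖ • fun x : F => inner ℝ u x := by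
    funext x
    simp [hu, inner_smul_left, hn.ne']
  rw [e2, eLpNorm_const_smul, mul_comm, ENNReal.ofReal_mul (by positivity), enorm_norm,
    ← ofReal_norm]
  gcongr

theorem eLpNorm_max_inner_le (p : ℕ) (ξ : F) :
    eLpNorm (fun x => max (inner ℝ ξ x) 0) p γ ≤ eLpNorm (fun x => inner ℝ ξ x) p γ := by
  refine eLpNorm_mono fun x => ?_
  rw [Real.norm_eq_abs, Real.norm_eq_abs, abs_of_nonneg (le_max_right _ _)]
  exact max_le (le_abs_self _) (abs_nonneg _)

theorem momentPlus_nonneg (p : ℕ) (ξ : F) : 0 ≤ momentPlus γ p ξ := ENNReal.toReal_nonneg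

theorem eLpNorm_max_inner_ne_top (hlc : IsLogConcave γ) (hi : IsIsotropic γ) {p : ℕ} (hp : 1 ≤ p)
    (ξ : F) : eLpNorm (fun x => max (inner ℝ ξ x) 0) p γ ≠ ∞ :=
  ((eLpNorm_max_inner_le p ξ).trans_lt
    ((eLpNorm_inner_le hlc hi hp ξ).trans_lt ENNReal.ofReal_lt_top)).ne

theorem momentPlus_sub_le (hlc : IsLogConcave γ) (hi : IsIsotropic γ) {p : ℕ} (hp : 1 ≤ p)
    (ξ η : F) : momentPlus γ p ξ - momentPlus γ p η ≤ 128 * p * ‖ξ - η‖ := by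
  have h1 : eLpNorm (fun x => max (inner ℝ ξ x) 0) p γ ≤
      eLpNorm (fun x => max (inner ℝ η x) 0) p γ + ENNReal.ofReal (128 * p * ‖ξ - η‖) := by
    have e : (fun x : F => max (inner ℝ ξ x) 0) = (fun x => max (inner ℝ η x) 0) +
        fun x => (max (inner ℝ ξ x) 0 - max (inner ℝ η x) 0) := by funext x; simp
    rw [e]
    refine (eLpNorm_add_le (by fun_prop) (by fun_prop) (by exact_mod_cast hp)).trans ?_
    gcongr
    refine le_trans (eLpNorm_mono fun x => ?_) (eLpNorm_inner_le hlc hi hp (ξ - η))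
    rw [inner_sub_left, Real.norm_eq_abs, Real.norm_eq_abs]
    exact abs_max_sub_max_le_abs _ _ _
  have h2 := ENNReal.toReal_mono (ENNReal.add_ne_top.2
    ⟨eLpNorm_max_inner_ne_top hlc hi hp η, ENNReal.ofReal_ne_top⟩) h1
  rw [ENNReal.toReal_add (eLpNorm_max_inner_ne_top hlc hi hp η) ENNReal.ofReal_ne_top,
    ENNReal.toReal_ofReal (by positivity)] at h2
  rw [momentPlus, momentPlus]
  linarith

theorem continuous_momentPlus (hlc : IsLogConcave γ) (hi : IsIsotropic γ) {p : ℕ} (hp : 1 ≤ p) :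
    Continuous (momentPlus γ p) := by
  have : LipschitzWith (128 * p) (momentPlus γ p) := LipschitzWith.of_le_add_mul _ fun x y => by
    have := momentPlus_sub_le hlc hi hp x y
    rw [dist_eq_norm]; push_cast; linarith
  exact this.continuous

theorem lintegral_max_inner_pow (hlc : IsLogConcave γ) (hi : IsIsotropic γ) {p : ℕ} (hp : 1 ≤ p)
    (ξ : F) : ∫⁻ x, ENNReal.ofReal (max (inner ℝ ξ x) 0 ^ p) ∂γ =
      ENNReal.ofReal (momentPlus γ p ξ ^ p) := by
  have hp0 : (0 : ℝ) < p := by exact_mod_cast hp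
  rw [ENNReal.ofReal_pow (momentPlus_nonneg p ξ), momentPlus,
    ENNReal.ofReal_toReal (eLpNorm_max_inner_ne_top hlc hi hp ξ),
    eLpNorm_eq_lintegral_rpow_enorm_toReal (by exact_mod_cast (show p ≠ 0 by omega)) (by simp)]
  simp only [ENNReal.toReal_natCast]
  rw [← ENNReal.rpow_natCast, ← ENNReal.rpow_mul, one_div_mul_cancel hp0.ne', ENNReal.rpow_one]
  refine lintegral_congr fun x => ?_
  rw [ENNReal.rpow_natCast, Real.enorm_of_nonneg (le_max_right _ _),
    ENNReal.ofReal_pow (le_max_right _ _)]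

theorem IsIsotropic.integral_norm_sq (hi : IsIsotropic γ) :
    ∫ x, ‖x‖ ^ 2 ∂γ = Module.finrank ℝ F := by
  set b := stdOrthonormalBasis ℝ F
  have h1 : ∀ g : F, ‖g‖ ^ 2 = ∑ i, inner ℝ (b i) g ^ 2 := fun g => (b.sum_sq_inner_right g).symm
  simp_rw [h1]
  rw [integral_finsetSum _ fun i _ => hi.integrable_inner_sq _]
  simp [hi.cov]

theorem IsIsotropic.norm_pow_moment (hi : IsIsotropic γ) {p : ℕ} (hp : 2 ≤ p) :
    ENNReal.ofReal (√(Module.finrank ℝ F) ^ p) ≤ ∫⁻ x, ENNReal.ofReal (‖x‖ ^ p) ∂γ := by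
  refine ofReal_pow_le_lintegral_pow (by fun_prop) (fun x => norm_nonneg x) (Real.sqrt_nonneg _)
    (by norm_num : 1 ≤ 2) hp ?_
  rw [Real.sq_sqrt (by positivity), ← hi.integral_norm_sq,
    ofReal_integral_eq_lintegral_ofReal (by exact hi.memLp.norm.integrable_sq)
      (ae_of_all _ fun g => sq_nonneg _)]

variable {k d : ℕ}

/-- The linear map with matrix `G`. -/
noncomputable def matMap (G : EuclideanSpace ℝ (Fin k × Fin d)) :
    EuclideanSpace ℝ (Fin d) →ₗ[ℝ] EuclideanSpace ℝ (Fin k) where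
  toFun x := WithLp.toLp 2 fun i => ∑ j, G (i, j) * x j
  map_add' x y := by ext i; simp [mul_add, Finset.sum_add_distrib]
  map_smul' c x := by
    ext i; simp only [PiLp.smul_apply, smul_eq_mul, RingHom.id_apply, Finset.mul_sum]
    exact Finset.sum_congr rfl fun j _ => by ring

/-- The transpose of the matrix `G` applied to `a`. -/
noncomputable def matAdj (G : EuclideanSpace ℝ (Fin k × Fin d)) (a : EuclideanSpace ℝ (Fin k)) :
    EuclideanSpace ℝ (Fin d) :=
  WithLp.toLp 2 fun j => ∑ i, G (i, j) * a i

/-- The rank-one matrix `a ⊗ x`. -/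
noncomputable def matTensor (a : EuclideanSpace ℝ (Fin k)) (x : EuclideanSpace ℝ (Fin d)) :
    EuclideanSpace ℝ (Fin k × Fin d) :=
  WithLp.toLp 2 fun q => a q.1 * x q.2

theorem norm_matTensor (a : EuclideanSpace ℝ (Fin k)) (x : EuclideanSpace ℝ (Fin d)) :
    ‖matTensor a x‖ = ‖a‖ * ‖x‖ := by
  rw [EuclideanSpace.norm_eq, EuclideanSpace.norm_eq, EuclideanSpace.norm_eq, ← Real.sqrt_mul
    (by positivity), Finset.sum_mul_sum, Fintype.sum_prod_type]
  simp [matTensor, mul_pow]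

theorem inner_matAdj (G : EuclideanSpace ℝ (Fin k × Fin d)) (a : EuclideanSpace ℝ (Fin k))
    (x : EuclideanSpace ℝ (Fin d)) : inner ℝ (matAdj G a) x = inner ℝ a (matMap G x) := by
  simp only [PiLp.inner_apply, matAdj, matMap, LinearMap.coe_mk, AddHom.coe_mk, RCLike.inner_apply,
    conj_trivial, Finset.mul_sum, Finset.sum_mul]
  rw [Finset.sum_comm]
  exact Finset.sum_congr rfl fun i _ => Finset.sum_congr rfl fun j _ => by ring

theorem inner_matTensor (G : EuclideanSpace ℝ (Fin k × Fin d)) (a : EuclideanSpace ℝ (Fin k))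
    (x : EuclideanSpace ℝ (Fin d)) : inner ℝ (matTensor a x) G = inner ℝ (matAdj G a) x := by
  simp only [PiLp.inner_apply, matAdj, matTensor, RCLike.inner_apply,
    conj_trivial, Finset.mul_sum, Fintype.sum_prod_type]
  rw [Finset.sum_comm]
  exact Finset.sum_congr rfl fun i _ => Finset.sum_congr rfl fun j _ => by ring

theorem norm_matAdj_le (G : EuclideanSpace ℝ (Fin k × Fin d)) (a : EuclideanSpace ℝ (Fin k)) :
    ‖matAdj G a‖ ≤ ‖G‖ * ‖a‖ := by
  have h : ‖matAdj G a‖ ^ 2 ≤ ‖G‖ * ‖a‖ * ‖matAdj G a‖ := by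
    rw [← real_inner_self_eq_norm_sq, ← inner_matTensor]
    refine (real_inner_le_norm _ _).trans ?_
    rw [norm_matTensor]; apply le_of_eq; ring
  rcases (norm_nonneg (matAdj G a)).eq_or_lt with h0 | h0
  · rw [← h0]; positivity
  · rw [sq] at h; exact le_of_mul_le_mul_right h h0

theorem matAdj_sub_left (G G' : EuclideanSpace ℝ (Fin k × Fin d)) (a : EuclideanSpace ℝ (Fin k)) :
    matAdj G a - matAdj G' a = matAdj (G - G') a := by
  ext j; simp [matAdj, sub_mul, Finset.sum_sub_distrib]

theorem matAdj_sub_right (G : EuclideanSpace ℝ (Fin k × Fin d)) (a a' : EuclideanSpace ℝ (Fin k)) :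
    matAdj G a - matAdj G a' = matAdj G (a - a') := by
  ext j; simp [matAdj, mul_sub, Finset.sum_sub_distrib]

theorem continuous_matAdj (a : EuclideanSpace ℝ (Fin k)) :
    Continuous fun G : EuclideanSpace ℝ (Fin k × Fin d) => matAdj G a := by
  unfold matAdj
  fun_prop

theorem integral_norm_sq_matMap {γ : Measure (EuclideanSpace ℝ (Fin d))} [IsProbabilityMeasure γ]
    (hi : IsIsotropic γ) (G : EuclideanSpace ℝ (Fin k × Fin d)) :
    ∫ x, ‖matMap G x‖ ^ 2 ∂γ = ‖G‖ ^ 2 := by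
  have h1 : ∀ x, ‖matMap G x‖ ^ 2 =
      ∑ i, inner ℝ (WithLp.toLp 2 (fun j => G (i, j)) : EuclideanSpace ℝ (Fin d)) x ^ 2 := by
    intro x
    rw [EuclideanSpace.real_norm_sq_eq]
    refine Finset.sum_congr rfl fun i _ => ?_
    simp [matMap, PiLp.inner_apply, mul_comm]
  simp_rw [h1]
  rw [integral_finsetSum _ fun i _ => hi.integrable_inner_sq _]
  simp_rw [hi.cov, EuclideanSpace.real_norm_sq_eq]
  rw [Fintype.sum_prod_type]

/-- The expected `p`-th power of `momentPlus` along a Gaussian direction. -/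
theorem momentPlus_gaussian_moment {γ : Measure (EuclideanSpace ℝ (Fin d))}
    [IsProbabilityMeasure γ] (hlc : IsLogConcave γ) (hi : IsIsotropic γ) {p : ℕ} (hp : 2 ≤ p)
    {a : EuclideanSpace ℝ (Fin k)} (ha : ‖a‖ = 1) :
    ENNReal.ofReal ((Real.exp (-4) * √p * √d) ^ p) ≤
      ∫⁻ G : EuclideanSpace ℝ (Fin k × Fin d), ENNReal.ofReal (momentPlus γ p (matAdj G a) ^ p)
        ∂ProbabilityTheory.stdGaussian _ := by
  simp_rw [← lintegral_max_inner_pow hlc hi (show 1 ≤ p by omega)]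
  rw [lintegral_lintegral_swap]
  · simp_rw [← inner_matTensor, stdGaussian_moment_inner, norm_matTensor, ha, one_mul]
    rw [lintegral_mul_const _ (by fun_prop), mul_pow, mul_comm, ENNReal.ofReal_mul (by positivity)]
    refine mul_le_mul' ?_ (gaussianReal_moment_lower (by omega))
    simpa using hi.norm_pow_moment hp
  · have : Measurable fun q : EuclideanSpace ℝ (Fin k × Fin d) × EuclideanSpace ℝ (Fin d) =>
        inner ℝ (matAdj q.1 a) q.2 :=
      (((continuous_matAdj a).comp continuous_fst).inner continuous_snd).measurable
    exact (ENNReal.measurable_ofReal.comp ((this.max measurable_const).pow_const p)).aemeasurable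

end RandomProjection

section GoodProjection

theorem exists_sphere_net (k : ℕ) {B : ℕ} (hB : 2 ≤ B) :
    ∃ Y : Finset (EuclideanSpace ℝ (Fin k)), (∀ y ∈ Y, ‖y‖ = 1) ∧ Y.card ≤ B ^ k ∧
      ∀ x : EuclideanSpace ℝ (Fin k), ‖x‖ = 1 → ∃ y ∈ Y, ‖x - y‖ ≤ 4 / B := by
  have hB0 : (2 : ℝ) ≤ B := by exact_mod_cast hB
  obtain ⟨Y, h1, h2, h3⟩ := exists_finset_separated (d := k) (K := Metric.sphere 0 1)
    (A := Metric.closedBall 0 (4 / B)) (B ^ k) (fun Y hY hsep => by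
      have hdisj : (Y : Set (EuclideanSpace ℝ (Fin k))).PairwiseDisjoint
          fun y => Metric.ball y (2 / B) := by
        intro x hx y hy hxy
        refine Set.disjoint_left.2 fun c hcx hcy => hsep x hx y hy hxy ?_
        rw [mem_closedBall_zero_iff, ← dist_eq_norm]
        rw [Metric.mem_ball] at hcx hcy
        have := dist_triangle_left x y c
        have e : (4 : ℝ) / B = 2 / B + 2 / B := by ring
        linarith
      have hsub : (⋃ y ∈ Y, Metric.ball y (2 / (B : ℝ))) ⊆ Metric.ball 0 2 := by
        refine Set.iUnion₂_subset fun y hy => Metric.ball_subset_ball' ?_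
        have := hY hy
        rw [mem_sphere_iff_norm, sub_zero] at this
        rw [dist_zero_right, this]
        have : 2 / (B : ℝ) ≤ 1 := by rw [div_le_one (by linarith)]; exact hB0
        linarith
      have hv := measure_mono (μ := volume) hsub
      rw [measure_biUnion_finset hdisj fun y _ => measurableSet_ball] at hv
      have hvol : ∀ y : EuclideanSpace ℝ (Fin k), ∀ r : ℝ, 0 < r → volume (Metric.ball y r) =
          ENNReal.ofReal (r ^ k) * volume (Metric.ball (0 : EuclideanSpace ℝ (Fin k)) 1) := by
        intro y r hr
        rw [Measure.addHaar_ball_of_pos volume _ hr, finrank_euclideanSpace_fin]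
      rw [Finset.sum_congr rfl fun y _ => hvol y _ (by positivity), hvol 0 2 (by norm_num)] at hv
      rw [Finset.sum_const, nsmul_eq_mul, ← mul_assoc, ENNReal.mul_le_mul_iff_left
        (Metric.measure_ball_pos volume _ one_pos).ne' measure_ball_lt_top.ne,
        ← ENNReal.ofReal_natCast, ← ENNReal.ofReal_mul (by positivity),
        ENNReal.ofReal_le_ofReal_iff (by positivity), div_pow, mul_div_assoc',
        div_le_iff₀ (by positivity), mul_comm] at hv
      have := le_of_mul_le_mul_left hv (by positivity)
      exact_mod_cast this) (by simp; positivity) (fun x hx => by simpa using hx)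
  exact ⟨Y, fun y hy => by simpa using h1 hy, h2, fun x hx => by simpa using h3 x (by simpa using hx)⟩

theorem exp_one_lt_three : Real.exp 1 < 3 := by linarith [Real.exp_one_lt_d9]

theorem exists_momentPlus_lower {k d : ℕ} {γ : Measure (EuclideanSpace ℝ (Fin d))}
    [IsProbabilityMeasure γ] (hlc : IsLogConcave γ) (hi : IsIsotropic γ) (hk : 40 ≤ k)
    (hd : 2 ^ 40 * k ^ 3 ≤ d) :
    ∃ G : EuclideanSpace ℝ (Fin k × Fin d), ‖G‖ ^ 2 ≤ 4 * k * d ∧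
      ∀ a : EuclideanSpace ℝ (Fin k), ‖a‖ = 1 →
        Real.exp (-7) / 2 * √k * √d ≤ momentPlus γ k (matAdj G a) := by
  have hk0 : (40 : ℝ) ≤ k := by exact_mod_cast hk
  have hdR : (2 : ℝ) ^ 40 * k ^ 3 ≤ d := by exact_mod_cast hd
  have hd0 : (0 : ℝ) < d := lt_of_lt_of_le (by positivity) hdR
  obtain ⟨Y, hY1, hYc, hYn⟩ := exists_sphere_net k (B := 2 ^ 22 * k) (by omega)
  set P := ProbabilityTheory.stdGaussian (EuclideanSpace ℝ (Fin k × Fin d))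
  set w : ℝ := Real.exp (-4) * √k * √d with hw
  have hw0 : 0 < w := by positivity
  have htail : ∀ y ∈ Y, P {G | momentPlus γ k (matAdj G y) ≤ w * Real.exp (-3)} ≤
      ENNReal.ofReal (Real.exp (-(k ^ 2 : ℕ))) := by
    intro y hy
    refine stdGaussian_lower_tail (L := 128 * k) (p := k)
      (((continuous_momentPlus hlc hi (by omega)).comp (continuous_matAdj y)).measurable)
      (fun _ => momentPlus_nonneg _ _) hw0 (fun G G' => ?_) (by omega) (by nlinarith)
      (momentPlus_gaussian_moment hlc hi (by omega) (hY1 y hy)) ?_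
    · refine (momentPlus_sub_le hlc hi (by omega) _ _).trans ?_
      rw [matAdj_sub_left]
      have := norm_matAdj_le (G - G') y
      rw [hY1 y hy, mul_one] at this
      gcongr
    · rw [hw, mul_pow _ (√(d : ℝ)), mul_pow _ (√(k : ℝ)), Real.sq_sqrt (Nat.cast_nonneg k),
        Real.sq_sqrt hd0.le, ← Real.exp_nat_mul]
      have e1 : Real.exp 6 = Real.exp 14 * Real.exp ((2 : ℕ) * (-4)) := by
        rw [← Real.exp_add]; norm_num
      have e2 : Real.exp 14 ≤ 3 ^ 14 := by
        have : Real.exp 14 = Real.exp 1 ^ 14 := by rw [← Real.exp_nat_mul]; norm_num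
        rw [this]; exact pow_le_pow_left₀ (Real.exp_pos _).le exp_one_lt_three.le _
      rw [e1]
      push_cast
      have h3 : Real.exp 14 * 128 ^ 2 * k ^ 3 ≤ d := by
        refine le_trans ?_ hdR
        gcongr
        linarith
      calc (k : ℝ) ^ 2 * (Real.exp 14 * Real.exp (2 * -4)) * (128 * k) ^ 2
          = Real.exp (2 * -4) * k * (Real.exp 14 * 128 ^ 2 * k ^ 3) := by ring
        _ ≤ _ := by gcongr
  have hnorm : P {G | 4 * k * d ≤ ‖G‖ ^ 2} ≤ ENNReal.ofReal (1 / 4) := by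
    have h := mul_meas_ge_le_lintegral₀ (μ := P)
      (f := fun G : EuclideanSpace ℝ (Fin k × Fin d) => ENNReal.ofReal (‖G‖ ^ 2)) (by fun_prop)
      (ENNReal.ofReal (4 * k * d))
    rw [stdGaussian_lintegral_norm_sq, finrank_euclideanSpace, Fintype.card_prod, Fintype.card_fin,
      Fintype.card_fin] at h
    have hs : {G : EuclideanSpace ℝ (Fin k × Fin d) | 4 * k * d ≤ ‖G‖ ^ 2} ⊆
        {x | ENNReal.ofReal (4 * k * d) ≤ ENNReal.ofReal (‖x‖ ^ 2)} :=
      fun G hG => ENNReal.ofReal_le_ofReal hG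
    refine (measure_mono hs).trans ?_
    have h4 : ENNReal.ofReal (4 * k * d) ≠ 0 := by
      rw [ne_eq, ENNReal.ofReal_eq_zero, not_le]; positivity
    rw [← ENNReal.mul_le_mul_iff_right h4 ENNReal.ofReal_ne_top]
    refine h.trans (le_of_eq ?_)
    rw [← ENNReal.ofReal_mul (by positivity), ← ENNReal.ofReal_natCast]
    congr 1; push_cast; ring
  by_contra! hcon
  have hcov : (Set.univ : Set (EuclideanSpace ℝ (Fin k × Fin d))) ⊆ {G | 4 * k * d ≤ ‖G‖ ^ 2} ∪
      ⋃ y ∈ Y, {G | momentPlus γ k (matAdj G y) ≤ w * Real.exp (-3)} := by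
    intro G _
    by_cases hG : 4 * k * d ≤ ‖G‖ ^ 2
    · exact Or.inl hG
    · right
      push Not at hG
      obtain ⟨a, ha, hlt⟩ := hcon G hG.le
      obtain ⟨y, hy, hay⟩ := hYn a ha
      refine Set.mem_iUnion₂.2 ⟨y, hy, ?_⟩
      have h1 := momentPlus_sub_le hlc hi (show 1 ≤ k by omega) (matAdj G y) (matAdj G a)
      rw [matAdj_sub_right] at h1
      have h2 := norm_matAdj_le G (y - a)
      rw [norm_sub_rev] at hay
      have h3 : ‖G‖ ≤ 2 * (√k * √d) := by
        refine le_of_sq_le_sq ?_ (by positivity)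
        rw [mul_pow, mul_pow, Real.sq_sqrt (by positivity), Real.sq_sqrt hd0.le]; linarith
      have h4 : ‖matAdj G (y - a)‖ ≤ 2 * (√k * √d) * (4 / ((2 ^ 22 * k : ℕ) : ℝ)) :=
        h2.trans (by gcongr)
      have h5 : 128 * (k : ℝ) * (2 * (√k * √d) * (4 / ((2 ^ 22 * k : ℕ) : ℝ))) =
          (√k * √d) * (1 / 4096) := by
        push_cast; field_simp; norm_num
      have h6 : 128 * (k : ℝ) * ‖matAdj G (y - a)‖ ≤ (√k * √d) * (1 / 4096) := by
        rw [← h5]; gcongr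
      have e3 : w * Real.exp (-3) = Real.exp (-7) * (√k * √d) := by
        rw [hw, show (-7 : ℝ) = -4 + -3 by norm_num, Real.exp_add]; ring
      have e4 : 1 / 2048 ≤ Real.exp (-7) := by
        rw [Real.exp_neg, one_div]
        refine inv_anti₀ (Real.exp_pos _) ?_
        have : Real.exp 7 = Real.exp 1 ^ 7 := by rw [← Real.exp_nat_mul]; norm_num
        rw [this]
        refine (pow_le_pow_left₀ (Real.exp_pos _).le
          (show Real.exp 1 ≤ 2.72 by linarith [Real.exp_one_lt_d9]) _).trans (by norm_num)
      rw [Set.mem_ofPred_eq, e3]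
      have : 0 ≤ √k * √(d : ℝ) := by positivity
      nlinarith
  have hfin := (measure_mono (μ := P) hcov).trans ((measure_union_le _ _).trans
    (add_le_add hnorm ((measure_biUnion_finset_le _ _).trans (Finset.sum_le_sum htail))))
  rw [measure_univ, Finset.sum_const, nsmul_eq_mul, ← ENNReal.ofReal_natCast,
    ← ENNReal.ofReal_mul (by positivity), ← ENNReal.ofReal_add (by positivity) (by positivity),
    ENNReal.one_le_ofReal] at hfin
  have hc : (Y.card : ℝ) ≤ (2 ^ 22 * k) ^ k := by exact_mod_cast hYc
  have hpow : (2 : ℝ) ^ 23 * k ≤ 2 ^ k := by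
    have : ∀ n : ℕ, 40 ≤ n → 2 ^ 23 * n ≤ 2 ^ n := by
      intro n hn
      induction n, hn using Nat.le_induction with
      | base => norm_num
      | succ n hn ih => rw [pow_succ 2 n]; omega
    exact_mod_cast this k hk
  have hek : (2 : ℝ) ^ k ≤ Real.exp k := by
    have : Real.exp k = Real.exp 1 ^ k := by rw [← Real.exp_nat_mul, mul_one]
    rw [this]
    exact pow_le_pow_left₀ (by norm_num) (by linarith [Real.exp_one_gt_d9]) _
  have h1 : ((2 : ℝ) ^ 22 * k) ^ k ≤ Real.exp (k ^ 2) * (1 / 2) ^ k := by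
    have : Real.exp ((k : ℝ) ^ 2) = Real.exp k ^ k := by rw [← Real.exp_nat_mul, sq]
    rw [this, ← mul_pow]
    refine pow_le_pow_left₀ (by positivity) ?_ _
    have := hpow.trans hek
    have e : (2 : ℝ) ^ 23 * k = 2 * (2 ^ 22 * k) := by ring
    rw [e] at this
    linarith
  have h2 : ((1 : ℝ) / 2) ^ k ≤ 1 / 2 := by
    simpa using pow_le_pow_of_le_one (show (0 : ℝ) ≤ 1 / 2 by norm_num) (by norm_num) (show 1 ≤ k by omega)
  have h3 : (Y.card : ℝ) * Real.exp (-(k ^ 2 : ℕ)) ≤ 1 / 2 := by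
    push_cast
    rw [Real.exp_neg, ← div_eq_mul_inv, div_le_iff₀ (Real.exp_pos _)]
    have := mul_le_mul_of_nonneg_left h2 (Real.exp_pos ((k : ℝ) ^ 2)).le
    rw [mul_comm (1 / 2 : ℝ)]
    exact (hc.trans h1).trans this
  linarith

end GoodProjection

section SmallBall

variable {F : Type*} [NormedAddCommGroup F] [InnerProductSpace ℝ F] [FiniteDimensional ℝ F]
  [MeasurableSpace F] [BorelSpace F] {μ : Measure F} [IsProbabilityMeasure μ]

theorem IsLogConcave.real_closedBall (hlc : IsLogConcave μ) (ρ : ℝ) {l : ℝ} (h0 : 0 < l)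
    (h1 : l < 1) (x y : F) :
    μ.real (Metric.closedBall x ρ) ^ (1 - l) * μ.real (Metric.closedBall y ρ) ^ l ≤
      μ.real (Metric.closedBall ((1 - l) • x + l • y) ρ) := by
  have h := hlc l h0 h1 (Metric.closedBall x ρ) (Metric.closedBall y ρ)
    (Metric.closedBall ((1 - l) • x + l • y) ρ) Metric.isClosed_closedBall.measurableSet
    Metric.isClosed_closedBall.measurableSet Metric.isClosed_closedBall.measurableSet
    (fun x' hx y' hy => by
      rw [mem_closedBall_iff_norm] at hx hy ⊢
      have e : (1 - l) • x' + l • y' - ((1 - l) • x + l • y) =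
          (1 - l) • (x' - x) + l • (y' - y) := by module
      rw [e]
      refine (norm_add_le _ _).trans ?_
      rw [norm_smul, norm_smul, Real.norm_of_nonneg h0.le, Real.norm_of_nonneg (by linarith)]
      nlinarith)
  have h2 := ENNReal.toReal_mono (measure_ne_top _ _) h
  rwa [ENNReal.toReal_mul, ← ENNReal.toReal_rpow, ← ENNReal.toReal_rpow] at h2

theorem measurableSet_dist_le (ρ : ℝ) :
    MeasurableSet {p : F × F | dist p.1 p.2 ≤ ρ} :=
  (isClosed_le (by fun_prop) (by fun_prop)).measurableSet

theorem measurable_measure_closedBall (ρ : ℝ) : Measurable fun u : F => μ (Metric.closedBall u ρ) := by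
  have h := measurable_measure_prodMk_left (ν := μ) (measurableSet_dist_le (F := F) ρ)
  have e : ∀ u : F, Prod.mk u ⁻¹' {p : F × F | dist p.1 p.2 ≤ ρ} = Metric.closedBall u ρ := by
    intro u; ext y; simp [dist_comm]
  simpa only [e] using h

/-- Averaging `f` against the mass of moving balls. -/
theorem lintegral_mul_measure_closedBall (ρ : ℝ) {f : F → ℝ≥0∞} (hf : Measurable f) :
    ∫⁻ u, f u * μ (Metric.closedBall u ρ) = ∫⁻ y, ∫⁻ u in Metric.closedBall y ρ, f u ∂volume ∂μ := by
  have e1 : ∀ u, f u * μ (Metric.closedBall u ρ) =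
      ∫⁻ y, {p : F × F | dist p.1 p.2 ≤ ρ}.indicator (fun p => f p.1) (u, y) ∂μ := by
    intro u
    rw [← lintegral_indicator_const Metric.isClosed_closedBall.measurableSet]
    refine lintegral_congr fun y => ?_
    classical
    simp only [Set.indicator_apply, Metric.mem_closedBall, Set.mem_ofPred_eq, dist_comm]
  have e2 : ∀ y, ∫⁻ u in Metric.closedBall y ρ, f u =
      ∫⁻ u, {p : F × F | dist p.1 p.2 ≤ ρ}.indicator (fun p => f p.1) (u, y) := by
    intro y
    rw [← lintegral_indicator Metric.isClosed_closedBall.measurableSet]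
    refine lintegral_congr fun u => ?_
    classical
    simp only [Set.indicator_apply, Metric.mem_closedBall, Set.mem_ofPred_eq]
  simp_rw [e1, e2]
  refine lintegral_lintegral_swap ?_
  exact ((hf.comp measurable_fst).indicator (measurableSet_dist_le ρ)).aemeasurable

theorem lintegral_measure_closedBall (ρ : ℝ) :
    ∫⁻ u : F, μ (Metric.closedBall u ρ) = volume (Metric.closedBall (0 : F) ρ) := by
  have h := lintegral_mul_measure_closedBall (μ := μ) ρ (f := fun _ : F => 1) measurable_const
  simp only [one_mul, setLIntegral_one] at h
  rw [h]
  simp_rw [Measure.addHaar_closedBall_center volume _ ρ]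
  simp

theorem half_le_lintegral_closedBall (ρ : ℝ) {f : F → ℝ≥0∞} (hf : Measurable f) (y : F)
    (h : ∀ v, f y ≤ f (y + v) + f (y - v)) :
    f y * volume (Metric.closedBall (0 : F) ρ) ≤ 2 * ∫⁻ u in Metric.closedBall y ρ, f u := by
  have hB : MeasurableSet (Metric.closedBall (0 : F) ρ) := Metric.isClosed_closedBall.measurableSet
  have hBy : MeasurableSet (Metric.closedBall y ρ) := Metric.isClosed_closedBall.measurableSet
  have e1 : ∫⁻ u in Metric.closedBall y ρ, f u = ∫⁻ v in Metric.closedBall 0 ρ, f (y + v) := by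
    rw [← lintegral_indicator hBy, ← lintegral_indicator hB,
      ← lintegral_add_left_eq_self _ y]
    refine lintegral_congr fun v => ?_
    classical
    simp [Set.indicator_apply, dist_eq_norm]
  have e2 : ∫⁻ u in Metric.closedBall y ρ, f u = ∫⁻ v in Metric.closedBall 0 ρ, f (y - v) := by
    rw [← lintegral_indicator hBy, ← lintegral_indicator hB,
      ← lintegral_sub_left_eq_self _ y]
    refine lintegral_congr fun v => ?_
    classical
    simp [Set.indicator_apply, dist_eq_norm]
  calc f y * volume (Metric.closedBall (0 : F) ρ) = ∫⁻ v in Metric.closedBall (0 : F) ρ, f y := by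
        rw [setLIntegral_const]
    _ ≤ ∫⁻ v in Metric.closedBall (0 : F) ρ, (f (y + v) + f (y - v)) := lintegral_mono fun v => h v
    _ = _ := by
        rw [lintegral_add_left (by fun_prop), ← e1, ← e2, two_mul]

/-- A half-space outside of which the ball masses are small controls moments. -/
theorem lintegral_moment_closedBall_le (hlc : IsLogConcave μ) (ρ : ℝ) {k : ℕ}
    (hk : Module.finrank ℝ F = k) (a : F) {s : ℝ} (hs : 0 < s)
    (h0 : 0 < μ.real (Metric.closedBall 0 ρ))
    (h : ∀ u : F, s ≤ inner ℝ a u →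
      μ.real (Metric.closedBall u ρ) ≤ Real.exp (-(2 * k)) * μ.real (Metric.closedBall 0 ρ)) :
    ∫⁻ u, ENNReal.ofReal (max (inner ℝ a u) 0 ^ k) * μ (Metric.closedBall u ρ) ≤
      ENNReal.ofReal (2 * s ^ k) * volume (Metric.closedBall (0 : F) ρ) := by
  set g : F → ℝ := fun u => μ.real (Metric.closedBall u ρ) with hg
  have hg0 : ∀ u, 0 ≤ g u := fun u => measureReal_nonneg
  have hray : ∀ u, s ≤ inner ℝ a u →
      g u ≤ g 0 * Real.exp (-(2 * k * (inner ℝ a u / s))) := by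
    intro u hu
    set t := inner ℝ a u / s with ht
    have ht1 : 1 ≤ t := by rwa [ht, one_le_div hs]
    have ht0 : 0 < t := by linarith
    rcases ht1.eq_or_lt with h1 | h1
    · rw [← h1, mul_one, mul_comm]; exact h u hu
    · rcases (hg0 u).eq_or_lt with hz | hz
      · rw [← hz]; positivity
      · have h2 := hlc.real_closedBall ρ (inv_pos.2 ht0) (inv_lt_one_of_one_lt₀ h1) 0 u
        rw [smul_zero, zero_add] at h2
        have h3 := h2.trans (h (t⁻¹ • u) (by
          rw [inner_smul_right, ht, inv_div]
          have : 0 < inner ℝ a u := by linarith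
          rw [div_mul_cancel₀ _ this.ne']))
        have h4 := Real.log_le_log (by positivity) h3
        rw [Real.log_mul (by positivity) (by positivity), Real.log_rpow h0, Real.log_rpow hz,
          Real.log_mul (by positivity) h0.ne', Real.log_exp] at h4
        rw [← Real.log_le_log_iff hz (by positivity), Real.log_mul h0.ne' (by positivity),
          Real.log_exp]
        change Real.log (μ.real (Metric.closedBall u ρ)) ≤ Real.log (μ.real (Metric.closedBall 0 ρ)) + _
        have h5 := mul_le_mul_of_nonneg_left h4 ht0.le
        have e : t * t⁻¹ = 1 := mul_inv_cancel₀ ht0.ne'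
        linear_combination h5 - (Real.log (μ.real (Metric.closedBall u ρ)) -
          Real.log (μ.real (Metric.closedBall 0 ρ))) * e
  have hhalf : ∀ u, g 0 * g u ≤ g ((2⁻¹ : ℝ) • u) ^ 2 := by
    intro u
    have h2 := hlc.real_closedBall ρ (l := 1 / 2) (by norm_num) (by norm_num) 0 u
    rw [smul_zero, zero_add, show (1 : ℝ) - 1 / 2 = 1 / 2 by norm_num,
      ← Real.mul_rpow h0.le (hg0 u), ← Real.sqrt_eq_rpow] at h2
    have h3 := pow_le_pow_left₀ (Real.sqrt_nonneg _) h2 2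
    rw [Real.sq_sqrt (mul_nonneg h0.le (hg0 u)), one_div] at h3
    exact h3
  have hpt : ∀ u, max (inner ℝ a u) 0 ^ k * g u ≤
      s ^ k * g u + s ^ k * Real.exp (-k) * g ((2⁻¹ : ℝ) • u) := by
    intro u
    rcases le_total (inner ℝ a u) s with hu | hu
    · have : max (inner ℝ a u) 0 ^ k ≤ s ^ k :=
        pow_le_pow_left₀ (le_max_right _ _) (max_le hu hs.le) _
      have h2 := mul_le_mul_of_nonneg_right this (hg0 u)
      have h3 : 0 ≤ s ^ k * Real.exp (-k) * g ((2⁻¹ : ℝ) • u) :=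
        mul_nonneg (by positivity) (hg0 _)
      linarith
    · set t := inner ℝ a u / s with ht
      have hts : max (inner ℝ a u) 0 = s * t := by
        rw [max_eq_left (by linarith), ht, mul_div_cancel₀ _ hs.ne']
      have ht1 : 1 ≤ t := by rwa [ht, one_le_div hs]
      have h1 : g u ≤ Real.exp (-(k * t)) * g ((2⁻¹ : ℝ) • u) := by
        refine le_of_sq_le_sq ?_ (mul_nonneg (Real.exp_pos _).le (hg0 _))
        have e : Real.exp (-(k * t)) ^ 2 = Real.exp (-(2 * k * t)) := by
          rw [← Real.exp_nat_mul]; congr 1; push_cast; ring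
        rw [mul_pow, e]
        calc g u ^ 2 = g u * g u := sq _
          _ ≤ (g 0 * Real.exp (-(2 * k * t))) * g u :=
            mul_le_mul_of_nonneg_right (hray u hu) (hg0 u)
          _ = Real.exp (-(2 * k * t)) * (g 0 * g u) := by ring
          _ ≤ _ := by gcongr; exact hhalf u
      have h2 : t ^ k * Real.exp (-(k * t)) ≤ Real.exp (-k) := by
        have e1 : Real.exp (-(k * t)) = Real.exp (-t) ^ k := by
          rw [← Real.exp_nat_mul]; congr 1; ring
        have e2 : Real.exp (-(k : ℝ)) = Real.exp (-1) ^ k := by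
          rw [← Real.exp_nat_mul]; congr 1; ring
        rw [e1, e2, ← mul_pow]
        refine pow_le_pow_left₀ (by positivity) ?_ _
        have := Real.add_one_le_exp (t - 1)
        calc t * Real.exp (-t) ≤ Real.exp (t - 1) * Real.exp (-t) := by gcongr; linarith
          _ = _ := by rw [← Real.exp_add]; congr 1; ring
      rw [hts, mul_pow]
      calc s ^ k * t ^ k * g u ≤ s ^ k * t ^ k * (Real.exp (-(k * t)) * g ((2⁻¹ : ℝ) • u)) := by gcongr
        _ = s ^ k * (t ^ k * Real.exp (-(k * t))) * g ((2⁻¹ : ℝ) • u) := by ring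
        _ ≤ s ^ k * Real.exp (-k) * g ((2⁻¹ : ℝ) • u) := by
          gcongr
        _ ≤ _ := by
          have : 0 ≤ s ^ k * g u := mul_nonneg (by positivity) (hg0 u)
          linarith
  have hgm := measurable_measure_closedBall (μ := μ) ρ
  have hgr : ∀ u, μ (Metric.closedBall u ρ) = ENNReal.ofReal (g u) := fun u =>
    (ofReal_measureReal (measure_ne_top _ _)).symm
  calc ∫⁻ u, ENNReal.ofReal (max (inner ℝ a u) 0 ^ k) * μ (Metric.closedBall u ρ)
      ≤ ∫⁻ u, (ENNReal.ofReal (s ^ k) * μ (Metric.closedBall u ρ) +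
          ENNReal.ofReal (s ^ k * Real.exp (-k)) * μ (Metric.closedBall ((2⁻¹ : ℝ) • u) ρ)) := by
        refine lintegral_mono fun u => ?_
        rw [hgr, hgr, ← ENNReal.ofReal_mul (by positivity), ← ENNReal.ofReal_mul (by positivity),
          ← ENNReal.ofReal_mul (by positivity), ← ENNReal.ofReal_add
          (mul_nonneg (by positivity) (hg0 u)) (mul_nonneg (by positivity) (hg0 _))]
        exact ENNReal.ofReal_le_ofReal (hpt u)
    _ = ENNReal.ofReal (s ^ k) * volume (Metric.closedBall (0 : F) ρ) +
          ENNReal.ofReal (s ^ k * Real.exp (-k)) *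
            (ENNReal.ofReal (2 ^ k) * volume (Metric.closedBall (0 : F) ρ)) := by
        have hscale : ∫⁻ u : F, μ (Metric.closedBall ((2⁻¹ : ℝ) • u) ρ) =
            ENNReal.ofReal (2 ^ k) * volume (Metric.closedBall (0 : F) ρ) := by
          rw [← lintegral_map hgm (measurable_const_smul (2⁻¹ : ℝ)),
            Measure.map_addHaar_smul volume (by norm_num), lintegral_smul_measure,
            lintegral_measure_closedBall, hk, inv_pow, inv_inv, abs_of_pos (by positivity),
            smul_eq_mul]
        rw [lintegral_add_left (hgm.const_mul _), lintegral_const_mul _ hgm,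
          lintegral_const_mul' _ _ ENNReal.ofReal_ne_top, lintegral_measure_closedBall, hscale]
    _ ≤ ENNReal.ofReal (s ^ k) * volume (Metric.closedBall (0 : F) ρ) +
          ENNReal.ofReal (s ^ k) * volume (Metric.closedBall (0 : F) ρ) := by
        rw [← mul_assoc, ← ENNReal.ofReal_mul (by positivity)]
        gcongr
        have e2 : Real.exp (-(k : ℝ)) = Real.exp (-1) ^ k := by
          rw [← Real.exp_nat_mul]; congr 1; ring
        rw [mul_assoc, e2, ← mul_pow]
        refine mul_le_of_le_one_right (by positivity) (pow_le_one₀ (by positivity) ?_)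
        rw [Real.exp_neg, inv_mul_le_iff₀ (Real.exp_pos _)]
        linarith [Real.exp_one_gt_d9]
    _ = _ := by
        rw [← two_mul, ← mul_assoc, ENNReal.ofReal_mul (by norm_num), ENNReal.ofReal_ofNat]

theorem pow_le_of_halfspace (hlc : IsLogConcave μ) {ρ : ℝ} (hρ : 0 < ρ) {k : ℕ}
    (hk : Module.finrank ℝ F = k) (a : F) {s w : ℝ} (hs : 0 < s)
    (h0 : 0 < μ.real (Metric.closedBall 0 ρ))
    (h : ∀ u : F, s ≤ inner ℝ a u →
      μ.real (Metric.closedBall u ρ) ≤ Real.exp (-(2 * k)) * μ.real (Metric.closedBall 0 ρ))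
    (hw : ENNReal.ofReal (w ^ k) ≤ ∫⁻ y, ENNReal.ofReal (max (inner ℝ a y) 0 ^ k) ∂μ) :
    w ^ k ≤ 4 * s ^ k := by
  have hup := lintegral_moment_closedBall_le hlc ρ hk a hs h0 h
  have hfm : Measurable fun u : F => ENNReal.ofReal (max (inner ℝ a u) 0 ^ k) := by fun_prop
  rw [lintegral_mul_measure_closedBall ρ hfm] at hup
  set v := volume (Metric.closedBall (0 : F) ρ) with hv
  have hv0 : v ≠ 0 := (Metric.measure_closedBall_pos volume _ hρ).ne'
  have hvt : v ≠ ∞ := measure_closedBall_lt_top.ne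
  have hlow : (∫⁻ y, ENNReal.ofReal (max (inner ℝ a y) 0 ^ k) ∂μ) * v ≤
      2 * ∫⁻ y, ∫⁻ u in Metric.closedBall y ρ, ENNReal.ofReal (max (inner ℝ a u) 0 ^ k) ∂volume ∂μ := by
    rw [← lintegral_mul_const _ hfm, ← lintegral_const_mul' _ _ (by simp)]
    refine lintegral_mono fun y => half_le_lintegral_closedBall ρ hfm y fun z => ?_
    rcases le_total 0 (inner ℝ a z) with hz | hz
    · refine le_add_right (ENNReal.ofReal_le_ofReal (pow_le_pow_left₀ (le_max_right _ _) ?_ _))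
      rw [inner_add_right]
      exact max_le_max_right _ (by linarith)
    · refine le_add_left (ENNReal.ofReal_le_ofReal (pow_le_pow_left₀ (le_max_right _ _) ?_ _))
      rw [inner_sub_right]
      exact max_le_max_right _ (by linarith)
  have h1 : ENNReal.ofReal (w ^ k) * v ≤ ENNReal.ofReal (4 * s ^ k) * v := by
    refine (mul_le_mul_left hw v).trans (hlow.trans ((mul_le_mul_right hup 2).trans (le_of_eq ?_)))
    rw [← mul_assoc, show (2 : ℝ≥0∞) = ENNReal.ofReal 2 by simp,
      ← ENNReal.ofReal_mul (by norm_num)]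
    congr 2; ring
  rw [ENNReal.mul_le_mul_iff_left hv0 hvt, ENNReal.ofReal_le_ofReal_iff (by positivity)] at h1
  exact h1

/-- Log-concave measures all of whose one-sided moments are large give little mass to small
balls. -/
theorem IsLogConcave.measure_closedBall_le_exp (hlc : IsLogConcave μ) {ρ w : ℝ} (hρ : 0 < ρ) {k : ℕ}
    (hk : Module.finrank ℝ F = k) (hk1 : 1 ≤ k)
    (hw : ∀ a : F, ‖a‖ = 1 →
      ENNReal.ofReal (w ^ k) ≤ ∫⁻ y, ENNReal.ofReal (max (inner ℝ a y) 0 ^ k) ∂μ)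
    (hρw : 4 * Real.exp 3 * ρ ≤ w) :
    μ (Metric.closedBall 0 ρ) ≤ ENNReal.ofReal (Real.exp (-k)) := by
  have hw0 : 0 < w := lt_of_lt_of_le (by positivity) hρw
  rw [← ofReal_measureReal (measure_ne_top _ _)]
  refine ENNReal.ofReal_le_ofReal ?_
  set q := μ.real (Metric.closedBall (0 : F) ρ) with hq
  have hq0 : 0 ≤ q := measureReal_nonneg
  rcases hq0.eq_or_lt with h0 | h0
  · rw [← h0]; positivity
  set V : Set F := {u | Real.exp (-(2 * k)) * q ≤ μ.real (Metric.closedBall u ρ)} with hV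
  have hVconv : Convex ℝ V := by
    rw [convex_iff_forall_pos]
    intro x hx y hy a b ha hb hab
    obtain rfl : a = 1 - b := by linarith
    rw [hV, Set.mem_ofPred_eq] at hx hy ⊢
    refine le_trans ?_ (hlc.real_closedBall ρ hb (by linarith) x y)
    set c := Real.exp (-(2 * k)) * q
    have hc : 0 < c := by positivity
    calc c = c ^ (1 - b) * c ^ b := by rw [← Real.rpow_add hc]; simp
      _ ≤ _ := by gcongr
  have h0V : (0 : F) ∈ V := by
    rw [hV, Set.mem_ofPred_eq]
    refine mul_le_of_le_one_left h0.le (Real.exp_le_one_iff.2 ?_)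
    have : (0 : ℝ) ≤ k := by positivity
    linarith
  have hball : Metric.ball (0 : F) (w / 4) ⊆ closure V := by
    intro b hb
    by_contra hbV
    obtain ⟨f, t, h1, h2⟩ := geometric_hahn_banach_closed_point hVconv.closure isClosed_closure hbV
    set a' := (InnerProductSpace.toDual ℝ F).symm f with ha'
    have hf : ∀ x, f x = inner ℝ a' x := fun x => by
      rw [ha', InnerProductSpace.toDual_symm_apply]
    have ht : 0 < t := by simpa using h1 0 (subset_closure h0V)
    rw [hf] at h2
    have hb' : ‖b‖ < w / 4 := by simpa using hb
    have hn : 0 < ‖a'‖ := by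
      rw [norm_pos_iff]; intro h; rw [h, inner_zero_left] at h2; linarith
    have h3 := pow_le_of_halfspace hlc hρ hk (‖a'‖⁻¹ • a') (s := t / ‖a'‖) (w := w) (by positivity) h0
      (fun u hu => by
        rw [real_inner_smul_left, div_eq_inv_mul] at hu
        have hu' := le_of_mul_le_mul_left hu (by positivity)
        by_contra! hcon
        have := h1 u (subset_closure hcon.le)
        rw [hf] at this; linarith)
      (hw _ (by rw [norm_smul, norm_inv, norm_norm, inv_mul_cancel₀ hn.ne']))
    have h4 : t / ‖a'‖ < w / 4 := by
      rw [div_lt_iff₀ hn]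
      have := real_inner_le_norm a' b
      nlinarith
    have h5 : 4 * (t / ‖a'‖) ^ k < w ^ k := by
      calc 4 * (t / ‖a'‖) ^ k < 4 * (w / 4) ^ k := by
            gcongr
        _ ≤ w ^ k := by
            rw [div_pow, mul_div_assoc', div_le_iff₀ (by positivity), mul_comm]
            gcongr
            exact le_self_pow₀ (by norm_num) (by omega)
    linarith
  have hvol : volume (Metric.ball (0 : F) (w / 4)) ≤ volume V := by
    refine (measure_mono hball).trans ?_
    have : closure V ⊆ V ∪ frontier V := by
      rw [closure_eq_self_union_frontier]
    refine (measure_mono this).trans ((measure_union_le _ _).trans ?_)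
    rw [hVconv.addHaar_frontier volume, add_zero]
  have hmk := mul_meas_ge_le_lintegral₀ (measurable_measure_closedBall (μ := μ) ρ).aemeasurable
    (μ := volume) (ENNReal.ofReal (Real.exp (-(2 * k)) * q))
  rw [lintegral_measure_closedBall] at hmk
  have hVe : V ⊆ {x | ENNReal.ofReal (Real.exp (-(2 * k)) * q) ≤ μ (Metric.closedBall x ρ)} := by
    intro u hu
    rw [Set.mem_ofPred_eq, ← ofReal_measureReal (measure_ne_top _ _)]
    exact ENNReal.ofReal_le_ofReal hu
  have h6 := (mul_le_mul_right (hvol.trans (measure_mono hVe)) _).trans hmk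
  rw [Measure.addHaar_ball_of_pos _ _ (by positivity), Measure.addHaar_closedBall _ _ hρ.le, hk, ← mul_assoc,
    ENNReal.mul_le_mul_iff_left (Metric.measure_ball_pos volume _ one_pos).ne'
    measure_ball_lt_top.ne, ← ENNReal.ofReal_mul (by positivity),
    ENNReal.ofReal_le_ofReal_iff (by positivity)] at h6
  have e1 : Real.exp (-(2 * k)) = Real.exp (-2) ^ k := by
    rw [← Real.exp_nat_mul]; congr 1; ring
  have e2 : Real.exp (-(k : ℝ)) = Real.exp (-1) ^ k := by
    rw [← Real.exp_nat_mul]; congr 1; ring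
  have h7 : ρ ^ k ≤ Real.exp (-(k : ℝ)) * (Real.exp (-(2 * k)) * (w / 4) ^ k) := by
    rw [e1, e2, ← mul_pow, ← mul_pow]
    refine pow_le_pow_left₀ hρ.le ?_ _
    rw [← mul_assoc, ← Real.exp_add, show (-1 + -2 : ℝ) = -3 by norm_num, Real.exp_neg,
      le_inv_mul_iff₀ (Real.exp_pos _)]
    linarith
  have h8 : q * (Real.exp (-(2 * k)) * (w / 4) ^ k) ≤
      Real.exp (-(k : ℝ)) * (Real.exp (-(2 * k)) * (w / 4) ^ k) := by linarith
  exact le_of_mul_le_mul_right h8 (by positivity)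

end SmallBall

section LogBound

theorem sub_one_le_of_midLaw_le {F : Type*} [NormedAddCommGroup F] [InnerProductSpace ℝ F]
    [FiniteDimensional ℝ F] [MeasurableSpace F] [BorelSpace F] {γ : Measure F}
    [IsProbabilityMeasure γ] (h2 : MemLp id 2 γ) (h0 : ∫ x, x ∂γ = 0) {Δ : ℝ}
    (hM : midLaw γ ≤ ENNReal.ofReal (Real.exp Δ) • γ) (m : ℕ) {R t : ℝ} (hR : 0 < R)
    (hR2 : 2 * ∫ x, ‖x‖ ^ 2 ∂γ ≤ 2 ^ m * R ^ 2)
    (ht : γ (Metric.closedBall 0 R) ≤ ENNReal.ofReal (Real.exp (-t))) :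
    t - 1 ≤ ((2 ^ m - 1 : ℕ) : ℝ) * Δ := by
  have h := (half_le_of_midLaw_le h2 h0 hM m hR hR2).trans (mul_le_mul_right ht _)
  generalize 2 ^ m - 1 = n at h ⊢
  rw [← ENNReal.ofReal_pow (Real.exp_pos _).le, ← ENNReal.ofReal_mul (by positivity),
    ← Real.exp_nat_mul, ← Real.exp_add, show (2⁻¹ : ℝ≥0∞) = ENNReal.ofReal 2⁻¹ by
      rw [ENNReal.ofReal_inv_of_pos (by norm_num)]; simp,
    ENNReal.ofReal_le_ofReal_iff (Real.exp_pos _).le] at h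
  have h3 : Real.exp (-1) ≤ 2⁻¹ := by
    rw [Real.exp_neg]
    exact inv_anti₀ (by norm_num) (by linarith [Real.exp_one_gt_d9])
  have := Real.exp_le_exp.1 (h3.trans h)
  linarith

theorem sub_one_le_of_isIsotropic {k d : ℕ} {γ : Measure (EuclideanSpace ℝ (Fin d))}
    [IsProbabilityMeasure γ] (hlc : IsLogConcave γ) (hi : IsIsotropic γ) (hk : 40 ≤ k)
    (hd : 2 ^ 40 * k ^ 3 ≤ d) {Δ : ℝ} (hM : midLaw γ ≤ ENNReal.ofReal (Real.exp Δ) • γ) :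
    (k : ℝ) - 1 ≤ ((2 ^ 41 - 1 : ℕ) : ℝ) * Δ := by
  obtain ⟨G, hG, hGa⟩ := exists_momentPlus_lower hlc hi hk hd
  have hk0 : (0 : ℝ) < k := by exact_mod_cast (by omega : 0 < k)
  have hd0 : (0 : ℝ) < d := by
    have : 0 < d := lt_of_lt_of_le (by positivity) hd
    exact_mod_cast this
  set T : EuclideanSpace ℝ (Fin d) →L[ℝ] EuclideanSpace ℝ (Fin k) :=
    ((√(d : ℝ))⁻¹ • matMap G).toContinuousLinearMap with hT
  have hTx : ∀ x, T x = (√(d : ℝ))⁻¹ • matMap G x := fun x => rfl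
  have hTm : Measurable T := T.continuous.measurable
  have : IsProbabilityMeasure (γ.map T) := Measure.isProbabilityMeasure_map hTm.aemeasurable
  have hlc' : IsLogConcave (γ.map T) := hlc.map hTm fun l x y => by simp
  have hM' : midLaw (γ.map T) ≤ ENNReal.ofReal (Real.exp Δ) • γ.map T := by
    rw [midLaw_map γ T hTm fun x y => by simp, ← Measure.map_smul]
    exact Measure.map_mono hM hTm
  have hmem : MemLp id 2 (γ.map T) := by
    rw [memLp_map_measure_iff (by fun_prop) hTm.aemeasurable]
    exact T.comp_memLp' hi.memLp
  have hmean : ∫ x, x ∂(γ.map T) = 0 := by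
    rw [integral_map hTm.aemeasurable (by fun_prop)]
    have := T.integral_comp_comm (μ := γ) (φ := id) (hi.memLp.integrable (by norm_num))
    simp only [id] at this
    rw [this, hi.mean, map_zero]
  have hsq : ∫ x, ‖x‖ ^ 2 ∂(γ.map T) ≤ 4 * k := by
    rw [integral_map hTm.aemeasurable (by fun_prop)]
    simp_rw [hTx, norm_smul, mul_pow]
    rw [integral_const_mul, integral_norm_sq_matMap hi, norm_inv, inv_pow, Real.norm_eq_abs, sq_abs,
      Real.sq_sqrt hd0.le, inv_mul_le_iff₀ hd0]
    linarith
  refine sub_one_le_of_midLaw_le hmem hmean hM' 41 (R := Real.exp (-10) / 8 * √k) (by positivity)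
    ?_ ?_
  · rw [mul_pow, div_pow, Real.sq_sqrt hk0.le, ← Real.exp_nat_mul]
    have e : Real.exp ((2 : ℕ) * -10) = (Real.exp 1 ^ 20)⁻¹ := by
      rw [← Real.exp_nat_mul, ← Real.exp_neg]; norm_num
    have e2 : ((3 : ℝ) ^ 20)⁻¹ ≤ (Real.exp 1 ^ 20)⁻¹ :=
      inv_anti₀ (by positivity) (pow_le_pow_left₀ (Real.exp_pos _).le exp_one_lt_three.le _)
    rw [e]
    have e3 : (8 : ℝ) ≤ 2 ^ 41 * ((Real.exp 1 ^ 20)⁻¹ / 8 ^ 2) := by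
      refine le_trans ?_ (mul_le_mul_of_nonneg_left (div_le_div_of_nonneg_right e2 (by norm_num))
        (by norm_num))
      norm_num
    nlinarith
  · refine hlc'.measure_closedBall_le_exp (w := Real.exp (-7) / 2 * √k) (by positivity) (by simp)
      (by omega) (fun a ha => ?_) (le_of_eq ?_)
    · rw [lintegral_map (by fun_prop) hTm]
      have e : ∀ x, ENNReal.ofReal (max (inner ℝ a (T x)) 0 ^ k) = ENNReal.ofReal ((√(d : ℝ))⁻¹ ^ k) *
          ENNReal.ofReal (max (inner ℝ (matAdj G a) x) 0 ^ k) := by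
        intro x
        rw [← ENNReal.ofReal_mul (by positivity), ← mul_pow, mul_max_of_nonneg _ _ (by positivity),
          mul_zero, hTx, inner_smul_right, inner_matAdj]
      simp_rw [e]
      rw [lintegral_const_mul' _ _ ENNReal.ofReal_ne_top, lintegral_max_inner_pow hlc hi (by omega),
        ← ENNReal.ofReal_mul (by positivity), ← mul_pow]
      refine ENNReal.ofReal_le_ofReal (pow_le_pow_left₀ (by positivity) ?_ _)
      rw [le_inv_mul_iff₀ (by positivity), mul_comm]
      exact hGa a ha
    · have : Real.exp (-7) = Real.exp 3 * Real.exp (-10) := by rw [← Real.exp_add]; norm_num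
      rw [this]; ring

end LogBound

section VolumeBound

theorem volume_real_closedBall_le {d : ℕ} {R b : ℝ} (hb : 0 < b) :
    volume.real (Metric.closedBall (0 : EuclideanSpace ℝ (Fin d)) R) ≤
      Real.exp (b * R ^ 2) * (Real.pi / b) ^ ((d : ℝ) / 2) := by
  have h := GaussianFourier.integral_rexp_neg_mul_sq_norm (V := EuclideanSpace ℝ (Fin d)) hb
  rw [finrank_euclideanSpace_fin] at h
  have hInt : Integrable fun v : EuclideanSpace ℝ (Fin d) => Real.exp (-b * ‖v‖ ^ 2) := by
    by_contra hc
    rw [integral_undef hc] at h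
    have : 0 < (Real.pi / b) ^ ((d : ℝ) / 2) := Real.rpow_pos_of_pos (by positivity) _
    linarith
  have hB : MeasurableSet (Metric.closedBall (0 : EuclideanSpace ℝ (Fin d)) R) :=
    Metric.isClosed_closedBall.measurableSet
  have h1 : ∫ v in Metric.closedBall (0 : EuclideanSpace ℝ (Fin d)) R, Real.exp (-b * R ^ 2) ≤
      ∫ v : EuclideanSpace ℝ (Fin d), Real.exp (-b * ‖v‖ ^ 2) := by
    refine le_trans (setIntegral_mono_on (integrableOn_const measure_closedBall_lt_top.ne)
      hInt.integrableOn hB fun v hv => ?_) (setIntegral_le_integral hInt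
        (ae_of_all _ fun v => (Real.exp_pos _).le))
    rw [mem_closedBall_zero_iff] at hv
    have : ‖v‖ ^ 2 ≤ R ^ 2 := pow_le_pow_left₀ (norm_nonneg _) hv 2
    rw [Real.exp_le_exp]
    nlinarith
  rw [setIntegral_const, smul_eq_mul, h] at h1
  rw [← div_le_iff₀' (Real.exp_pos _), div_eq_mul_inv, ← Real.exp_neg, ← neg_mul]
  exact h1

theorem le_of_ball_bound {d : ℕ} (hd : 2 ≤ d) {γ : Measure (EuclideanSpace ℝ (Fin d))}
    [IsProbabilityMeasure γ] (hi : IsIsotropic γ) {L Δ : ℝ} (hL : 0 < L)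
    (hball : ∀ r : ℝ, γ (Metric.closedBall 0 r) ≤ ENNReal.ofReal (L ^ d) * volume (Metric.closedBall
      (0 : EuclideanSpace ℝ (Fin d)) r))
    (hM : midLaw γ ≤ ENNReal.ofReal (Real.exp Δ) • γ) :
    d / (1296 * L ^ 2) ≤ Δ := by
  have hd0 : (2 : ℝ) ≤ d := by exact_mod_cast hd
  have hsq : ∫ x, ‖x‖ ^ 2 ∂γ = d := by rw [hi.integral_norm_sq, finrank_euclideanSpace_fin]
  set R : ℝ := √(d / 162) / L with hR
  have hR0 : 0 < R := by positivity
  have hR2 : R ^ 2 = d / (162 * L ^ 2) := by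
    rw [hR, div_pow, Real.sq_sqrt (by positivity), div_div]
  have hsmall : γ (Metric.closedBall 0 R) ≤ ENNReal.ofReal (Real.exp (-d)) := by
    refine (hball R).trans ?_
    rw [← ofReal_measureReal measure_closedBall_lt_top.ne, ← ENNReal.ofReal_mul (by positivity)]
    refine ENNReal.ofReal_le_ofReal ?_
    have h := volume_real_closedBall_le (d := d) (R := R) (b := d / (2 * R ^ 2)) (by positivity)
    have e1 : Real.exp (d / (2 * R ^ 2) * R ^ 2) = Real.exp 1 ^ ((d : ℝ) / 2) := by
      rw [← Real.exp_mul]; congr 1; field_simp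
    have e2 : L ^ d = (L ^ 2) ^ ((d : ℝ) / 2) := by
      rw [← Real.rpow_natCast, ← Real.rpow_natCast, ← Real.rpow_mul hL.le]; congr 1; push_cast; ring
    have e3 : Real.exp (-(d : ℝ)) = Real.exp (-2) ^ ((d : ℝ) / 2) := by
      rw [← Real.exp_mul]; congr 1; ring
    rw [e1] at h
    refine (mul_le_mul_of_nonneg_left h (by positivity)).trans ?_
    rw [e2, e3, ← Real.mul_rpow (by positivity) (by positivity),
      ← Real.mul_rpow (by positivity) (by positivity)]
    refine Real.rpow_le_rpow (by positivity) ?_ (by positivity)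
    have e4 : L ^ 2 * (Real.exp 1 * (Real.pi / (d / (2 * R ^ 2)))) = Real.exp 1 * Real.pi / 81 := by
      rw [hR2]; field_simp; ring
    have e5 : Real.exp (-2) = (Real.exp 1 ^ 2)⁻¹ := by
      rw [← Real.exp_nat_mul, ← Real.exp_neg]; norm_num
    rw [e4, e5, ← one_div, le_div_iff₀ (by positivity)]
    have h6 : Real.exp 1 ^ 3 ≤ 2.72 ^ 3 :=
      pow_le_pow_left₀ (Real.exp_pos _).le (by linarith [Real.exp_one_lt_d9]) 3
    have h7 := Real.pi_lt_d2
    have := Real.exp_pos 1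
    have h8 : Real.exp 1 ^ 3 * Real.pi ≤ 2.72 ^ 3 * 3.15 :=
      mul_le_mul h6 h7.le Real.pi_pos.le (by norm_num)
    nlinarith
  have hex : ∃ m : ℕ, 324 * L ^ 2 ≤ 2 ^ m := by
    obtain ⟨m, hm⟩ := pow_unbounded_of_one_lt (324 * L ^ 2) (one_lt_two)
    exact ⟨m, hm.le⟩
  classical
  set m := Nat.find hex with hm
  have hm1 : 324 * L ^ 2 ≤ 2 ^ m := Nat.find_spec hex
  have key := sub_one_le_of_midLaw_le hi.memLp hi.mean hM m hR0 (by
    rw [hsq, hR2, mul_div_assoc', le_div_iff₀ (by positivity)]; nlinarith) hsmall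
  rcases Nat.eq_zero_or_pos m with h0 | h0
  · rw [h0] at key; norm_num at key; linarith
  · have hm2 : (2 : ℝ) ^ m < 648 * L ^ 2 := by
      have := Nat.find_min hex (Nat.sub_lt h0 one_pos)
      rw [← hm] at this
      push Not at this
      obtain ⟨n, hn⟩ := Nat.exists_eq_succ_of_ne_zero h0.ne'
      rw [hn, Nat.succ_sub_one] at this
      rw [hn, pow_succ]; linarith
    have hc : ((2 ^ m - 1 : ℕ) : ℝ) ≤ 648 * L ^ 2 := by
      refine le_trans ?_ hm2.le
      have : (2 ^ m - 1 : ℕ) ≤ 2 ^ m := Nat.sub_le _ _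
      exact_mod_cast this
    have hΔ : 0 < Δ := by
      by_contra! hneg
      have := mul_nonpos_of_nonneg_of_nonpos (Nat.cast_nonneg (2 ^ m - 1)) hneg
      linarith
    rw [div_le_iff₀ (by positivity)]
    have := mul_le_mul_of_nonneg_right hc hΔ.le
    nlinarith

end VolumeBound

section Whitening

variable {d : ℕ} {K : Set (EuclideanSpace ℝ (Fin d))}

theorem lintegral_comp_two_smul_sub {f : EuclideanSpace ℝ (Fin d) → ℝ≥0∞} (hf : Measurable f)
    (x : EuclideanSpace ℝ (Fin d)) :
    ∫⁻ y, f y = 2 ^ d * ∫⁻ z, f ((2 : ℝ) • z - x) := by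
  have h1 : ∫⁻ z, f ((2 : ℝ) • z - x) = ∫⁻ y, f (y - x) ∂(Measure.map ((2 : ℝ) • ·) volume) := by
    rw [lintegral_map (by fun_prop) (by fun_prop)]
  rw [h1, Measure.map_addHaar_smul volume (by norm_num), lintegral_smul_measure,
    lintegral_sub_right_eq_self f x, finrank_euclideanSpace_fin, abs_of_pos (by positivity), smul_eq_mul,
    ← mul_assoc, ENNReal.ofReal_inv_of_pos (by positivity), ENNReal.ofReal_pow (by norm_num),
    ENNReal.ofReal_ofNat, ENNReal.mul_inv_cancel (by simp) (by simp), one_mul]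

theorem midLaw_restrict_apply_le (hK : MeasurableSet K) (hconv : Convex ℝ K) {M : ℝ≥0∞}
    (h : ∀ z, 2 ^ d * volume {s | z + s ∈ K ∧ z - s ∈ K} ≤ M)
    {A : Set (EuclideanSpace ℝ (Fin d))} (hA : MeasurableSet A) :
    midLaw (volume.restrict K) A ≤ M * volume.restrict K A := by
  classical
  set f : EuclideanSpace ℝ (Fin d) → EuclideanSpace ℝ (Fin d) → ℝ≥0∞ := fun x y =>
    K.indicator 1 x * K.indicator 1 y * A.indicator 1 ((2⁻¹ : ℝ) • (x + y)) with hf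
  have hKi : Measurable (K.indicator (1 : EuclideanSpace ℝ (Fin d) → ℝ≥0∞)) :=
    measurable_one.indicator hK
  have hAi : Measurable (A.indicator (1 : EuclideanSpace ℝ (Fin d) → ℝ≥0∞)) :=
    measurable_one.indicator hA
  have hm : Measurable fun p : EuclideanSpace ℝ (Fin d) × EuclideanSpace ℝ (Fin d) =>
      (2⁻¹ : ℝ) • (p.1 + p.2) := by fun_prop
  have h1 : midLaw (volume.restrict K) A = ∫⁻ x, ∫⁻ y, f x y := by
    rw [midLaw, Measure.map_apply hm hA, Measure.prod_apply (hm hA), ← lintegral_indicator hK]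
    refine lintegral_congr fun x => ?_
    have hsec : MeasurableSet (Prod.mk x ⁻¹'
        ((fun p : EuclideanSpace ℝ (Fin d) × EuclideanSpace ℝ (Fin d) =>
          (2⁻¹ : ℝ) • (p.1 + p.2)) ⁻¹' A)) := measurable_prodMk_left (hm hA)
    by_cases hx : x ∈ K
    · rw [Set.indicator_of_mem hx, Measure.restrict_apply hsec,
        ← lintegral_indicator_one (hsec.inter hK)]
      refine lintegral_congr fun y => ?_
      simp only [hf, Set.indicator_apply, hx, Set.mem_inter_iff, Set.mem_preimage]
      by_cases hy : y ∈ K <;> by_cases hz : (2⁻¹ : ℝ) • (x + y) ∈ A <;> simp_all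
    · simp [hf, hx]
  have h2 : ∀ x, ∫⁻ y, f x y = 2 ^ d * ∫⁻ z, K.indicator 1 x * K.indicator 1 ((2 : ℝ) • z - x) *
      A.indicator 1 z := by
    intro x
    rw [lintegral_comp_two_smul_sub (f := f x) (by fun_prop) x]
    congr 1
    refine lintegral_congr fun z => ?_
    simp only [hf]
    rw [add_sub_cancel, smul_smul]; norm_num
  have h3 : ∀ z, ∫⁻ x, K.indicator 1 x * K.indicator 1 ((2 : ℝ) • z - x) * A.indicator 1 z =
      volume {s | z + s ∈ K ∧ z - s ∈ K} * A.indicator 1 z := by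
    intro z
    have hs : MeasurableSet {s | z + s ∈ K ∧ z - s ∈ K} :=
      MeasurableSet.inter (measurable_const_add z hK) (measurable_const_sub z hK)
    rw [lintegral_mul_const _ (by fun_prop), ← lintegral_indicator_one hs,
      ← lintegral_add_left_eq_self _ z]
    congr 1
    refine lintegral_congr fun s => ?_
    have e : (2 : ℝ) • z - (z + s) = z - s := by module
    rw [e]
    by_cases h1 : z + s ∈ K <;> by_cases h2 : z - s ∈ K <;> simp [h1, h2]
  have h4 : ∀ z, 2 ^ d * (volume {s | z + s ∈ K ∧ z - s ∈ K} * A.indicator 1 z) ≤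
      M * (A ∩ K).indicator 1 z := by
    intro z
    by_cases hzA : z ∈ A
    · by_cases hzK : z ∈ K
      · rw [Set.indicator_of_mem hzA, Set.indicator_of_mem (Set.mem_inter hzA hzK)]
        simpa using h z
      · have : {s | z + s ∈ K ∧ z - s ∈ K} = ∅ := by
          rw [Set.eq_empty_iff_forall_notMem]
          rintro s ⟨hs1, hs2⟩
          refine hzK ?_
          have := hconv hs1 hs2 (show (0 : ℝ) ≤ 1 / 2 by norm_num) (show (0 : ℝ) ≤ 1 / 2 by norm_num)
            (by norm_num)
          have e : (1 / 2 : ℝ) • (z + s) + (1 / 2 : ℝ) • (z - s) = z := by module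
          rwa [e] at this
        rw [this]; simp
    · simp [hzA]
  rw [h1]
  simp_rw [h2]
  rw [lintegral_const_mul' _ _ (by simp), lintegral_lintegral_swap (by fun_prop)]
  simp_rw [h3]
  rw [← lintegral_const_mul' _ _ (by simp), Measure.restrict_apply hA]
  refine (lintegral_mono h4).trans ?_
  rw [lintegral_const_mul _ (measurable_one.indicator (hA.inter hK)),
    lintegral_indicator_one (hA.inter hK)]

/-- If all central sections are small, then the law of midpoints is dominated by the uniform law. -/
theorem midLaw_uniform_le (hK : MeasurableSet K) (hconv : Convex ℝ K) (h0 : volume K ≠ 0)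
    (hfin : volume K ≠ ∞) {M : ℝ≥0∞}
    (h : ∀ z, 2 ^ d * volume {s | z + s ∈ K ∧ z - s ∈ K} ≤ M * volume K) :
    midLaw ((volume K)⁻¹ • volume.restrict K) ≤ M • ((volume K)⁻¹ • volume.restrict K) := by
  rw [midLaw_smul]
  refine Measure.le_iff.2 fun A hA => ?_
  have := midLaw_restrict_apply_le hK hconv h hA
  rw [Measure.smul_apply, Measure.smul_apply, Measure.smul_apply, smul_eq_mul, smul_eq_mul, smul_eq_mul]
  refine (mul_le_mul_right this _).trans (le_of_eq ?_)
  calc (volume K)⁻¹ * (volume K)⁻¹ * (M * volume K * volume.restrict K A)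
      = M * ((volume K)⁻¹ * (volume.restrict K A)) * ((volume K)⁻¹ * volume K) := by ring
    _ = _ := by rw [ENNReal.inv_mul_cancel h0 hfin, mul_one]

theorem integrableOn_of_continuous (hK : IsCompact K) {G : Type*} [NormedAddCommGroup G]
    {f : EuclideanSpace ℝ (Fin d) → G} (hf : Continuous f) : IntegrableOn f K :=
  hf.continuousOn.integrableOn_compact hK

theorem setIntegral_inner_sq (hK : IsCompact K) (ξ : EuclideanSpace ℝ (Fin d)) :
    (volume K).toReal⁻¹ * ∫ x in K, inner ℝ ξ (x - centroid K) ^ 2 =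
      ξ.ofLp ⬝ᵥ (covMatrix K).mulVec ξ.ofLp := by
  have e : ∀ x, inner ℝ ξ (x - centroid K) ^ 2 =
      ∑ i, ∑ j, (ξ i * ξ j) * ((x i - centroid K i) * (x j - centroid K j)) := by
    intro x
    simp only [PiLp.inner_apply, RCLike.inner_apply, conj_trivial, sq, Finset.sum_mul_sum,
      PiLp.sub_apply]
    exact Finset.sum_congr rfl fun i _ => Finset.sum_congr rfl fun j _ => by ring
  simp_rw [e]
  have hInt : ∀ i j, IntegrableOn (fun x : EuclideanSpace ℝ (Fin d) =>
      (ξ i * ξ j) * ((x i - centroid K i) * (x j - centroid K j))) K := fun i j =>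
    integrableOn_of_continuous hK (by fun_prop)
  rw [integral_finsetSum _ fun i _ => integrable_finsetSum _ fun j _ => hInt i j]
  simp_rw [fun i => integral_finsetSum (μ := volume.restrict K) Finset.univ fun j _ => hInt i j]
  simp only [integral_const_mul, dotProduct, Matrix.mulVec, covMatrix, Finset.mul_sum]
  exact Finset.sum_congr rfl fun i _ => Finset.sum_congr rfl fun j _ => by ring

theorem covMatrix_posDef (hK : IsCompact K) (hInt : (interior K).Nonempty) :
    (covMatrix K).PosDef := by
  have hv : 0 < (volume K).toReal := ENNReal.toReal_pos
    (Measure.measure_pos_of_nonempty_interior volume hInt).ne' hK.measure_lt_top.ne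
  refine Matrix.PosDef.of_dotProduct_mulVec_pos ?_ fun x hx => ?_
  · ext i j
    simp only [Matrix.conjTranspose_apply, covMatrix, star_trivial]
    simp_rw [mul_comm]
  · set ξ : EuclideanSpace ℝ (Fin d) := WithLp.toLp 2 x with hξ
    have h := setIntegral_inner_sq hK ξ
    have e : star x ⬝ᵥ (covMatrix K).mulVec x = ξ.ofLp ⬝ᵥ (covMatrix K).mulVec ξ.ofLp := by
      simp [hξ]
    rw [e, ← h]
    have hnn : 0 ≤ ∫ x in K, inner ℝ ξ (x - centroid K) ^ 2 := integral_nonneg fun _ => sq_nonneg _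
    refine mul_pos (inv_pos.2 hv) (lt_of_le_of_ne hnn fun h0 => hx ?_)
    have hae := (setIntegral_eq_zero_iff_of_nonneg_ae (ae_of_all _ fun _ => sq_nonneg _)
      (integrableOn_of_continuous hK (by fun_prop))).1 h0.symm
    have hEq := Measure.eqOn_open_of_ae_eq (ae_restrict_of_ae_restrict_of_subset interior_subset hae)
      isOpen_interior (by fun_prop) (by fun_prop)
    obtain ⟨p, hp⟩ := hInt
    obtain ⟨ε, hε, hball⟩ := Metric.isOpen_iff.1 isOpen_interior p hp
    by_contra hx0
    have hξ0 : 0 < ‖ξ‖ := by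
      rw [norm_pos_iff]; intro hc; apply hx0
      have := congrArg WithLp.ofLp hc
      simpa [hξ] using this
    have hp2 : p + (ε / (2 * ‖ξ‖)) • ξ ∈ interior K := by
      refine hball ?_
      rw [mem_ball_iff_norm, add_sub_cancel_left, norm_smul, Real.norm_of_nonneg (by positivity)]
      have : ε / (2 * ‖ξ‖) * ‖ξ‖ = ε / 2 := by field_simp
      rw [this]; linarith
    have h1 := pow_eq_zero_iff (two_ne_zero) |>.1 (hEq hp)
    have h2 := pow_eq_zero_iff (two_ne_zero) |>.1 (hEq hp2)
    rw [add_sub_right_comm, inner_add_right, h1, zero_add, inner_smul_right,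
      real_inner_self_eq_norm_sq] at h2
    have : 0 < ε / (2 * ‖ξ‖) * ‖ξ‖ ^ 2 := by positivity
    linarith

open scoped MatrixOrder Matrix.Norms.L2Operator in
theorem exists_whitening {S : Matrix (Fin d) (Fin d) ℝ} (hS : S.PosDef) :
    ∃ A : Matrix (Fin d) (Fin d) ℝ, A * S * A.transpose = 1 ∧ 0 < S.det ∧ |A.det|⁻¹ = √S.det := by
  obtain ⟨B, hB⟩ := CStarAlgebra.nonneg_iff_eq_star_mul_self.mp hS.posSemidef.nonneg
  have hB' : S = B.transpose * B := by
    rw [hB, Matrix.star_eq_conjTranspose, Matrix.conjTranspose_eq_transpose_of_trivial]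
  have hdet : 0 < S.det := hS.det_pos
  have hd2 : S.det = B.det ^ 2 := by rw [hB', Matrix.det_mul, Matrix.det_transpose, sq]
  have hBd : B.det ≠ 0 := by intro h; rw [hd2, h] at hdet; simp at hdet
  have hu : IsUnit B.det := isUnit_iff_ne_zero.2 hBd
  have hut : IsUnit B.transpose.det := by rwa [Matrix.det_transpose]
  refine ⟨(B.transpose)⁻¹, ?_, hdet, ?_⟩
  · rw [hB', ← Matrix.transpose_nonsing_inv, Matrix.transpose_transpose, Matrix.transpose_nonsing_inv,
      ← Matrix.mul_assoc, Matrix.nonsing_inv_mul _ hut, Matrix.one_mul, Matrix.mul_nonsing_inv _ hu]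
  · rw [Matrix.det_nonsing_inv, Matrix.det_transpose, Ring.inverse_eq_inv', abs_inv, inv_inv, hd2,
      Real.sqrt_sq_eq_abs]

/-- Every convex body has an affine image in isotropic position. -/
theorem exists_isotropic_position (hd : 1 ≤ d) (hK : IsCompact K) (hconv : Convex ℝ K)
    (hInt : (interior K).Nonempty) :
    0 < isotropicConstant K ∧ ∃ γ : Measure (EuclideanSpace ℝ (Fin d)), IsProbabilityMeasure γ ∧
      IsLogConcave γ ∧ IsIsotropic γ ∧
      (∀ r : ℝ, γ (Metric.closedBall 0 r) ≤ ENNReal.ofReal (isotropicConstant K ^ d) *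
        volume (Metric.closedBall (0 : EuclideanSpace ℝ (Fin d)) r)) ∧
      ∀ M : ℝ≥0∞, (∀ z, 2 ^ d * volume {s | z + s ∈ K ∧ z - s ∈ K} ≤ M * volume K) →
        midLaw γ ≤ M • γ := by
  have hv0 : volume K ≠ 0 := (Measure.measure_pos_of_nonempty_interior volume hInt).ne'
  have hvt : volume K ≠ ∞ := hK.measure_lt_top.ne
  have hv : 0 < (volume K).toReal := ENNReal.toReal_pos hv0 hvt
  obtain ⟨A, hA, hdet, hAdet⟩ := exists_whitening (covMatrix_posDef hK hInt)
  have hAd0 : A.det ≠ 0 := by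
    intro h; rw [h] at hAdet; simp at hAdet
    exact absurd hAdet (Real.sqrt_pos.2 hdet).ne
  have hLd : isotropicConstant K ^ d = √(covMatrix K).det / (volume K).toReal := by
    rw [isotropicConstant, ← Real.rpow_natCast, ← Real.rpow_mul (by positivity),
      inv_mul_cancel₀ (by exact_mod_cast (by omega : d ≠ 0)), Real.rpow_one]
  refine ⟨Real.rpow_pos_of_pos (div_pos (Real.sqrt_pos.2 hdet) hv) _, ?_⟩
  set μ : Measure (EuclideanSpace ℝ (Fin d)) := (volume K)⁻¹ • volume.restrict K with hμ
  have hμp : IsProbabilityMeasure μ := ⟨by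
    rw [hμ, Measure.smul_apply, Measure.restrict_apply_univ, smul_eq_mul,
      ENNReal.inv_mul_cancel hv0 hvt]⟩
  set T : EuclideanSpace ℝ (Fin d) →ₗ[ℝ] EuclideanSpace ℝ (Fin d) := A.toEuclideanLin with hT
  have hTdet : LinearMap.det T = A.det := by
    rw [hT, Matrix.toEuclideanLin_eq_toLin_orthonormal, LinearMap.det_toLin]
  have hTc : Continuous T := T.continuous_of_finiteDimensional
  set W : EuclideanSpace ℝ (Fin d) → EuclideanSpace ℝ (Fin d) := fun x => T (x - centroid K) with hW
  have hWc : Continuous W := by fun_prop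
  have hWm : Measurable W := hWc.measurable
  have hmem : MemLp W 2 μ := by
    refine MemLp.smul_measure ?_ (ENNReal.inv_ne_top.2 hv0)
    have : IsFiniteMeasure (volume.restrict K) := ⟨by simpa using hK.measure_lt_top⟩
    obtain ⟨C, hC⟩ := hK.exists_bound_of_continuousOn hWc.continuousOn
    exact MemLp.of_bound (by fun_prop) C (ae_restrict_of_forall_mem hK.measurableSet hC)
  have hIμ : ∀ {G : Type} [NormedAddCommGroup G] [NormedSpace ℝ G] (f : EuclideanSpace ℝ (Fin d) → G),
      ∫ x, f x ∂μ = (volume K).toReal⁻¹ • ∫ x in K, f x := by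
    intro G _ _ f
    rw [hμ, integral_smul_measure, ENNReal.toReal_inv]
  refine ⟨μ.map W, Measure.isProbabilityMeasure_map hWm.aemeasurable,
    (isLogConcave_uniform hK.measurableSet hconv hv0 hvt).map hWm fun l x y => ?_, ⟨?_, ?_, ?_⟩, ?_, ?_⟩
  · simp only [hW]
    rw [← map_smul, ← map_smul, ← map_add]
    congr 1
    module
  · rwa [memLp_map_measure_iff (by fun_prop) hWm.aemeasurable]
  · rw [integral_map hWm.aemeasurable (by fun_prop), hIμ]
    have h1 : ∫ x in K, W x = T.toContinuousLinearMap (∫ x in K, (x - centroid K)) :=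
      ContinuousLinearMap.integral_comp_comm T.toContinuousLinearMap (integrableOn_of_continuous hK (by fun_prop))
    rw [h1, integral_sub (by exact integrableOn_of_continuous hK (by fun_prop)) (by exact integrableOn_of_continuous hK (by fun_prop)),
      setIntegral_const, ← map_smul, smul_sub, smul_smul, Measure.real, inv_mul_cancel₀ hv.ne', one_smul]
    rw [show (volume K).toReal⁻¹ • ∫ x in K, x = centroid K from rfl, sub_self, map_zero]
  · intro ξ
    rw [integral_map hWm.aemeasurable (by fun_prop), hIμ, smul_eq_mul]
    set η : EuclideanSpace ℝ (Fin d) := A.transpose.toEuclideanLin ξ with hη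
    have e : ∀ x, inner ℝ ξ (W x) = inner ℝ η (x - centroid K) := by
      intro x
      rw [hη, ← Matrix.conjTranspose_eq_transpose_of_trivial,
        Matrix.toEuclideanLin_conjTranspose_eq_adjoint, LinearMap.adjoint_inner_left]
    simp_rw [e]
    rw [setIntegral_inner_sq hK, hη, Matrix.ofLp_toLpLin, Matrix.toLin'_apply, Matrix.mulVec_mulVec,
      Matrix.mulVec_transpose A, ← Matrix.dotProduct_mulVec, Matrix.mulVec_mulVec, ← Matrix.mul_assoc, hA,
      Matrix.one_mulVec, EuclideanSpace.real_norm_sq_eq]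
    simp [dotProduct, sq]
  · intro r
    have hB : MeasurableSet (Metric.closedBall (0 : EuclideanSpace ℝ (Fin d)) r) :=
      Metric.isClosed_closedBall.measurableSet
    rw [Measure.map_apply hWm hB, hμ, Measure.smul_apply, smul_eq_mul, hLd, div_eq_inv_mul,
      ENNReal.ofReal_mul (by positivity), ENNReal.ofReal_inv_of_pos hv, ENNReal.ofReal_toReal hvt,
      mul_assoc]
    gcongr
    refine (Measure.restrict_apply_le _ _).trans (le_of_eq ?_)
    have : W ⁻¹' Metric.closedBall 0 r = (fun x => x + -centroid K) ⁻¹'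
        (T ⁻¹' Metric.closedBall 0 r) := by
      ext x
      simp [hW, sub_eq_add_neg]
    rw [this, measure_preimage_add_right, Measure.addHaar_preimage_linearMap volume
      (by rwa [hTdet]), hTdet, abs_inv, hAdet]
  · intro M hM
    rw [midLaw_map μ W hWm fun x y => ?_, ← Measure.map_smul]
    · exact Measure.map_mono (midLaw_uniform_le hK.measurableSet hconv hv0 hvt hM) hWm
    · simp only [hW]
      rw [← map_add, ← map_smul]
      congr 1
      module

end Whitening

section Conclusion

/-- For large `d` there is a dimension `k` that is small against `d` and large against `log d`. -/
theorem exists_marginal_dimension : ∃ d₀ : ℕ, ∀ d : ℕ, d₀ ≤ d → ∃ k : ℕ, 40 ≤ k ∧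
    2 ^ 40 * k ^ 3 ≤ d ∧ ((2 ^ 41 - 1 : ℕ) : ℝ) * (6 * Real.log d) < k - 1 := by
  set b : ℝ := ((2 ^ 41 - 1 : ℕ) : ℝ) with hb
  have hb0 : 0 < b := by rw [hb]; norm_num
  have hlim : ∀ᶠ x : ℝ in Filter.atTop, ‖Real.log x‖ ≤ (48 * b)⁻¹ * ‖x‖ :=
    Real.isLittleO_log_id_atTop.def (by positivity)
  obtain ⟨x₀, hx₀⟩ := Filter.eventually_atTop.1 hlim
  set k₀ : ℕ := max (2 ^ 40) ⌈x₀⌉₊ with hk₀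
  refine ⟨k₀ ^ 4, fun d hd => ?_⟩
  set k := Nat.sqrt (Nat.sqrt d) with hk
  have hkk : k₀ ≤ k := by
    rw [hk, Nat.le_sqrt', Nat.le_sqrt', ← pow_mul]
    exact hd
  have h40 : 2 ^ 40 ≤ k := (le_max_left _ _).trans hkk
  have hxk : x₀ ≤ k := (Nat.le_ceil x₀).trans (by exact_mod_cast (le_max_right _ _).trans hkk)
  have h1 : k ^ 4 ≤ d := by
    have h := Nat.le_sqrt'.1 (Nat.le_sqrt'.1 hk.le)
    rwa [← pow_mul] at h
  have h2 : d ≤ (k + 1) ^ 4 := by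
    have h3 : Nat.sqrt d + 1 ≤ (k + 1) ^ 2 := Nat.lt_succ_sqrt' _
    have h4 : d < (Nat.sqrt d + 1) ^ 2 := Nat.lt_succ_sqrt' _
    calc d ≤ (Nat.sqrt d + 1) ^ 2 := h4.le
      _ ≤ ((k + 1) ^ 2) ^ 2 := Nat.pow_le_pow_left h3 2
      _ = (k + 1) ^ 4 := by ring
  have hk0 : (2 ^ 40 : ℝ) ≤ k := by exact_mod_cast h40
  have hd0 : (0 : ℝ) < d := by
    exact_mod_cast (pow_pos (lt_of_lt_of_le (by norm_num) h40) 4).trans_le h1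
  refine ⟨k, le_trans (by norm_num) h40, ?_, ?_⟩
  · calc 2 ^ 40 * k ^ 3 ≤ k * k ^ 3 := Nat.mul_le_mul_right _ h40
      _ = k ^ 4 := by ring
      _ ≤ d := h1
  · have h5 : Real.log d ≤ 4 * Real.log (k + 1) := by
      have : Real.log d ≤ Real.log (((k : ℝ) + 1) ^ 4) :=
        Real.log_le_log hd0 (by exact_mod_cast h2)
      rwa [Real.log_pow] at this
    have h6 : Real.log (k + 1) ≤ (48 * b)⁻¹ * (k + 1) := by
      have h := hx₀ (k + 1) (by linarith)
      rw [Real.norm_of_nonneg (by positivity : (0 : ℝ) ≤ k + 1)] at h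
      exact (Real.le_norm_self _).trans h
    calc b * (6 * Real.log d) ≤ b * (6 * (4 * ((48 * b)⁻¹ * (k + 1)))) := by gcongr; linarith
      _ = (k + 1) / 2 := by field_simp; norm_num
      _ < k - 1 := by linarith

variable {d : ℕ} {K : Set (EuclideanSpace ℝ (Fin d))}

/-- Some point reflection of `K` meets `K` in exponentially more than a `2⁻ᵈ` fraction of it. -/
theorem exists_large_symmetric_part {k : ℕ} (hk : 40 ≤ k) (hkd : 2 ^ 40 * k ^ 3 ≤ d)
    (hK : IsCompact K) (hconv : Convex ℝ K) (hInt : (interior K).Nonempty) {Δ : ℝ}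
    (hΔ : Δ < d / (1296 * isotropicConstant K ^ 2) ∨ ((2 ^ 41 - 1 : ℕ) : ℝ) * Δ < k - 1) :
    ∃ z, ENNReal.ofReal (Real.exp Δ) * volume K ≤
      2 ^ d * volume {s | z + s ∈ K ∧ z - s ∈ K} := by
  have hd : 2 ≤ d := by
    have : 1 ≤ k ^ 3 := Nat.one_le_pow _ _ (by omega)
    omega
  obtain ⟨hL, γ, hγ, hlc, hi, hball, hM⟩ := exists_isotropic_position (by omega) hK hconv hInt
  by_contra! h
  have hmid := hM _ fun z => (h z).le
  rcases hΔ with hΔ | hΔ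
  · exact hΔ.not_ge (le_of_ball_bound hd hi hL hball hmid)
  · exact hΔ.not_ge (sub_one_le_of_isIsotropic hlc hi hk hkd hmid)

end Conclusion

/-- There exist `c > 0` and `d₀` such that for every `d ≥ d₀` and every convex body
`K ⊆ ℝ^d`, we have `N(K) ≤ exp(-c d / L_K^2) · 4^d`. -/
theorem hadwiger_isotropic :
    ∃ c : ℝ, 0 < c ∧ ∃ d₀ : ℕ, ∀ d : ℕ, d₀ ≤ d →
      ∀ K : Set (EuclideanSpace ℝ (Fin d)),
        IsCompact K → Convex ℝ K → (interior K).Nonempty →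
        (coveringNumber K : ℝ) ≤
          Real.exp (-c * d / (isotropicConstant K) ^ 2) * 4 ^ d := by
  obtain ⟨d₀, hd₀⟩ := exists_marginal_dimension
  refine ⟨1 / 2592, by norm_num, max d₀ 66, fun d hd K hK hconv hInt => ?_⟩
  obtain ⟨k, hk, hkd, hlog⟩ := hd₀ d ((le_max_left _ _).trans hd)
  have hd66 : 66 ≤ d := (le_max_right _ _).trans hd
  have hdR : (66 : ℝ) ≤ d := by exact_mod_cast hd66
  have hd0 : (0 : ℝ) < d := by linarith
  have hlog0 : 0 ≤ Real.log d := Real.log_nonneg (by linarith)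
  set I : ℝ := d / (1296 * isotropicConstant K ^ 2) with hI
  have hI0 : 0 ≤ I := by positivity
  set Δ : ℝ := (I + 6 * Real.log d) / 2 with hΔ
  obtain ⟨z, hz⟩ := exists_large_symmetric_part (Δ := Δ) hk hkd hK hconv hInt (by
    by_cases h : Δ < I
    · exact Or.inl h
    · refine Or.inr (lt_of_le_of_lt ?_ hlog)
      gcongr
      linarith)
  have hcov := coveringNumber_le_of_symmetric (by omega) hK hconv hInt z
    (θ := Real.exp Δ * 2⁻¹ ^ d)
    (le_mul_of_one_le_left (by positivity) (Real.one_le_exp (by positivity)))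
    (by
      have e : ENNReal.ofReal (Real.exp Δ * 2⁻¹ ^ d) = (2 ^ d)⁻¹ * ENNReal.ofReal (Real.exp Δ) := by
        rw [mul_comm, ENNReal.ofReal_mul (by positivity), inv_pow,
          ENNReal.ofReal_inv_of_pos (by positivity), ENNReal.ofReal_pow (by norm_num)]
        norm_num
      rw [e, mul_assoc, mul_comm, ← div_eq_mul_inv]
      refine ENNReal.div_le_of_le_mul ?_
      rwa [mul_comm _ (2 ^ d : ℝ≥0∞)])
  refine hcov.trans ?_
  have hexp : Real.exp Δ = Real.exp (I / 2) * d ^ 3 := by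
    rw [hΔ, show (I + 6 * Real.log d) / 2 = I / 2 + (3 : ℕ) * Real.log d by push_cast; ring,
      Real.exp_add, Real.exp_nat_mul, Real.exp_log hd0]
  have hneg : Real.exp (-(1 / 2592) * d / isotropicConstant K ^ 2) = (Real.exp (I / 2))⁻¹ := by
    rw [← Real.exp_neg, hI]
    congr 1
    rw [← div_div]
    ring
  rw [hneg, hexp, inv_pow, show (4 : ℝ) ^ d = 2 ^ d * 2 ^ d by rw [← mul_pow]; norm_num]
  have hE := Real.exp_pos (I / 2)
  rw [show 66 * (d : ℝ) ^ 2 * 2 ^ d / (Real.exp (I / 2) * d ^ 3 * (2 ^ d)⁻¹) =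
    66 / d * ((Real.exp (I / 2))⁻¹ * (2 ^ d * 2 ^ d)) by field_simp]
  exact mul_le_of_le_one_left (by positivity) ((div_le_one hd0).2 hdR)
end

section
/- For every convex body K ⊂ ℝ^d (d ≥ 1), the Kövner–Besicovitch measure of symmetry satisfies Δ_KB(K) ≥ exp(d/(2^15 · L_K²)) · 2^{−d}, where L_K is the isotropic constant of K. -/
open MeasureTheory Pointwise

/-- The Kövner–Besicovitch measure of symmetry
`Δ_KB(K) = sup_x vol(K ∩ (x - K)) / vol(K)`. -/
noncomputable def kbSym {d : ℕ} (K : Set (EuclideanSpace ℝ (Fin d))) : ℝ :=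
  ⨆ x : EuclideanSpace ℝ (Fin d),
    (volume (K ∩ (fun y => x - y) '' K)).toReal / (volume K).toReal

theorem measure_inter_le_kbSym {d : ℕ} {K : Set (EuclideanSpace ℝ (Fin d))}
    (hcpt : IsCompact K) (hpos : volume K ≠ 0) (x : EuclideanSpace ℝ (Fin d)) :
    volume (K ∩ (fun y => x - y) '' K) ≤ ENNReal.ofReal (kbSym K) * volume K := by
  have hV : volume K ≠ ⊤ := hcpt.measure_ne_top
  have hV' : 0 < (volume K).toReal := ENNReal.toReal_pos hpos hV
  have hle : ∀ z, (volume (K ∩ (fun y => z - y) '' K)).toReal ≤ (volume K).toReal := fun z =>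
    ENNReal.toReal_mono hV (measure_mono Set.inter_subset_left)
  have hb : BddAbove (Set.range fun z : EuclideanSpace ℝ (Fin d) =>
      (volume (K ∩ (fun y => z - y) '' K)).toReal / (volume K).toReal) := by
    refine ⟨1, ?_⟩
    rintro _ ⟨z, rfl⟩
    exact div_le_one_of_le₀ (hle z) hV'.le
  have h := (div_le_iff₀ hV').1 (le_ciSup hb x)
  have hfin : volume (K ∩ (fun y => x - y) '' K) ≠ ⊤ :=
    ne_top_of_le_ne_top hV (measure_mono Set.inter_subset_left)
  rw [← ENNReal.ofReal_toReal hfin]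
  conv_rhs => rw [← ENNReal.ofReal_toReal hV]
  rw [← ENNReal.ofReal_mul' hV'.le]
  exact ENNReal.ofReal_le_ofReal h

theorem kbSym_nonneg {d : ℕ} (K : Set (EuclideanSpace ℝ (Fin d))) : 0 ≤ kbSym K :=
  Real.iSup_nonneg fun _ => by positivity

/-- Two independent uniform points of `K` have a midpoint whose density with respect to the
uniform measure is at most `2 ^ d * kbSym K`. -/
theorem map_midpoint_prod_restrict_le {d : ℕ} {K : Set (EuclideanSpace ℝ (Fin d))}
    (hcpt : IsCompact K) (hconv : Convex ℝ K) (hpos : volume K ≠ 0) :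
    ((volume.restrict K).prod (volume.restrict K)).map
        (fun p : EuclideanSpace ℝ (Fin d) × EuclideanSpace ℝ (Fin d) =>
          (2 : ℝ)⁻¹ • (p.1 + p.2)) ≤
      (ENNReal.ofReal (2 ^ d * kbSym K) * volume K) • volume.restrict K := by
  have hK : MeasurableSet K := hcpt.isClosed.measurableSet
  have hmid : Measurable (fun p : EuclideanSpace ℝ (Fin d) × EuclideanSpace ℝ (Fin d) =>
      (2 : ℝ)⁻¹ • (p.1 + p.2)) := by fun_prop
  refine Measure.le_iff.2 fun A hA => ?_
  rw [Measure.map_apply hmid hA, Measure.prod_restrict, Measure.restrict_apply (hmid hA)]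
  set S := (fun p : EuclideanSpace ℝ (Fin d) × EuclideanSpace ℝ (Fin d) =>
      (2 : ℝ)⁻¹ • (p.1 + p.2)) ⁻¹' A ∩ K ×ˢ K
  have hSm : MeasurableSet S := (hmid hA).inter (hK.prod hK)
  let Φ : EuclideanSpace ℝ (Fin d) × EuclideanSpace ℝ (Fin d) →
      EuclideanSpace ℝ (Fin d) × EuclideanSpace ℝ (Fin d) :=
    fun p => (p.1, (2 : ℝ) • p.2 - p.1)
  have hΦ : Measurable Φ := by fun_prop
  have hslice : ∀ x, volume (Prod.mk x ⁻¹' S) = 2 ^ d * volume (Prod.mk x ⁻¹' (Φ ⁻¹' S)) := by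
    intro x
    have h1 : Prod.mk x ⁻¹' (Φ ⁻¹' S) =
        ((2 : ℝ) • ·) ⁻¹' ((fun y => y + -x) ⁻¹' (Prod.mk x ⁻¹' S)) := by
      ext z; simp [Φ, sub_eq_add_neg]
    rw [h1, Measure.addHaar_preimage_smul _ (two_ne_zero), measure_preimage_add_right,
      finrank_euclideanSpace_fin, abs_of_pos (by positivity), ENNReal.ofReal_inv_of_pos
      (by positivity), ENNReal.ofReal_pow (by norm_num), ← mul_assoc, ENNReal.ofReal_ofNat,
      ENNReal.mul_inv_cancel (by positivity) (by finiteness), one_mul]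
  have hfib : ∀ z, volume ((fun x => (x, z)) ⁻¹' (Φ ⁻¹' S)) ≤
      (A ∩ K).indicator (fun _ => ENNReal.ofReal (kbSym K) * volume K) z := by
    intro z
    by_cases hz : z ∈ A ∩ K
    · rw [Set.indicator_of_mem hz]
      refine le_trans (measure_mono ?_) (measure_inter_le_kbSym hcpt hpos ((2 : ℝ) • z))
      intro x hx
      exact ⟨hx.2.1, (2 : ℝ) • z - x, hx.2.2, by simp⟩
    · have hempty : (fun x => (x, z)) ⁻¹' (Φ ⁻¹' S) = ∅ := by
        refine Set.eq_empty_of_forall_notMem fun x hx => hz ?_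
        have hzx : (2 : ℝ)⁻¹ • (x + ((2 : ℝ) • z - x)) = z := by
          rw [add_sub_cancel, smul_smul]; norm_num
        refine ⟨hzx ▸ hx.1, ?_⟩
        rw [← hzx, smul_add]
        exact hconv hx.2.1 hx.2.2 (by norm_num) (by norm_num) (by norm_num)
      rw [hempty]; simp
  calc (volume.prod volume) S
      = 2 ^ d * (volume.prod volume) (Φ ⁻¹' S) := by
        rw [Measure.prod_apply hSm, Measure.prod_apply (hΦ hSm),
          ← lintegral_const_mul _ (measurable_measure_prodMk_left (hΦ hSm))]
        exact lintegral_congr hslice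
    _ ≤ 2 ^ d * ∫⁻ z, (A ∩ K).indicator (fun _ => ENNReal.ofReal (kbSym K) * volume K) z := by
        rw [Measure.prod_apply_symm (hΦ hSm)]
        gcongr with z
        exact hfib z
    _ = _ := by
        rw [lintegral_indicator_const (hA.inter hK), Measure.smul_apply,
          Measure.restrict_apply hA, ENNReal.ofReal_mul (by positivity),
          ENNReal.ofReal_pow (by norm_num), ENNReal.ofReal_ofNat, smul_eq_mul]
        ring

/-- The law of the average of `2 ^ k` independent points with law `μ`. -/
noncomputable def dyadicAverageLaw {d : ℕ} (μ : Measure (EuclideanSpace ℝ (Fin d))) :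
    ℕ → Measure (EuclideanSpace ℝ (Fin d))
  | 0 => μ
  | k + 1 => ((dyadicAverageLaw μ k).prod (dyadicAverageLaw μ k)).map
      (fun p => (2 : ℝ)⁻¹ • (p.1 + p.2))

theorem isProbabilityMeasure_dyadicAverageLaw {d : ℕ} (μ : Measure (EuclideanSpace ℝ (Fin d)))
    [IsProbabilityMeasure μ] (k : ℕ) : IsProbabilityMeasure (dyadicAverageLaw μ k) := by
  induction k with
  | zero => assumption
  | succ k ih => exact Measure.isProbabilityMeasure_map (by fun_prop)

theorem dyadicAverageLaw_le {d : ℕ} {μ : Measure (EuclideanSpace ℝ (Fin d))}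
    [IsProbabilityMeasure μ] {M : ENNReal} (h : dyadicAverageLaw μ 1 ≤ M • μ) (k : ℕ) :
    dyadicAverageLaw μ k ≤ M ^ (2 ^ k - 1) • μ := by
  have hmid : Measurable (fun p : EuclideanSpace ℝ (Fin d) × EuclideanSpace ℝ (Fin d) =>
      (2 : ℝ)⁻¹ • (p.1 + p.2)) := by fun_prop
  induction k with
  | zero => simp [dyadicAverageLaw]
  | succ k ih =>
    have := isProbabilityMeasure_dyadicAverageLaw μ k
    calc dyadicAverageLaw μ (k + 1)
        ≤ ((M ^ (2 ^ k - 1) • μ).prod (M ^ (2 ^ k - 1) • μ)).map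
            (fun p => (2 : ℝ)⁻¹ • (p.1 + p.2)) :=
          Measure.map_mono (Measure.prod_mono ih ih) hmid
      _ = (M ^ (2 ^ k - 1) * M ^ (2 ^ k - 1)) • dyadicAverageLaw μ 1 := by
          rw [Measure.prod_smul_left, Measure.prod_smul_right, Measure.map_smul,
            Measure.map_smul, smul_smul]
          rfl
      _ ≤ (M ^ (2 ^ k - 1) * M ^ (2 ^ k - 1)) • M • μ := by gcongr
      _ = M ^ (2 ^ (k + 1) - 1) • μ := by
          rw [smul_smul, ← pow_add, ← pow_succ]
          congr 2
          have := Nat.one_le_two_pow (n := k)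
          rw [pow_succ]; omega

theorem dyadicAverageLaw_moments {d : ℕ} {μ : Measure (EuclideanSpace ℝ (Fin d))}
    [IsProbabilityMeasure μ] {f g : EuclideanSpace ℝ (Fin d) → ℝ}
    (hfm : Measurable f) (hgm : Measurable g)
    (hf : ∀ x y, f ((2 : ℝ)⁻¹ • (x + y)) = (f x + f y) / 2)
    (hg : ∀ x y, g ((2 : ℝ)⁻¹ • (x + y)) = (g x + g y) / 2)
    (hfi : Integrable f μ) (hgi : Integrable g μ) (hfgi : Integrable (fun x => f x * g x) μ)
    (hf0 : ∫ x, f x ∂μ = 0) (hg0 : ∫ x, g x ∂μ = 0) (k : ℕ) :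
    Integrable f (dyadicAverageLaw μ k) ∧ Integrable g (dyadicAverageLaw μ k) ∧
      Integrable (fun x => f x * g x) (dyadicAverageLaw μ k) ∧
      ∫ x, f x ∂(dyadicAverageLaw μ k) = 0 ∧ ∫ x, g x ∂(dyadicAverageLaw μ k) = 0 ∧
      ∫ x, f x * g x ∂(dyadicAverageLaw μ k) = (∫ x, f x * g x ∂μ) / 2 ^ k := by
  have hmid : Measurable (fun p : EuclideanSpace ℝ (Fin d) × EuclideanSpace ℝ (Fin d) =>
      (2 : ℝ)⁻¹ • (p.1 + p.2)) := by fun_prop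
  have hfgm : Measurable fun x => f x * g x := hfm.mul hgm
  induction k with
  | zero => exact ⟨hfi, hgi, hfgi, hf0, hg0, by simp [dyadicAverageLaw]⟩
  | succ k ih =>
    obtain ⟨hfi, hgi, hfgi, hf0, hg0, hfg⟩ := ih
    have := isProbabilityMeasure_dyadicAverageLaw μ k
    set ν := dyadicAverageLaw μ k
    have lin : ∀ u : EuclideanSpace ℝ (Fin d) → ℝ, Measurable u →
        (∀ x y, u ((2 : ℝ)⁻¹ • (x + y)) = (u x + u y) / 2) → Integrable u ν →
        ∫ x, u x ∂ν = 0 → Integrable u (dyadicAverageLaw μ (k + 1)) ∧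
          ∫ x, u x ∂(dyadicAverageLaw μ (k + 1)) = 0 := by
      intro u hum hu hui hu0
      have h1 := hui.comp_fst ν
      have h2 := hui.comp_snd ν
      constructor
      · refine (integrable_map_measure hum.aestronglyMeasurable hmid.aemeasurable).2 ?_
        simp only [Function.comp_def, hu]
        exact (h1.add h2).div_const 2
      · rw [dyadicAverageLaw, integral_map hmid.aemeasurable hum.aestronglyMeasurable]
        simp only [hu]
        rw [integral_div, integral_add h1 h2, integral_fun_fst, integral_fun_snd, hu0]
        simp
    have h11 : Integrable (fun p : EuclideanSpace ℝ (Fin d) × EuclideanSpace ℝ (Fin d) =>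
      f p.1 * g p.1) (ν.prod ν) := hfgi.comp_fst ν
    have h22 : Integrable (fun p : EuclideanSpace ℝ (Fin d) × EuclideanSpace ℝ (Fin d) =>
      f p.2 * g p.2) (ν.prod ν) := hfgi.comp_snd ν
    have h12 : Integrable (fun p : EuclideanSpace ℝ (Fin d) × EuclideanSpace ℝ (Fin d) =>
      f p.1 * g p.2) (ν.prod ν) := hfi.mul_prod hgi
    have h21 : Integrable (fun p : EuclideanSpace ℝ (Fin d) × EuclideanSpace ℝ (Fin d) =>
      g p.1 * f p.2) (ν.prod ν) := hgi.mul_prod hfi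
    have hexp : ∀ p : EuclideanSpace ℝ (Fin d) × EuclideanSpace ℝ (Fin d),
        f ((2 : ℝ)⁻¹ • (p.1 + p.2)) * g ((2 : ℝ)⁻¹ • (p.1 + p.2)) =
          ((f p.1 * g p.1 + f p.2 * g p.2) + (f p.1 * g p.2 + g p.1 * f p.2)) / 4 := by
      intro p; rw [hf, hg]; ring
    have hdiag : Integrable (fun p : EuclideanSpace ℝ (Fin d) × EuclideanSpace ℝ (Fin d) =>
      f p.1 * g p.1 + f p.2 * g p.2) (ν.prod ν) := h11.add h22
    have hcross : Integrable (fun p : EuclideanSpace ℝ (Fin d) × EuclideanSpace ℝ (Fin d) =>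
      f p.1 * g p.2 + g p.1 * f p.2) (ν.prod ν) := h12.add h21
    refine ⟨(lin f hfm hf hfi hf0).1, (lin g hgm hg hgi hg0).1, ?_,
      (lin f hfm hf hfi hf0).2, (lin g hgm hg hgi hg0).2, ?_⟩
    · refine (integrable_map_measure hfgm.aestronglyMeasurable hmid.aemeasurable).2 ?_
      simp only [Function.comp_def, hexp]
      exact (hdiag.add hcross).div_const 4
    · rw [dyadicAverageLaw, integral_map hmid.aemeasurable hfgm.aestronglyMeasurable]
      simp only [hexp]
      rw [integral_div, integral_add hdiag hcross, integral_add h11 h22,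
        integral_add h12 h21, integral_prod_mul, integral_prod_mul,
        integral_fun_fst (fun x => f x * g x), integral_fun_snd (fun x => f x * g x), hf0, hg0,
        hfg]
      simp only [probReal_univ, one_smul]
      ring

theorem covMatrix_posDef_s2 {d : ℕ} {K : Set (EuclideanSpace ℝ (Fin d))}
    (hcpt : IsCompact K) (hpos : volume K ≠ 0) : (covMatrix K).PosDef := by
  have hV' : 0 < (volume K).toReal := ENNReal.toReal_pos hpos hcpt.measure_ne_top
  have hint : ∀ f : EuclideanSpace ℝ (Fin d) → ℝ, Continuous f → IntegrableOn f K :=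
    fun f hf => hf.continuousOn.integrableOn_compact hcpt
  refine Matrix.PosDef.of_dotProduct_mulVec_pos ?_ fun v hv => ?_
  · ext i j
    simp only [Matrix.conjTranspose_apply, star_trivial, covMatrix, mul_comm]
  have hquad : star v ⬝ᵥ (covMatrix K).mulVec v =
      (volume K).toReal⁻¹ * ∫ y in K, (inner ℝ (WithLp.toLp 2 v) (y - centroid K)) ^ 2 := by
    have hsq : ∀ y : EuclideanSpace ℝ (Fin d),
        (inner ℝ (WithLp.toLp 2 v) (y - centroid K)) ^ 2 =
          ∑ i, ∑ j, v i * v j * ((y i - centroid K i) * (y j - centroid K j)) := by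
      intro y
      simp only [PiLp.inner_apply, RCLike.inner_apply, conj_trivial, PiLp.sub_apply, sq,
        Finset.sum_mul_sum]
      exact Finset.sum_congr rfl fun i _ => Finset.sum_congr rfl fun j _ => by ring
    simp only [hsq]
    rw [integral_finsetSum _ fun i _ => hint _ (by fun_prop), Finset.mul_sum]
    refine Finset.sum_congr rfl fun i _ => ?_
    rw [integral_finsetSum _ fun j _ => hint _ (by fun_prop), Finset.mul_sum,
      Matrix.mulVec, dotProduct, Finset.mul_sum]
    refine Finset.sum_congr rfl fun j _ => ?_
    rw [integral_const_mul, covMatrix, Pi.star_apply, star_trivial]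
    ring
  rw [hquad]
  refine mul_pos (inv_pos.2 hV') (lt_of_le_of_ne (integral_nonneg fun _ => sq_nonneg _) ?_)
  intro h0
  have hae := (integral_eq_zero_iff_of_nonneg (fun _ => sq_nonneg _)
    (hint (fun y => (inner ℝ (WithLp.toLp 2 v) (y - centroid K)) ^ 2) (by fun_prop))).1 h0.symm
  let H : Submodule ℝ (EuclideanSpace ℝ (Fin d)) :=
    LinearMap.ker (innerSL ℝ (WithLp.toLp 2 v : EuclideanSpace ℝ (Fin d))).toLinearMap
  have hH : H ≠ ⊤ := by
    intro h
    have hmem : (WithLp.toLp 2 v : EuclideanSpace ℝ (Fin d)) ∈ H := h ▸ Submodule.mem_top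
    have hz : inner ℝ (WithLp.toLp 2 v : EuclideanSpace ℝ (Fin d)) (WithLp.toLp 2 v) = 0 := hmem
    exact hv (by simpa using hz)
  have hnull :
      volume ((fun y => y + -centroid K) ⁻¹' (H : Set (EuclideanSpace ℝ (Fin d)))) = 0 := by
    rw [measure_preimage_add_right, Measure.addHaar_submodule _ _ hH]
  rw [Filter.EventuallyEq, ae_restrict_iff' hcpt.isClosed.measurableSet] at hae
  refine hpos (measure_mono_null_ae ?_ hnull)
  filter_upwards [hae] with y hy hyK
  have := hy hyK
  simp only [Pi.zero_apply, sq_eq_zero_iff] at this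
  rw [sub_eq_add_neg] at this
  exact this

/-- The Gaussian integral of a nondegenerate quadratic form. -/
theorem integral_exp_neg_mul_sq_norm_toLpLin {d : ℕ} {B : Matrix (Fin d) (Fin d) ℝ}
    (hB : B.det ≠ 0) (c : EuclideanSpace ℝ (Fin d)) {b : ℝ} (hb : 0 < b) :
    ∫ x, Real.exp (-b * ‖B.toLpLin 2 2 (x - c)‖ ^ 2) =
      |B.det|⁻¹ * (Real.pi / b) ^ ((d : ℝ) / 2) := by
  have hdet : LinearMap.det (B.toLpLin 2 2) ≠ 0 := by rwa [LinearMap.det_toLpLin]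
  have hcont : Continuous (B.toLpLin 2 2) := LinearMap.continuous_of_finiteDimensional _
  have hG := GaussianFourier.integral_rexp_neg_mul_sq_norm (V := EuclideanSpace ℝ (Fin d)) hb
  rw [finrank_euclideanSpace_fin] at hG
  rw [integral_sub_right_eq_self (fun x => Real.exp (-b * ‖B.toLpLin 2 2 x‖ ^ 2)) c,
    ← integral_map (f := fun y => Real.exp (-b * ‖y‖ ^ 2)) hcont.measurable.aemeasurable
      (by fun_prop), Measure.map_linearMap_addHaar_eq_smul_addHaar _ hdet, integral_smul_measure,
    hG, LinearMap.det_toLpLin, ENNReal.toReal_ofReal (abs_nonneg _), abs_inv, smul_eq_mul]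

open scoped MatrixOrder in
theorem exists_transpose_mul_self_eq_inv_of_posDef {d : ℕ}
    {S : Matrix (Fin d) (Fin d) ℝ} (hS : S.PosDef) :
    ∃ B : Matrix (Fin d) (Fin d) ℝ, B.transpose * B = S⁻¹ := by
  obtain ⟨B, hB⟩ := CStarAlgebra.nonneg_iff_eq_star_mul_self.mp hS.inv.posSemidef.nonneg
  exact ⟨B, by rw [hB, Matrix.star_eq_conjTranspose, Matrix.conjTranspose_eq_transpose_of_trivial]⟩

/-- If averaging two independent uniform points of `K` increases the density by a factor at most
`M`, then `M ^ (2 ^ k - 1)` controls the concentration of the average of `2 ^ k` points. -/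
theorem exp_neg_le_of_dyadicAverageLaw_one_le {d : ℕ} {K : Set (EuclideanSpace ℝ (Fin d))}
    (hcpt : IsCompact K) (hpos : volume K ≠ 0) {M : ℝ} (hM : 0 ≤ M)
    (h : dyadicAverageLaw ((volume K)⁻¹ • volume.restrict K) 1 ≤
      ENNReal.ofReal M • (volume K)⁻¹ • volume.restrict K) (k : ℕ) {b : ℝ} (hb : 0 < b) :
    Real.exp (-b * (d / 2 ^ k)) ≤ M ^ (2 ^ k - 1) *
      (Real.sqrt (covMatrix K).det / (volume K).toReal * (Real.pi / b) ^ ((d : ℝ) / 2)) := by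
  have hV : volume K ≠ ⊤ := hcpt.measure_ne_top
  have hV' : 0 < (volume K).toReal := ENNReal.toReal_pos hpos hV
  set μ : Measure (EuclideanSpace ℝ (Fin d)) := (volume K)⁻¹ • volume.restrict K with hμ
  have hμp : IsProbabilityMeasure μ :=
    ⟨by simp [hμ, ENNReal.inv_mul_cancel hpos hV]⟩
  have hμint : ∀ f : EuclideanSpace ℝ (Fin d) → ℝ, Continuous f → Integrable f μ := fun f hf =>
    Integrable.smul_measure (hf.continuousOn.integrableOn_compact hcpt) (ENNReal.inv_ne_top.2 hpos)
  have hμeq : ∀ f : EuclideanSpace ℝ (Fin d) → ℝ,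
      ∫ x, f x ∂μ = (volume K).toReal⁻¹ * ∫ x in K, f x := fun f => by
    rw [hμ, integral_smul_measure, ENNReal.toReal_inv, smul_eq_mul]
  have hprob := isProbabilityMeasure_dyadicAverageLaw μ k
  have hle := dyadicAverageLaw_le h k
  set ν := dyadicAverageLaw μ k
  set c := centroid K with hc
  have hc0 : ∀ i, ∫ x, (x i - c i) ∂μ = 0 := by
    intro i
    have hid : Integrable (fun x : EuclideanSpace ℝ (Fin d) => x) (volume.restrict K) :=
      continuous_id.continuousOn.integrableOn_compact hcpt
    have hci : c i = (volume K).toReal⁻¹ * ∫ x in K, x i := by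
      rw [hc, centroid, PiLp.smul_apply, smul_eq_mul]
      congr 1
      exact ((EuclideanSpace.proj (𝕜 := ℝ) i).integral_comp_comm hid).symm
    rw [integral_sub (hμint _ (by fun_prop)) (integrable_const _), hμeq, ← hci]
    simp
  have hmom := fun i j => dyadicAverageLaw_moments (μ := μ)
    (f := fun x => x i - c i) (g := fun x => x j - c j) (by fun_prop) (by fun_prop)
    (fun x y => by simp only [PiLp.smul_apply, PiLp.add_apply, smul_eq_mul]; ring)
    (fun x y => by simp only [PiLp.smul_apply, PiLp.add_apply, smul_eq_mul]; ring)
    (hμint _ (by fun_prop)) (hμint _ (by fun_prop)) (hμint _ (by fun_prop)) (hc0 i) (hc0 j) k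
  have hSpos := covMatrix_posDef_s2 hcpt hpos
  obtain ⟨B, hB⟩ := exists_transpose_mul_self_eq_inv_of_posDef hSpos
  have hdetS := hSpos.det_pos
  have hBdet : B.det ^ 2 = (covMatrix K).det⁻¹ := by
    rw [← Ring.inverse_eq_inv', ← Matrix.det_nonsing_inv, ← hB, Matrix.det_mul,
      Matrix.det_transpose, sq]
  have hBne : B.det ≠ 0 := by
    intro h0
    rw [h0] at hBdet
    exact (inv_pos.2 hdetS).ne (by simpa using hBdet)
  have hBabs : |B.det|⁻¹ = Real.sqrt (covMatrix K).det := by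
    rw [← Real.sqrt_sq_eq_abs, hBdet, Real.sqrt_inv, inv_inv]
  let Q : EuclideanSpace ℝ (Fin d) → ℝ := fun x => ‖B.toLpLin 2 2 (x - c)‖ ^ 2
  have hQ : ∀ x, Q x = ∑ i, ∑ j, (covMatrix K)⁻¹ i j * ((x i - c i) * (x j - c j)) := by
    intro x
    have h1 : Q x = ((B.mulVec (x - c).ofLp) ⬝ᵥ (B.mulVec (x - c).ofLp)) := by
      simp only [Q, EuclideanSpace.real_norm_sq_eq, Matrix.toLpLin_apply, dotProduct]
      simp only [sq]
    rw [h1, ← hB, Matrix.dotProduct_mulVec, ← Matrix.mulVec_transpose, Matrix.mulVec_mulVec,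
      dotProduct]
    simp only [Matrix.mulVec, dotProduct, PiLp.sub_apply, Finset.sum_mul]
    exact Finset.sum_congr rfl fun i _ => Finset.sum_congr rfl fun j _ => by ring
  have hterm : ∀ i j, Integrable (fun x : EuclideanSpace ℝ (Fin d) =>
      (covMatrix K)⁻¹ i j * ((x i - c i) * (x j - c j))) ν := fun i j =>
    (hmom i j).2.2.1.const_mul _
  have hrowint : ∀ i, Integrable (fun x : EuclideanSpace ℝ (Fin d) =>
      ∑ j, (covMatrix K)⁻¹ i j * ((x i - c i) * (x j - c j))) ν := fun i =>
    integrable_finsetSum _ fun j _ => hterm i j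
  have hQint : Integrable Q ν := by
    rw [funext hQ]
    exact integrable_finsetSum _ fun i _ => hrowint i
  have hQval : ∫ x, Q x ∂ν = d / 2 ^ k := by
    rw [integral_congr_ae (Filter.Eventually.of_forall hQ),
      integral_finsetSum _ fun i _ => hrowint i]
    have hrow : ∀ i, ∫ x, ∑ j, (covMatrix K)⁻¹ i j * ((x i - c i) * (x j - c j)) ∂ν =
        ((covMatrix K)⁻¹ * covMatrix K) i i / 2 ^ k := by
      intro i
      rw [integral_finsetSum _ fun j _ => hterm i j, Matrix.mul_apply,
        Finset.sum_div]
      refine Finset.sum_congr rfl fun j _ => ?_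
      have hcov : covMatrix K j i = ∫ x, (x i - c i) * (x j - c j) ∂μ := by
        rw [hμeq, covMatrix, ← hc]
        simp only [mul_comm (_ - c j)]
      rw [integral_const_mul, (hmom i j).2.2.2.2.2, ← hcov, mul_div_assoc]
    simp only [hrow]
    rw [Matrix.nonsing_inv_mul _ (isUnit_iff_ne_zero.2 hdetS.ne')]
    simp [div_eq_mul_inv]
  have hQc : Continuous Q := by
    have : Continuous (B.toLpLin 2 2) := LinearMap.continuous_of_finiteDimensional _
    fun_prop
  have hG := integral_exp_neg_mul_sq_norm_toLpLin hBne c hb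
  have hGint : Integrable (fun x => Real.exp (-b * Q x)) := by
    by_contra hni
    have hGpos : 0 < |B.det|⁻¹ * (Real.pi / b) ^ ((d : ℝ) / 2) := by positivity
    rw [integral_undef hni] at hG
    exact hGpos.ne hG
  have hle' : ν ≤ ENNReal.ofReal (M ^ (2 ^ k - 1) * (volume K).toReal⁻¹) • volume := by
    rw [ENNReal.ofReal_mul (by positivity), ENNReal.ofReal_pow hM,
      ENNReal.ofReal_inv_of_pos hV', ENNReal.ofReal_toReal hV, mul_smul]
    refine hle.trans ?_
    rw [hμ]
    gcongr
    exact Measure.restrict_le_self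
  have hGint' := hGint.smul_measure
    (ENNReal.ofReal_ne_top (r := M ^ (2 ^ k - 1) * (volume K).toReal⁻¹))
  calc Real.exp (-b * (d / 2 ^ k)) = Real.exp (∫ x, -b * Q x ∂ν) := by
        rw [integral_const_mul, hQval]
    _ ≤ ∫ x, Real.exp (-b * Q x) ∂ν :=
        convexOn_exp.map_integral_le Real.continuous_exp.continuousOn isClosed_univ (by simp)
          (hQint.const_mul _) (hGint'.mono_measure hle')
    _ ≤ ∫ x, Real.exp (-b * Q x)
          ∂(ENNReal.ofReal (M ^ (2 ^ k - 1) * (volume K).toReal⁻¹) • volume) :=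
        integral_mono_measure hle' (Filter.Eventually.of_forall fun _ => (Real.exp_pos _).le)
          hGint'
    _ = _ := by
        rw [integral_smul_measure, hG, hBabs, ENNReal.toReal_ofReal (by positivity), smul_eq_mul]
        ring

theorem dyadicAverageLaw_uniform_one_le {d : ℕ} {K : Set (EuclideanSpace ℝ (Fin d))}
    (hcpt : IsCompact K) (hconv : Convex ℝ K) (hpos : volume K ≠ 0) :
    dyadicAverageLaw ((volume K)⁻¹ • volume.restrict K) 1 ≤
      ENNReal.ofReal (2 ^ d * kbSym K) • (volume K)⁻¹ • volume.restrict K := by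
  have hV : volume K ≠ ⊤ := hcpt.measure_ne_top
  have hfin : IsFiniteMeasure (volume.restrict K) := ⟨by simpa using hV.lt_top⟩
  calc dyadicAverageLaw ((volume K)⁻¹ • volume.restrict K) 1
      = ((volume K)⁻¹ * (volume K)⁻¹) • ((volume.restrict K).prod (volume.restrict K)).map
          (fun p : EuclideanSpace ℝ (Fin d) × EuclideanSpace ℝ (Fin d) =>
            (2 : ℝ)⁻¹ • (p.1 + p.2)) := by
        simp only [dyadicAverageLaw]
        rw [Measure.prod_smul_left, Measure.prod_smul_right, Measure.map_smul,
          Measure.map_smul, smul_smul]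
    _ ≤ ((volume K)⁻¹ * (volume K)⁻¹) •
          (ENNReal.ofReal (2 ^ d * kbSym K) * volume K) • volume.restrict K := by
        gcongr
        exact map_midpoint_prod_restrict_le hcpt hconv hpos
    _ = _ := by
        rw [smul_smul, smul_smul]
        congr 1
        calc (volume K)⁻¹ * (volume K)⁻¹ * (ENNReal.ofReal (2 ^ d * kbSym K) * volume K)
            = ENNReal.ofReal (2 ^ d * kbSym K) * (volume K)⁻¹ * ((volume K)⁻¹ * volume K) := by
              ring
          _ = _ := by rw [ENNReal.inv_mul_cancel hpos hV, mul_one]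

/-- The choice of the number of averaged points that optimises the concentration estimate. -/
theorem exp_div_le_of_forall_dyadic {d : ℕ} (hd : 1 ≤ d) {M L : ℝ} (hM : 0 ≤ M) (hL : 0 ≤ L)
    (h : ∀ k : ℕ, Real.exp (-(d / 2)) ≤
      M ^ (2 ^ k - 1) * (L ^ d * (Real.pi / (2 ^ k / 2)) ^ ((d : ℝ) / 2))) :
    Real.exp (d / (2 ^ 15 * L ^ 2)) ≤ M := by
  have hd' : (0 : ℝ) < d := by exact_mod_cast hd
  have hexp2 : 2 * Real.pi ≤ 64 * Real.exp (-2) := by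
    have h1 : Real.exp 2 < 2.7182818286 ^ 2 := by
      rw [show (2 : ℝ) = (2 : ℕ) * 1 by norm_num, Real.exp_nat_mul]
      gcongr
      exact Real.exp_one_lt_d9
    have h2 := Real.pi_lt_d2
    have h3 : Real.exp (-2) * Real.exp 2 = 1 := by rw [← Real.exp_add]; simp
    nlinarith [Real.exp_pos (-2), Real.exp_pos 2]
  have key : ∀ k : ℕ, 64 * L ^ 2 ≤ 2 ^ k → Real.exp (d / 2) ≤ M ^ (2 ^ k - 1) := by
    intro k hk
    have hN : (0 : ℝ) < 2 ^ k := by positivity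
    have h1 : L ^ d * (Real.pi / (2 ^ k / 2)) ^ ((d : ℝ) / 2) ≤ Real.exp (-d) := by
      have e1 : L ^ d = (L ^ 2) ^ ((d : ℝ) / 2) := by
        rw [← Real.rpow_natCast L 2, ← Real.rpow_mul hL, ← Real.rpow_natCast]
        congr 1
        push_cast; ring
      have e2 : Real.exp (-d) = (Real.exp (-2)) ^ ((d : ℝ) / 2) := by
        rw [← Real.exp_mul]
        congr 1
        ring
      rw [e1, e2, ← Real.mul_rpow (by positivity) (by positivity)]
      refine Real.rpow_le_rpow (by positivity) ?_ (by positivity)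
      rw [div_div_eq_mul_div, mul_div_assoc', div_le_iff₀ hN]
      nlinarith [Real.exp_pos (-2), sq_nonneg L]
    have h2 := (h k).trans (mul_le_mul_of_nonneg_left h1 (by positivity))
    have h3 : Real.exp (-(d / 2)) = Real.exp (d / 2) * Real.exp (-d) := by
      rw [← Real.exp_add]
      congr 1
      ring
    rw [h3] at h2
    exact le_of_mul_le_mul_right h2 (Real.exp_pos _)
  have hone : 1 < Real.exp ((d : ℝ) / 2) := Real.one_lt_exp_iff.2 (by positivity)
  have hL1 : 1 ≤ 64 * L ^ 2 := by
    by_contra! hlt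
    have := key 0 (by simpa using hlt.le)
    simp only [pow_zero, Nat.sub_self] at this
    linarith
  obtain ⟨n, hn1, hn2⟩ := exists_nat_pow_near hL1 one_lt_two
  have hk := key (n + 1) hn2.le
  have hM1 : 1 ≤ M := by
    by_contra! hlt
    linarith [pow_le_one₀ (n := 2 ^ (n + 1) - 1) hM hlt.le]
  have hk' : Real.exp (d / 2) ≤ M ^ (2 ^ (n + 1)) :=
    hk.trans (pow_le_pow_right₀ hM1 (Nat.sub_le _ _))
  refine le_of_pow_le_pow_left₀ (n := 2 ^ (n + 1)) (by positivity) hM (le_trans ?_ hk')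
  have hL2 : 0 < L ^ 2 := by linarith
  rw [← Real.exp_nat_mul, Real.exp_le_exp, mul_div_assoc', div_le_div_iff₀ (by positivity)
    (by norm_num)]
  push_cast
  rw [pow_succ]
  nlinarith

/-- For every convex body `K ⊆ ℝ^d` with `d ≥ 1`,
`Δ_KB(K) ≥ exp(d / (2^15 L_K^2)) · 2^(-d)`. -/
theorem kb_lower_bound {d : ℕ} (hd : 1 ≤ d) (K : Set (EuclideanSpace ℝ (Fin d)))
    (hcpt : IsCompact K) (hconv : Convex ℝ K) (hint : (interior K).Nonempty) :
    kbSym K ≥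
      Real.exp ((d : ℝ) / (2 ^ 15 * (isotropicConstant K) ^ 2)) * ((2 : ℝ) ^ d)⁻¹ := by
  have hpos : volume K ≠ 0 := (Measure.measure_pos_of_nonempty_interior volume hint).ne'
  have hLd : isotropicConstant K ^ d =
      Real.sqrt (covMatrix K).det / (volume K).toReal := by
    rw [isotropicConstant, Real.rpow_inv_natCast_pow (by positivity) (by omega)]
  have hL : 0 ≤ isotropicConstant K := by unfold isotropicConstant; positivity
  have hM : 0 ≤ 2 ^ d * kbSym K := mul_nonneg (by positivity) (kbSym_nonneg K)
  have hmain : Real.exp ((d : ℝ) / (2 ^ 15 * isotropicConstant K ^ 2)) ≤ 2 ^ d * kbSym K := by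
    refine exp_div_le_of_forall_dyadic hd hM hL fun k => ?_
    have h := exp_neg_le_of_dyadicAverageLaw_one_le hcpt hpos hM
      (dyadicAverageLaw_uniform_one_le hcpt hconv hpos) k (b := 2 ^ k / 2) (by positivity)
    rw [← hLd] at h
    convert h using 2
    field_simp
  rw [ge_iff_le, ← div_eq_mul_inv, div_le_iff₀ (by positivity), mul_comm (kbSym K)]
  exact hmain
end
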